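/- Let k be a division ring, let A be a locally indicable group, let C₁, C₂ ≤ A be subgroups, let ψ : C₁ → C₂ be a group isomorphism, and let G = A∗_ψ = ⟨A, t ∣ t c t⁻¹ = ψ(c) for all c ∈ C₁⟩ be the corresponding HNN extension of A. If kA admits a Hughes-free embedding into a division ring, then there exist a division ring D and an injective ring homomorphism kG → D. -/

import Mathlib

/-- A subring `S` of a ring `R` is a *division subring* if every nonzero element of `S`
has a two-sided inverse lying in `S`. -/
def IsDivisionSubring {R : Type*} [Ring R] (S : Subring R) : Prop :=
  ∀ x ∈ S, x ≠ 0 → ∃ y ∈ S, x * y = 1 ∧ y * x = 1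

/-- The *division closure* of a subset `s` of a ring `R`: the smallest division subring
of `R` containing `s` (realized as the infimum of all division subrings containing `s`). -/
def divisionClosure {R : Type*} [Ring R] (s : Set R) : Subring R :=
  sInf {S : Subring R | IsDivisionSubring S ∧ s ⊆ S}

lemma subset_divisionClosure {R : Type*} [Ring R] (s : Set R) :
    s ⊆ (divisionClosure s : Set R) := fun _x hx =>
  Subring.mem_sInf.2 fun _S hS => hS.2 hx

/-- Integer powers of an element of a ring, using `Ring.inverse` for negative exponents.
When the ambient ring is a division ring this agrees with the usual `zpow`. -/
noncomputable def ringZPow {R : Type*} [Ring R] (x : R) (i : ℤ) : R :=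
  if 0 ≤ i then x ^ i.toNat else (Ring.inverse x) ^ (-i).toNat

/-- A group is *locally indicable* if every nontrivial finitely generated subgroup
admits a surjective homomorphism onto `ℤ`. -/
def LocallyIndicable (G : Type*) [Group G] : Prop :=
  ∀ H : Subgroup G, H ≠ ⊥ → H.FG →
    ∃ f : H →* Multiplicative ℤ, Function.Surjective f

/-- `φ : kG →+* D` is a *Hughes-free embedding* if it is injective, the division closure
of its image is all of `D`, and whenever `H ≤ G` is finitely generated, `K ⊴ H` and
`t ∈ H` are such that `H/K` is infinite cyclic generated by `tK`, the integer powers of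
`φ t` are left linearly independent over the division closure of `φ (kK)` in `D`. -/
def IsHughesFreeEmbedding {k : Type*} [DivisionRing k] {G : Type*} [Group G]
    {D : Type*} [Ring D] (φ : MonoidAlgebra k G →+* D) : Prop :=
  Function.Injective φ ∧
  divisionClosure (Set.range φ) = ⊤ ∧
  ∀ (H : Subgroup G), H.FG → ∀ (K : Subgroup H) (t : H),
    (∃ f : H →* Multiplicative ℤ,
        Function.Surjective f ∧ f.ker = K ∧ f t = Multiplicative.ofAdd 1) →
    ∀ c : ℤ →₀ D,
      (∀ i : ℤ, c i ∈ divisionClosure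
          (Set.range (φ.comp (MonoidAlgebra.mapDomainRingHom k (H.subtype.comp K.subtype))))) →
      (c.sum fun i a => a * ringZPow (φ (MonoidAlgebra.of k G (H.subtype t))) i) = 0 →
      c = 0

/-- A topological space is a *3-manifold* if it is nonempty, connected, Hausdorff,
second countable, and every point has an open neighbourhood homeomorphic to `ℝ³`. -/
def Is3Manifold (M : Type*) [TopologicalSpace M] : Prop :=
  Nonempty M ∧ ConnectedSpace M ∧ T2Space M ∧ SecondCountableTopology M ∧
    ∀ x : M, ∃ U : Set M, IsOpen U ∧ x ∈ U ∧ Nonempty (U ≃ₜ (Fin 3 → ℝ))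

universe w

namespace Semifir

open Matrix

section Full

variable {R : Type w} [Ring R]

/-- A square matrix is full when it does not factor through a smaller index type. -/
def Full {n : Type} [Fintype n] (P : Matrix n n R) : Prop :=
  ∀ (m : Type) [Fintype m] (X : Matrix n m R) (Y : Matrix m n R),
    P = X * Y → Fintype.card n ≤ Fintype.card m

/-- Every matrix relation `X * Y = 0` can be trivialized by an invertible matrix. -/
def TrivializesRelations (R : Type w) [Ring R] : Prop :=
  ∀ (a b c : Type) [Fintype a] [Fintype b] [Fintype c] [DecidableEq b]
    (X : Matrix a b R) (Y : Matrix b c R), X * Y = 0 →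
    ∃ U V : Matrix b b R, U * V = 1 ∧ V * U = 1 ∧
      ∀ j, (∀ i, (X * V) i j = 0) ∨ (∀ l, (U * Y) j l = 0)

theorem Full.card_le_of_set {n m : Type} [Fintype n] [Fintype m] {P : Matrix n n R}
    (hP : Full P) {X : Matrix n m R} {Y : Matrix m n R} (h : P = X * Y) (s : Set m)
    (hs : ∀ j ∉ s, (∀ i, X i j = 0) ∨ (∀ l, Y j l = 0)) :
    Fintype.card n ≤ Nat.card s := by
  classical
  rw [Nat.card_eq_fintype_card]
  refine hP s (X.submatrix id Subtype.val) (Y.submatrix Subtype.val id) ?_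
  rw [h]
  ext i l
  simp only [mul_apply, submatrix_apply, id]
  rw [← Finset.sum_subtype (Finset.univ.filter (· ∈ s)) (p := fun j => j ∈ s) (by simp)
    (fun j => X i j * Y j l), Finset.sum_filter]
  refine Finset.sum_congr rfl fun j _ => ?_
  split_ifs with hj
  · rfl
  · rcases hs j hj with h | h <;> simp [h]

theorem natCard_add_compl {m : Type} [Fintype m] (s : Set m) :
    Nat.card s + Nat.card (sᶜ : Set m) = Fintype.card m := by
  classical
  rw [← Nat.card_eq_fintype_card]
  exact Set.ncard_add_ncard_compl s

theorem Full.reindex {n m : Type} [Fintype n] [Fintype m] {P : Matrix n n R}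
    (hP : Full P) (e : m ≃ n) : Full (P.submatrix e e) := by
  intro q _ X Y h
  rw [Fintype.card_congr e]
  refine hP q (X.submatrix e.symm id) (Y.submatrix id e.symm) ?_
  have := congrArg (fun M => M.submatrix e.symm e.symm) h
  simp only [submatrix_submatrix, Equiv.self_comp_symm, submatrix_id_id] at this
  rw [this]
  ext; simp [mul_apply]

theorem Full.fromBlocks (hR : TrivializesRelations R) {n p : Type} [Fintype n] [Fintype p]
    {P : Matrix n n R} {Q : Matrix p p R} (hP : Full P) (hQ : Full Q) (C : Matrix p n R) :
    Full (Matrix.fromBlocks P 0 C Q) := by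
  classical
  intro m _ X Y h
  set X₁ : Matrix n m R := fun i j => X (Sum.inl i) j
  set X₂ : Matrix p m R := fun i j => X (Sum.inr i) j
  set Y₁ : Matrix m n R := fun i j => Y i (Sum.inl j)
  set Y₂ : Matrix m p R := fun i j => Y i (Sum.inr j)
  have h11 : P = X₁ * Y₁ := by
    ext i j; exact congrFun (congrFun h (Sum.inl i)) (Sum.inl j)
  have h12 : X₁ * Y₂ = 0 := by
    ext i j; exact (congrFun (congrFun h (Sum.inl i)) (Sum.inr j)).symm
  have h22 : Q = X₂ * Y₂ := by
    ext i j; exact congrFun (congrFun h (Sum.inr i)) (Sum.inr j)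
  obtain ⟨U, V, -, hVU, hk⟩ := hR n m p X₁ Y₂ h12
  let s : Set m := {j | ∀ l, (U * Y₂) j l = 0}
  have e1 : P = (X₁ * V) * (U * Y₁) := by
    rw [Matrix.mul_assoc, ← Matrix.mul_assoc V, hVU, Matrix.one_mul, h11]
  have e2 : Q = (X₂ * V) * (U * Y₂) := by
    rw [Matrix.mul_assoc, ← Matrix.mul_assoc V, hVU, Matrix.one_mul, h22]
  have c1 := hP.card_le_of_set e1 s fun j hj => (hk j).imp_right fun h => absurd h hj
  have c2 := hQ.card_le_of_set e2 sᶜ fun j hj => Or.inr (not_not.mp hj)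
  have := natCard_add_compl s
  rw [Fintype.card_sum]
  omega

theorem full_of_isEmpty {n : Type} [Fintype n] [IsEmpty n] (P : Matrix n n R) : Full P := by
  intro m _ X Y _
  simp

theorem full_of_ne_zero {n : Type} [Fintype n] [Unique n] (P : Matrix n n R)
    (h : P default default ≠ 0) : Full P := by
  intro m _ X Y hXY
  rw [Fintype.card_unique, Nat.one_le_iff_ne_zero, Ne, Fintype.card_eq_zero_iff]
  intro hm
  apply h
  rw [hXY]; simp [mul_apply]

end Full

section Submodules

variable {R : Type w} [Ring R] {F : Type w} [AddCommGroup F] [Module R F]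

/-- Solutions of full systems modulo `W` never force a nonzero multiple of `g` to vanish. -/
def Consistent (g : F) (W : Submodule R F) : Prop :=
  ∀ (n : Type) [Fintype n] (Q : Matrix n n R) (y : n → F), Full Q →
    (∀ i, ∑ j, Q i j • y j ∈ W) → ∀ (j : n) (r : R), y j = r • g → r = 0

theorem Consistent.exists_maximal {g : F} {W₀ : Submodule R F} (h : Consistent g W₀) :
    ∃ W, W₀ ≤ W ∧ Maximal (Consistent g) W := by
  refine zorn_le_nonempty₀ {W | Consistent g W} ?_ W₀ h
  intro c hc hchain W₁ hW₁
  refine ⟨sSup c, ?_, fun z hz => le_sSup hz⟩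
  intro n _ Q y hQ hy j r hr
  have hdir : DirectedOn (· ≤ ·) c := hchain.directedOn
  have : ∀ i, ∃ W ∈ c, ∑ j, Q i j • y j ∈ W := fun i =>
    (Submodule.mem_sSup_of_directed ⟨W₁, hW₁⟩ hdir).mp (hy i)
  choose W hWc hW using this
  obtain ⟨W', hW'c, hW'⟩ : ∃ W' ∈ c, ∀ i, W i ≤ W' := by
    classical
    have : ∀ s : Finset n, ∃ W' ∈ c, ∀ i ∈ s, W i ≤ W' := by
      intro s
      induction s using Finset.induction_on with
      | empty => exact ⟨W₁, hW₁, by simp⟩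
      | insert a s _ ih =>
        obtain ⟨W', h1, h2⟩ := ih
        obtain ⟨W'', h3, h4, h5⟩ := hdir _ h1 _ (hWc a)
        refine ⟨W'', h3, fun i hi => ?_⟩
        rcases Finset.mem_insert.mp hi with rfl | hi
        · exact h5
        · exact (h2 i hi).trans h4
    obtain ⟨W', h1, h2⟩ := this Finset.univ
    exact ⟨W', h1, fun i => h2 i (Finset.mem_univ i)⟩
  exact hc hW'c n Q y hQ (fun i => hW' i (hW i)) j r hr

theorem mem_of_full_of_maximal (hR : TrivializesRelations R) {g : F} {W : Submodule R F}
    (hW : Maximal (Consistent g) W) {n : Type} [Fintype n] {Q : Matrix n n R} (hQ : Full Q)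
    (z : n → F) (hz : ∀ i, ∑ j, Q i j • z j ∈ W) (j : n) : z j ∈ W := by
  have key : Consistent g (W ⊔ Submodule.span R (Set.range z)) := by
    intro p _ Q' y hQ' hy j' r hr
    have : ∀ i, ∃ c : n → R, ∑ j, Q' i j • y j - ∑ j, c j • z j ∈ W := by
      intro i
      obtain ⟨a, ha, b, hb, hab⟩ := Submodule.mem_sup.mp (hy i)
      obtain ⟨c, hc⟩ := (Submodule.mem_span_range_iff_exists_fun R).mp hb
      exact ⟨c, by rw [hc, ← hab]; simpa using ha⟩
    choose c hc using this
    refine hW.prop (n ⊕ p) (Matrix.fromBlocks Q 0 (of fun i j => - c i j) Q') (Sum.elim z y)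
      (hQ.fromBlocks hR hQ' _) ?_ (Sum.inr j') r hr
    rintro (i | i)
    · simpa using hz i
    · simpa [neg_smul, sub_eq_neg_add] using hc i
  exact hW.le_of_ge key le_sup_left
    (Submodule.mem_sup_right (Submodule.subset_span ⟨j, rfl⟩))

end Submodules

end Semifir

namespace Semifir

open Matrix

section FreeSystem

variable (R : Type w) [Ring R]

/-- A full square system of linear equations with a right-hand side. -/
structure FullSystem where
  size : ℕ
  mat : Matrix (Fin size) (Fin size) R
  rhs : Fin size → R
  full : Full mat

/-- The unknowns of all full systems. -/
abbrev Unknown : Type w := Σ s : FullSystem R, Fin s.size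

variable {R}

open Classical in
/-- The equations of all full systems, where `none` plays the role of the unit. -/
noncomputable def equation (x : Unknown R) : Option (Unknown R) →₀ R :=
  ∑ k, Finsupp.single (some ⟨x.1, k⟩) (x.1.mat x.2 k) - Finsupp.single none (x.1.rhs x.2)

theorem equation_none (x : Unknown R) : equation x none = - x.1.rhs x.2 := by
  simp [equation]

theorem equation_some (s : FullSystem R) (i k : Fin s.size) :
    equation ⟨s, i⟩ (some ⟨s, k⟩) = s.mat i k := by
  classical
  simp only [equation, Finsupp.sub_apply, Finsupp.finsetSum_apply]
  rw [Finset.sum_eq_single k]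
  · simp
  · intro b _ hb
    rw [Finsupp.single_apply, if_neg]
    simpa using hb
  · simp

theorem equation_some_ne {s s' : FullSystem R} (h : s ≠ s') (i : Fin s.size) (k : Fin s'.size) :
    equation ⟨s, i⟩ (some ⟨s', k⟩) = 0 := by
  classical
  simp only [equation, Finsupp.sub_apply, Finsupp.finsetSum_apply]
  rw [Finset.sum_eq_zero]
  · simp
  · intro b _
    rw [Finsupp.single_apply, if_neg]
    intro hb
    exact h (congrArg Sigma.fst (Option.some.inj hb))

theorem exists_full_finite_system (hR : TrivializesRelations R) (J : Finset (FullSystem R)) :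
    ∃ (N : Type) (_ : Fintype N) (e : N → Unknown R), Function.Injective e ∧
      (∀ x, x ∈ Set.range e ↔ x.1 ∈ J) ∧
      Full (of fun x y => equation (e x) (some (e y)) : Matrix N N R) := by
  classical
  induction J using Finset.induction_on with
  | empty =>
    refine ⟨PEmpty, inferInstance, PEmpty.elim, fun x => x.elim, by simp, full_of_isEmpty _⟩
  | insert s J hs ih =>
    obtain ⟨N, _, e, he, hr, hf⟩ := ih
    have hsJ : ∀ x, (e x).1 ∈ J := fun x => (hr _).mp ⟨x, rfl⟩
    have hne : ∀ x, s ≠ (e x).1 := fun x h => hs (h ▸ hsJ x)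
    refine ⟨Fin s.size ⊕ N, inferInstance, Sum.elim (fun i => (⟨s, i⟩ : Unknown R)) e, ?_, ?_, ?_⟩
    · refine Function.Injective.sumElim (fun i j h => ?_) he fun a b h => hne b ?_
      · simpa using h
      · exact congrArg Sigma.fst h
    · rintro ⟨s', i⟩
      rw [Set.Sum.elim_range, Set.mem_union, hr, Finset.mem_insert]
      refine or_congr_left ⟨?_, ?_⟩
      · rintro ⟨j, hj⟩
        exact (congrArg Sigma.fst hj).symm
      · rintro h
        dsimp only at h
        subst h
        exact ⟨i, rfl⟩
    · have := s.full.fromBlocks hR hf 0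
      convert this using 1
      ext (i | i) (j | j)
      · simp [equation_some]
      · simpa using equation_some_ne (hne j) i (e j).2
      · simpa using equation_some_ne (hne i).symm (e i).2 j
      · simp

theorem consistent_equations (hR : TrivializesRelations R) :
    Consistent (Finsupp.single none 1 : Option (Unknown R) →₀ R)
      (Submodule.span R (Set.range equation)) := by
  classical
  intro a _ Q y hQ hy j₀ r hr
  choose c hc using fun i => Finsupp.mem_span_range_iff_exists_finsupp.mp (hy i)
  let J : Finset (FullSystem R) := Finset.univ.biUnion fun i => (c i).support.image Sigma.fst
  obtain ⟨N, _, e, he, her, hf⟩ := exists_full_finite_system hR J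
  have hc' : ∀ i, ∑ j, Q i j • y j = ∑ n, c i (e n) • equation (e n) := by
    intro i
    rw [← hc i, Finsupp.sum]
    rw [← Finset.sum_image (s := Finset.univ) (g := e) (f := fun x => c i x • equation x)
      (fun x _ y _ h => he h)]
    refine Finset.sum_subset ?_ ?_
    · intro x hx
      have : x.1 ∈ J := Finset.mem_biUnion.mpr
        ⟨i, Finset.mem_univ _, Finset.mem_image_of_mem _ hx⟩
      obtain ⟨n, hn⟩ := (her x).mpr this
      exact Finset.mem_image.mpr ⟨n, Finset.mem_univ _, hn⟩
    · intro x _ hx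
      rw [Finsupp.notMem_support_iff.mp hx, zero_smul]
  let X : Matrix a (a ⊕ N) R := fromCols Q (of fun i n => - c i (e n))
  let Z : Matrix (a ⊕ N) (Option N) R :=
    fromRows (of fun j l => y j (l.map e)) (of fun n l => equation (e n) (l.map e))
  have hXZ : X * Z = 0 := by
    simp only [X, Z, fromCols_mul_fromRows]
    ext i l
    have := congrArg (fun f => f (l.map e)) (hc' i)
    simp only [Finsupp.finsetSum_apply, Finsupp.smul_apply, smul_eq_mul] at this
    simp only [Matrix.add_apply, mul_apply, of_apply, this, neg_mul, Finset.sum_neg_distrib,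
      add_neg_cancel, Matrix.zero_apply]
  obtain ⟨U, V, -, hVU, hk⟩ := hR _ _ _ X Z hXZ
  let s : Set (a ⊕ N) := {j | ∀ l, (U * Z) j l = 0}
  let E : Matrix (a ⊕ N) a R := fromRows 1 0
  have e1 : Q = (X * V) * (U * E) := by
    rw [Matrix.mul_assoc, ← Matrix.mul_assoc V, hVU, Matrix.one_mul, fromCols_mul_fromRows]
    simp
  have c1 := hQ.card_le_of_set e1 s fun j hj => (hk j).imp_right fun h => absurd h hj
  have c2 := natCard_add_compl s
  rw [Fintype.card_sum] at c2
  by_contra hr0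
  let K : Matrix (Unit ⊕ N) (Unit ⊕ N) R := Matrix.fromBlocks (of fun _ _ => r) 0
    (of fun n _ => equation (e n) none) (of fun x y => equation (e x) (some (e y)))
  have hK : Full K := (full_of_ne_zero _ hr0).fromBlocks hR hf _
  let f : Unit ⊕ N → a ⊕ N := Sum.map (fun _ => j₀) id
  let g : Unit ⊕ N → Option N := Sum.elim (fun _ => none) some
  have e2 : K = (V.submatrix f id) * (U * Z).submatrix id g := by
    rw [← submatrix_mul _ _ _ _ _ Function.bijective_id, ← Matrix.mul_assoc, hVU, Matrix.one_mul]
    ext (i | i) (j | j)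
    · simp [K, Z, f, g, hr]
    · simp [K, Z, f, g, hr]
    · simp [K, Z, f, g]
    · simp [K, Z, f, g]
  have c3 := hK.card_le_of_set e2 sᶜ fun j hj => Or.inr fun l => not_not.mp hj (g l)
  rw [Fintype.card_sum, Fintype.card_unit] at c3
  omega

theorem exists_module_full_bijective [Nontrivial R] (hR : TrivializesRelations R) :
    ∃ (M : Type w) (_ : AddCommGroup M) (_ : Module R M) (g : M),
      (∀ r : R, r • g = 0 → r = 0) ∧ ∀ (n : Type) [Fintype n] (P : Matrix n n R), Full P →
        Function.Bijective fun (z : n → M) i => ∑ j, P i j • z j := by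
  classical
  obtain ⟨W, hW₀, hW⟩ := (consistent_equations hR).exists_maximal
  have hinj : ∀ (n : Type) [Fintype n] (P : Matrix n n R), Full P →
      ∀ z : n → (Option (Unknown R) →₀ R) ⧸ W, (∀ i, ∑ j, P i j • z j = 0) → z = 0 := by
    intro n _ P hP z hz
    choose y hy using fun j => W.mkQ_surjective (z j)
    ext j
    rw [← hy j]
    refine (Submodule.Quotient.mk_eq_zero W).mpr (mem_of_full_of_maximal hR hW hP y (fun i => ?_) j)
    rw [← Submodule.Quotient.mk_eq_zero W, ← Submodule.mkQ_apply, map_sum]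
    simpa only [map_smul, hy] using hz i
  refine ⟨_ ⧸ W, inferInstance, inferInstance, W.mkQ (Finsupp.single none 1), ?_, ?_⟩
  · intro r hr
    rw [← map_smul] at hr
    refine hW.prop Unit (of fun _ _ => 1) (fun _ => r • Finsupp.single none 1)
      (full_of_ne_zero _ one_ne_zero) (fun i => ?_) () r rfl
    simpa using (Submodule.Quotient.mk_eq_zero W).mp hr
  intro n _ Q hQ
  refine ⟨fun z z' h => ?_, fun m => ?_⟩
  · refine sub_eq_zero.mp (hinj n Q hQ (z - z') fun i => ?_)
    have := congrFun h i
    simp only at this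
    simp [smul_sub, Finset.sum_sub_distrib, this]
  choose m' hm' using fun j => W.mkQ_surjective (m j)
  let J : Finset (FullSystem R) :=
    Finset.univ.biUnion fun i => (m' i).support.eraseNone.image Sigma.fst
  obtain ⟨N, _, e, he, her, hf⟩ := exists_full_finite_system hR J
  have hm'' : ∀ i, m' i = m' i none • Finsupp.single none 1 +
      ∑ x, m' i (some (e x)) • Finsupp.single (some (e x)) 1 := by
    intro i
    ext (_ | x)
    · simp
    · simp only [Finsupp.coe_add, Finsupp.coe_smul, Pi.add_apply, Pi.smul_apply, smul_eq_mul,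
        Finsupp.finsetSum_apply, Finsupp.single_apply]
      by_cases hx : x ∈ Set.range e
      · obtain ⟨y, rfl⟩ := hx
        simp [he.eq_iff]
      · have h1 : m' i (some x) = 0 := by
          by_contra h
          exact hx ((her x).mpr (Finset.mem_biUnion.mpr ⟨i, Finset.mem_univ _,
            Finset.mem_image_of_mem _ (by simpa using h)⟩))
        rw [h1, Finset.sum_eq_zero]
        · simp
        · intro y _
          rw [if_neg, mul_zero]
          rintro h
          exact hx ⟨y, Option.some.inj h⟩
  have heq : ∀ x, ∑ y, equation (e x) (some (e y)) • W.mkQ (Finsupp.single (some (e y)) 1) =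
      (e x).1.rhs (e x).2 • W.mkQ (Finsupp.single none 1) := by
    intro x
    have h1 : equation (e x) ∈ W := hW₀ (Submodule.subset_span ⟨_, rfl⟩)
    have h2 : equation (e x) = equation (e x) none • Finsupp.single none 1 +
      ∑ y, equation (e x) (some (e y)) • Finsupp.single (some (e y)) 1 := by
      ext (_ | z)
      · simp
      · simp only [Finsupp.coe_add, Finsupp.coe_smul, Pi.add_apply, Pi.smul_apply, smul_eq_mul,
          Finsupp.finsetSum_apply, Finsupp.single_apply]
        by_cases hx : z ∈ Set.range e
        · obtain ⟨y, rfl⟩ := hx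
          simp [he.eq_iff]
        · have h3 : equation (e x) (some z) = 0 := by
            refine equation_some_ne (s := (e x).1) (s' := z.1) (fun h => hx ((her z).mpr ?_)) _ z.2
            exact h ▸ (her _).mp ⟨x, rfl⟩
          rw [h3, Finset.sum_eq_zero]
          · simp
          · intro y _
            rw [if_neg, mul_zero]
            rintro h
            exact hx ⟨y, Option.some.inj h⟩
    rw [h2, ← Submodule.Quotient.mk_eq_zero W, ← Submodule.mkQ_apply, map_add, map_sum,
      equation_none, neg_smul, map_neg] at h1
    simp only [map_smul] at h1
    exact (neg_add_eq_zero.mp h1).symm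
  let B : Matrix (N ⊕ n) (N ⊕ n) R := Matrix.fromBlocks
    (of fun x y => equation (e x) (some (e y))) 0 (of fun i y => - m' i (some (e y))) Q
  have hB : Full B := hf.fromBlocks hR hQ _
  let c : Fin (Fintype.card (N ⊕ n)) ≃ N ⊕ n := (Fintype.equivFin _).symm
  let rhs : N ⊕ n → R := Sum.elim (fun x => (e x).1.rhs (e x).2) fun i => m' i none
  let s : FullSystem R := ⟨_, B.submatrix c c, rhs ∘ c, hB.reindex c⟩
  let u : N ⊕ n → (Option (Unknown R) →₀ R) ⧸ W :=
    fun x => W.mkQ (Finsupp.single (some ⟨s, c.symm x⟩) 1)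
  have hu : ∀ x, ∑ y, B x y • u y = rhs x • W.mkQ (Finsupp.single none 1) := by
    intro x
    have h1 : equation ⟨s, c.symm x⟩ ∈ W := hW₀ (Submodule.subset_span ⟨_, rfl⟩)
    have h2 : equation ⟨s, c.symm x⟩ =
      ∑ y, B x y • Finsupp.single (some ⟨s, c.symm y⟩) 1 - rhs x • Finsupp.single none 1 := by
      rw [equation]
      simp only [Finsupp.smul_single, smul_eq_mul, mul_one]
      rw [← c.symm.sum_comp]
      simp [s]
    rw [h2, ← Submodule.Quotient.mk_eq_zero W, ← Submodule.mkQ_apply, map_sub, map_sum] at h1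
    simp only [map_smul] at h1
    exact sub_eq_zero.mp h1
  have hux : ∀ x, u (Sum.inl x) = W.mkQ (Finsupp.single (some (e x)) 1) := by
    have := hinj N _ hf (fun x => u (Sum.inl x) - W.mkQ (Finsupp.single (some (e x)) 1)) ?_
    · exact fun x => sub_eq_zero.mp (congrFun this x)
    · intro x
      simp only [smul_sub, Finset.sum_sub_distrib, of_apply]
      rw [heq x, sub_eq_zero]
      have := hu (Sum.inl x)
      simpa [B, rhs] using this
  refine ⟨fun i => u (Sum.inr i), ?_⟩
  ext i
  have := hu (Sum.inr i)
  simp only [B, rhs, Fintype.sum_sum_type, fromBlocks_apply₂₁, fromBlocks_apply₂₂, of_apply,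
    neg_smul, Finset.sum_neg_distrib, Sum.elim_inr, hux] at this
  rw [← hm' i, hm'' i, map_add, map_sum]
  simp only [map_smul]
  rw [← this]
  simp

end FreeSystem
end Semifir

namespace Semifir

open Matrix

section RationalClosure

variable {R : Type w} [Ring R] {S : Type w} [Ring S]

/-- Full matrices over `R` act bijectively on columns over `S`. -/
def InvertsFull (ρ : R →+* S) : Prop :=
  ∀ (n : Type) [Fintype n] (P : Matrix n n R), Full P →
    Function.Bijective fun (v : n → S) i => ∑ j, ρ (P i j) * v j

theorem exists_invertsFull [Nontrivial R] (hR : TrivializesRelations R) :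
    ∃ (S : Type w) (_ : Ring S) (ρ : R →+* S), Nontrivial S ∧ InvertsFull ρ := by
  obtain ⟨M, _, _, g, hg, hM⟩ := exists_module_full_bijective hR
  refine ⟨AddMonoid.End M, inferInstance, Module.toAddMonoidEnd R M, ?_, ?_⟩
  · refine ⟨⟨0, 1, fun h => ?_⟩⟩
    have h1 : (0 : M) = g := congrArg (fun f : AddMonoid.End M => f g) h
    exact one_ne_zero (hg 1 (by rw [← h1, smul_zero]))
  · intro n _ P hP
    have hsum : ∀ (v : n → AddMonoid.End M) i m,
        (∑ j, Module.toAddMonoidEnd R M (P i j) * v j : AddMonoid.End M) m =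
          ∑ j, P i j • v j m := fun v i m => AddMonoidHom.finsetSum_apply _ _ _
    refine ⟨fun v v' h => ?_, fun s => ?_⟩
    · have : ∀ m, (fun j => v j m) = fun j => v' j m := by
        intro m
        apply (hM n P hP).1
        ext i
        have := congrArg (fun f : AddMonoid.End M => f m) (congrFun h i)
        simpa only [hsum] using this
      ext j m
      exact congrFun (this m) j
    · let T : (n → M) ≃+ (n → M) := AddEquiv.ofBijective
        ({ toFun := fun z i => ∑ j, P i j • z j
           map_zero' := by ext; simp
           map_add' := fun a b => by ext; simp [smul_add, Finset.sum_add_distrib] } :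
          (n → M) →+ (n → M)) (hM n P hP)
      let v : n → AddMonoid.End M := fun j =>
        (Pi.evalAddMonoidHom _ j).comp (T.symm.toAddMonoidHom.comp
          ({ toFun := fun m i => s i m
             map_zero' := by ext; simp
             map_add' := fun a b => by ext; simp } : M →+ (n → M)))
      refine ⟨v, ?_⟩
      ext i m
      have := congrFun (T.apply_symm_apply fun i => s i m) i
      exact (hsum v i m).trans this

variable (ρ : R →+* S)

/-- A column over `S` that solves a full linear system over `R`. -/
def IsFullSolution {n : Type} [Fintype n] (u : n → S) : Prop :=
  ∃ (P : Matrix n n R) (b : n → R), Full P ∧ ∀ i, ∑ j, ρ (P i j) * u j = ρ (b i)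

variable {ρ}

theorem IsFullSolution.sumElim (hR : TrivializesRelations R) {n m : Type} [Fintype n] [Fintype m]
    {u : n → S} {v : m → S} (hu : IsFullSolution ρ u) (hv : IsFullSolution ρ v) :
    IsFullSolution ρ (Sum.elim u v) := by
  obtain ⟨P, b, hP, h⟩ := hu
  obtain ⟨Q, c, hQ, h'⟩ := hv
  refine ⟨Matrix.fromBlocks P 0 0 Q, Sum.elim b c, hP.fromBlocks hR hQ 0, ?_⟩
  rintro (i | i)
  · simpa using h i
  · simpa using h' i

theorem IsFullSolution.sumElim_mul (hR : TrivializesRelations R) {n m : Type} [Fintype n]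
    [Fintype m] {u : n → S} {v : m → S} (hu : IsFullSolution ρ u) (hv : IsFullSolution ρ v)
    (k : m) : IsFullSolution ρ (Sum.elim v fun j => u j * v k) := by
  classical
  obtain ⟨P, b, hP, h⟩ := hu
  obtain ⟨Q, c, hQ, h'⟩ := hv
  refine ⟨Matrix.fromBlocks Q 0 (of fun i j => if j = k then - b i else 0) P, Sum.elim c 0,
    hQ.fromBlocks hR hP _, ?_⟩
  rintro (i | i)
  · simpa using h' i
  · have := congrArg (· * v k) (h i)
    simp only [Finset.sum_mul, mul_assoc] at this
    simp [this, apply_ite ρ, ite_mul]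

theorem IsFullSolution.sumElim_lin (hR : TrivializesRelations R) [Nontrivial R] {n : Type}
    [Fintype n] {u : n → S} (hu : IsFullSolution ρ u) (l : n → R) (r : R) :
    IsFullSolution ρ (Sum.elim u fun _ : Unit => ∑ j, ρ (l j) * u j + ρ r) := by
  obtain ⟨P, b, hP, h⟩ := hu
  refine ⟨Matrix.fromBlocks P 0 (of fun _ j => - l j) (of fun _ _ => 1), Sum.elim b fun _ => r,
    hP.fromBlocks hR (full_of_ne_zero _ one_ne_zero) _, ?_⟩
  rintro (i | i)
  · simpa using h i
  · simp

variable (ρ) in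
/-- The entries of solutions of full systems. -/
def IsRational (x : S) : Prop :=
  ∃ (n : Type) (_ : Fintype n) (u : n → S) (j : n), IsFullSolution ρ u ∧ u j = x

theorem isRational_map [Nontrivial R] (r : R) : IsRational ρ (ρ r) :=
  ⟨Unit, inferInstance, fun _ => ρ r, (), ⟨of fun _ _ => 1, fun _ => r,
    full_of_ne_zero _ one_ne_zero, by simp⟩, rfl⟩

theorem IsRational.mul (hR : TrivializesRelations R) {x y : S} (hx : IsRational ρ x)
    (hy : IsRational ρ y) : IsRational ρ (x * y) := by
  obtain ⟨n, _, u, j, hu, rfl⟩ := hx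
  obtain ⟨m, _, v, k, hv, rfl⟩ := hy
  exact ⟨_, inferInstance, _, Sum.inr j, hu.sumElim_mul hR hv k, rfl⟩

theorem IsRational.add (hR : TrivializesRelations R) [Nontrivial R] {x y : S}
    (hx : IsRational ρ x) (hy : IsRational ρ y) : IsRational ρ (x + y) := by
  classical
  obtain ⟨n, _, u, j, hu, rfl⟩ := hx
  obtain ⟨m, _, v, k, hv, rfl⟩ := hy
  refine ⟨_, inferInstance, _, Sum.inr (), (hu.sumElim hR hv).sumElim_lin hR
    (Sum.elim (Pi.single j 1) (Pi.single k 1)) 0, ?_⟩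
  simp [Pi.single_apply, apply_ite ρ, ite_mul]

theorem IsRational.exists_inv (hρ : InvertsFull ρ) {x : S}
    (hx : IsRational ρ x) (hx0 : x ≠ 0) : ∃ y, IsRational ρ y ∧ x * y = 1 ∧ y * x = 1 := by
  classical
  obtain ⟨n, _, u, j₀, ⟨P, b, hP, h⟩, rfl⟩ := hx
  have split : ∀ (f : n → S), ∑ j, f j = f j₀ + ∑ j ∈ Finset.univ.erase j₀, f j := fun f =>
    (Finset.add_sum_erase _ _ (Finset.mem_univ j₀)).symm
  let P' : Matrix n n R := of fun i j => if j = j₀ then b i else P i j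
  have hP'0 : ∀ i, P' i j₀ = b i := fun i => by simp [P']
  have hP'1 : ∀ i, ∀ j ∈ Finset.univ.erase j₀, P' i j = P i j := fun i j hj => by
    simp [P', Finset.ne_of_mem_erase hj]
  have hP' : Full P' := by
    intro m _ X Y hXY
    by_contra hlt
    push Not at hlt
    let K : Matrix n (Option m) R := of fun i l => l.elim (P i j₀) (X i)
    let Y' : Matrix (Option m) n R :=
      of fun l j => l.elim (if j = j₀ then 1 else 0) fun l => if j = j₀ then 0 else Y l j
    have hK : P = K * Y' := by
      ext i j
      by_cases hj : j = j₀
      · subst hj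
        simp [mul_apply, K, Y', Fintype.sum_option]
      · have : P' i j = (X * Y) i j := by rw [hXY]
        simpa [mul_apply, K, Y', Fintype.sum_option, hj, P'] using this
    have hcard : Fintype.card n = Fintype.card (Option m) := by
      refine le_antisymm (hP _ _ _ hK) ?_
      rw [Fintype.card_option]
      exact hlt
    let e : n ≃ Option m := Fintype.equivOfCardEq hcard
    have hKf : Full (K.submatrix id e) := by
      intro q _ A B hAB
      refine hP q A (B * Y'.submatrix e id) ?_
      rw [← Matrix.mul_assoc, ← hAB, ← submatrix_mul _ _ _ _ _ e.bijective, ← hK]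
      simp
    let w : Option m → S := fun l => l.elim (u j₀) fun l =>
      ∑ j ∈ Finset.univ.erase j₀, ρ (Y l j) * u j - ρ (Y l j₀)
    have hw : (fun l => w (e l)) = 0 := by
      apply (hρ n _ hKf).1
      ext i
      simp only [submatrix_apply, id, Pi.zero_apply, mul_zero, Finset.sum_const_zero]
      rw [e.sum_comp fun l => ρ (K i l) * w l, Fintype.sum_option]
      have h1 : ∀ j, P' i j = ∑ l, X i l * Y l j := fun j => by rw [hXY, mul_apply]
      have h2 := h i
      rw [split, ← hP'0, h1] at h2
      rw [Finset.sum_congr rfl fun j hj => by rw [← hP'1 i j hj, h1]] at h2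
      simp only [K, w, of_apply, Option.elim_none, Option.elim_some, mul_sub, Finset.mul_sum,
        Finset.sum_sub_distrib]
      simp only [map_sum, map_mul, Finset.sum_mul] at h2
      rw [Finset.sum_comm, ← add_sub_assoc, sub_eq_zero]
      simpa only [mul_assoc] using h2
    apply hx0
    simpa [w] using congrFun hw (e.symm none)
  obtain ⟨v, hv⟩ := (hρ n P' hP').2 fun i => ρ (P i j₀)
  have hv' : ∀ i, ρ (b i) * v j₀ + ∑ j ∈ Finset.univ.erase j₀, ρ (P i j) * v j = ρ (P i j₀) := by
    intro i
    have := congrFun hv i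
    simp only at this
    rw [split, hP'0, Finset.sum_congr rfl fun j hj => by rw [hP'1 i j hj]] at this
    exact this
  refine ⟨v j₀, ⟨n, inferInstance, v, j₀, ⟨P', fun i => P i j₀, hP', congrFun hv⟩, rfl⟩, ?_, ?_⟩
  · have : (fun j => if j = j₀ then u j₀ * v j₀ - 1 else u j * v j₀ + v j) = 0 := by
      apply (hρ n P hP).1
      ext i
      have h1 := congrArg (· * v j₀) (h i)
      rw [split, add_mul, Finset.sum_mul] at h1
      refine Eq.trans ?_ (Finset.sum_eq_zero fun j _ => mul_zero _).symm
      change ∑ j, ρ (P i j) * (if j = j₀ then u j₀ * v j₀ - 1 else u j * v j₀ + v j) = 0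
      rw [split, if_pos rfl, Finset.sum_congr rfl fun j hj => by
        rw [if_neg (Finset.ne_of_mem_erase hj), mul_add, ← mul_assoc]]
      rw [Finset.sum_add_distrib, mul_sub, ← mul_assoc, mul_one, sub_add_eq_add_sub,
        ← add_assoc, h1, hv' i, sub_self]
    simpa [sub_eq_zero] using congrFun this j₀
  · have : (fun j => if j = j₀ then v j₀ * u j₀ - 1 else v j * u j₀ + u j) = 0 := by
      apply (hρ n P' hP').1
      ext i
      have h1 := congrArg (· * u j₀) (hv' i)
      rw [add_mul, Finset.sum_mul] at h1
      refine Eq.trans ?_ (Finset.sum_eq_zero fun j _ => mul_zero _).symm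
      change ∑ j, ρ (P' i j) * (if j = j₀ then v j₀ * u j₀ - 1 else v j * u j₀ + u j) = 0
      rw [split, if_pos rfl, hP'0, Finset.sum_congr rfl fun j hj => by
        rw [if_neg (Finset.ne_of_mem_erase hj), mul_add, ← mul_assoc, hP'1 i j hj]]
      rw [Finset.sum_add_distrib, mul_sub, ← mul_assoc, mul_one, sub_add_eq_add_sub,
        ← add_assoc, h1, ← h i, split fun j => ρ (P i j) * u j, sub_self]
    simpa [sub_eq_zero] using congrFun this j₀

/-- A ring whose matrix relations are all trivializable embeds into a division ring. -/
theorem exists_divisionRing_embedding [Nontrivial R] (hR : TrivializesRelations R) :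
    ∃ (L : Type w) (_ : DivisionRing L) (φ : R →+* L), Function.Injective φ := by
  classical
  obtain ⟨S, _, ρ, _, hρ⟩ := exists_invertsFull hR
  let L : Subring S :=
    { carrier := {x | IsRational ρ x}
      mul_mem' := fun hx hy => hx.mul hR hy
      one_mem' := by simpa using isRational_map (ρ := ρ) 1
      add_mem' := fun hx hy => hx.add hR hy
      zero_mem' := by simpa using isRational_map (ρ := ρ) 0
      neg_mem' := fun {x} hx => by
        have : IsRational ρ (ρ (-1) * x) := (isRational_map _).mul hR hx
        simpa using this }
  have hL : ∀ x : L, IsUnit x ∨ x = 0 := by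
    intro x
    by_cases hx : x = 0
    · exact Or.inr hx
    · obtain ⟨y, hy, h1, h2⟩ := IsRational.exists_inv hρ x.2 fun h => hx (Subtype.ext h)
      exact Or.inl ⟨⟨x, ⟨y, hy⟩, Subtype.ext h1, Subtype.ext h2⟩, rfl⟩
  refine ⟨L, DivisionRing.ofIsUnitOrEqZero hL, ρ.codRestrict L fun r => isRational_map r, ?_⟩
  rw [injective_iff_map_eq_zero]
  intro r hr
  by_contra hr0
  have h1 : ρ r = 0 := congrArg Subtype.val hr
  have := (hρ Unit (of fun _ _ => r) (full_of_ne_zero _ hr0)).1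
    (a₁ := fun _ => 0) (a₂ := fun _ => 1) (by ext; simp [h1])
  exact zero_ne_one (congrFun this ())

end RationalClosure
end Semifir

namespace TwistedTensor

/-- Data for adjoining to a division ring `D` letters `t j` with `t j * e = α j e * t j`
for `e` in a division subring `E j`. -/
structure Data (D : Type w) [DivisionRing D] where
  J : Type
  E : J → Subfield D
  α : ∀ j, E j →+* D
  ι : J → Type w
  basis : ∀ j, Module.Basis (ι j) (E j) D

variable {D : Type w} [DivisionRing D] (d : Data D)

/-- The letter `⟨j, i⟩` stands for the product of `t j` and the `i`-th basis element. -/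
abbrev Data.Letter : Type w := Σ j, d.ι j

/-- The ring freely generated by `D` and letters `t j` subject to the commutation rules,
as a left vector space over `D`. -/
def TensorRing : Type w := List d.Letter →₀ D

noncomputable instance : AddCommGroup (TensorRing d) := inferInstanceAs (AddCommGroup (_ →₀ D))
noncomputable instance : Module D (TensorRing d) := inferInstanceAs (Module D (_ →₀ D))

/-- Compatibility of operators on a `D`-space with the commutation rules. -/
def IsTwisted {M : Type w} [AddCommGroup M] [Module D M] (τ : d.J → M →+ M) : Prop :=
  ∀ j (e : d.E j) (m : M), τ j ((e : D) • m) = d.α j e • τ j m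

section Action

variable {d} {M N : Type w} [AddCommGroup M] [Module D M] [AddCommGroup N] [Module D N]

/-- The action of a word. -/
noncomputable def wordAct (τ : d.J → M →+ M) : List d.Letter → M →+ M
  | [] => AddMonoidHom.id M
  | x :: l => (τ x.1).comp ((DistribSMul.toAddMonoidHom M (d.basis x.1 x.2)).comp (wordAct τ l))

@[simp] theorem wordAct_nil (τ : d.J → M →+ M) (m : M) : wordAct τ [] m = m := rfl

@[simp] theorem wordAct_cons (τ : d.J → M →+ M) (x : d.Letter) (l) (m : M) :
    wordAct τ (x :: l) m = τ x.1 (d.basis x.1 x.2 • wordAct τ l m) := rfl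

/-- Evaluation of an element of the tensor ring at a vector. -/
noncomputable def ev (τ : d.J → M →+ M) (m : M) : TensorRing d →ₗ[D] M :=
  Finsupp.linearCombination D fun l => wordAct τ l m

/-- Words with a left coefficient. -/
noncomputable def word (l : List d.Letter) (a : D) : TensorRing d := Finsupp.single l a

@[simp] theorem word_zero (l : List d.Letter) : word l (0 : D) = 0 := Finsupp.single_zero l

theorem word_add (l : List d.Letter) (a b : D) : word l (a + b) = word l a + word l b :=
  Finsupp.single_add _ _ _

theorem ev_word (τ : d.J → M →+ M) (m : M) (l : List d.Letter) (a : D) :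
    ev τ m (word l a) = a • wordAct τ l m :=
  Finsupp.linearCombination_single D a l

theorem smul_word (l : List d.Letter) (a b : D) : a • word l b = word l (a * b) :=
  Finsupp.smul_single a l b

theorem addHom_ext {A : Type*} [AddCommGroup A] {f g : TensorRing d →+ A}
    (h : ∀ l a, f (word l a) = g (word l a)) : f = g :=
  Finsupp.addHom_ext h

@[elab_as_elim]
theorem induction_word {p : TensorRing d → Prop} (x : TensorRing d) (zero : p 0)
    (add : ∀ x y, p x → p y → p (x + y)) (hword : ∀ l a, p (word l a)) : p x :=
  Finsupp.induction_linear x zero add hword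

variable (d) in
/-- Left multiplication by the letter `t j`. -/
noncomputable def shift (j : d.J) : TensorRing d →+ TensorRing d :=
  Finsupp.liftAddHom fun l =>
    { toFun := fun a => ((d.basis j).repr a).sum fun i e => word (⟨j, i⟩ :: l) (d.α j e)
      map_zero' := by simp
      map_add' := fun a b => by
        rw [map_add, Finsupp.sum_add_index']
        · simp
        · intro i e f; rw [map_add, word_add] }

theorem shift_word (j : d.J) (l : List d.Letter) (a : D) :
    shift d j (word l a) = ((d.basis j).repr a).sum fun i e => word (⟨j, i⟩ :: l) (d.α j e) :=
  Finsupp.liftAddHom_apply_single _ _ _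

theorem shift_basis (j : d.J) (i : d.ι j) (l : List d.Letter) :
    shift d j (word l (d.basis j i)) = word (⟨j, i⟩ :: l) 1 := by
  rw [shift_word, Module.Basis.repr_self, Finsupp.sum_single_index]
  · simp
  · simp

theorem isTwisted_shift : IsTwisted d (shift d) := by
  intro j e x
  induction x using induction_word with
  | zero => simp
  | add x y hx hy => rw [smul_add, map_add, hx, hy, map_add, smul_add]
  | hword l a =>
    rw [smul_word, shift_word, shift_word]
    have : (d.basis j).repr ((e : D) * a) = e • (d.basis j).repr a := by
      rw [← map_smul]; rfl
    rw [this, Finsupp.sum_smul_index fun i => by simp, Finsupp.smul_sum]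
    simp [smul_word]

theorem ev_shift {τ : d.J → M →+ M} (hτ : IsTwisted d τ) (m : M) (j : d.J) (x : TensorRing d) :
    ev τ m (shift d j x) = τ j (ev τ m x) := by
  induction x using induction_word with
  | zero => simp
  | add x y hx hy => simp only [map_add, hx, hy]
  | hword l a =>
    rw [shift_word, ev_word, Finsupp.sum, map_sum]
    conv_rhs => rw [← (d.basis j).linearCombination_repr a, Finsupp.linearCombination_apply,
      Finsupp.sum, Finset.sum_smul, map_sum]
    refine Finset.sum_congr rfl fun i _ => ?_
    rw [ev_word, wordAct_cons, ← hτ, smul_smul]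
    rfl

theorem wordAct_shift_word (l l' : List d.Letter) :
    wordAct (shift d) l (word l' 1) = word (l ++ l') 1 := by
  induction l with
  | nil => rfl
  | cons x l ih => rw [wordAct_cons, ih, smul_word, mul_one, shift_basis]; rfl

theorem ev_shift_nil (x : TensorRing d) : ev (shift d) (word [] 1) x = x := by
  induction x using induction_word with
  | zero => simp
  | add x y hx hy => simp only [map_add, hx, hy]
  | hword l a => rw [ev_word, wordAct_shift_word, smul_word]; simp

theorem eq_ev {τ : d.J → M →+ M} (f : TensorRing d →ₗ[D] M)
    (hf : ∀ j x, f (shift d j x) = τ j (f x)) (x : TensorRing d) :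
    f x = ev τ (f (word [] 1)) x := by
  have key : ∀ l, f (word l 1) = wordAct τ l (f (word [] 1)) := by
    intro l
    induction l with
    | nil => rfl
    | cons x l ih =>
      rw [wordAct_cons, ← ih, ← map_smul, ← hf, smul_word, mul_one, shift_basis]
  induction x using induction_word with
  | zero => simp
  | add x y hx hy => simp only [map_add, hx, hy]
  | hword l a => rw [ev_word, ← key, ← map_smul, smul_word, mul_one]

theorem ev_add (τ : d.J → M →+ M) (m m' : M) (x : TensorRing d) :
    ev τ (m + m') x = ev τ m x + ev τ m' x := by
  induction x using induction_word with
  | zero => simp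
  | add x y hx hy => simp only [map_add, hx, hy]; abel
  | hword l a => simp only [ev_word, map_add, smul_add]

theorem ev_ev {τ : d.J → M →+ M} (hτ : IsTwisted d τ) (m : M) (x y : TensorRing d) :
    ev τ (ev τ m y) x = ev τ m (ev (shift d) y x) := by
  have := eq_ev (τ := τ) ((ev τ m).comp (ev (shift d) y)) (fun j z => ?_) x
  · rw [LinearMap.comp_apply] at this
    rw [this, LinearMap.comp_apply, ev_word, one_smul, wordAct_nil]
  · rw [LinearMap.comp_apply, ev_shift isTwisted_shift, ev_shift hτ]; rfl

end Action

noncomputable instance : Mul (TensorRing d) := ⟨fun x y => ev (shift d) y x⟩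
noncomputable instance : One (TensorRing d) := ⟨word [] 1⟩

variable {d}

theorem mul_def (x y : TensorRing d) : x * y = ev (shift d) y x := rfl
theorem one_def : (1 : TensorRing d) = word [] 1 := rfl

noncomputable instance : Ring (TensorRing d) :=
  { (inferInstance : AddCommGroup (TensorRing d)) with
    mul := (· * ·)
    one := 1
    mul_assoc := fun x y z => (ev_ev isTwisted_shift z x y).symm
    one_mul := fun x => by rw [mul_def, one_def, ev_word, one_smul, wordAct_nil]
    mul_one := fun x => ev_shift_nil x
    left_distrib := fun x y z => ev_add _ _ _ _
    right_distrib := fun x y z => map_add _ _ _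
    zero_mul := fun x => map_zero _
    mul_zero := fun x => by
      change ev (shift d) 0 x = 0
      simpa using ev_add (shift d) 0 0 x }

theorem word_mul (l : List d.Letter) (a : D) (y : TensorRing d) :
    word l a * y = a • wordAct (shift d) l y := ev_word _ _ _ _

theorem word_mul_word (l l' : List d.Letter) (a : D) :
    word l a * word l' 1 = word (l ++ l') a := by
  rw [word_mul, wordAct_shift_word, smul_word, mul_one]

variable (d) in
/-- The inclusion of the coefficients. -/
noncomputable def C : D →+* TensorRing d where
  toFun a := word [] a
  map_one' := rfl
  map_mul' a b := by rw [word_mul, wordAct_nil, smul_word]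
  map_zero' := Finsupp.single_zero _
  map_add' a b := Finsupp.single_add _ _ _

theorem C_def (a : D) : C d a = word [] a := rfl

theorem C_mul (a : D) (x : TensorRing d) : C d a * x = a • x := by
  rw [C_def, word_mul, wordAct_nil]

variable (d) in
/-- The letters. -/
noncomputable def T (j : d.J) : TensorRing d := shift d j 1

theorem T_mul (j : d.J) (x : TensorRing d) : T d j * x = shift d j x := by
  change ev (shift d) x (shift d j 1) = _
  rw [ev_shift isTwisted_shift, one_def, ev_word, one_smul, wordAct_nil]

theorem T_mul_C (j : d.J) (e : d.E j) : T d j * C d e = C d (d.α j e) * T d j := by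
  rw [T_mul, C_mul, T, ← isTwisted_shift, one_def, smul_word, mul_one, C_def]

/-- The ring action on a `D`-space with twisted operators. -/
noncomputable def act {M : Type w} [AddCommGroup M] [Module D M] {τ : d.J → M →+ M}
    (hτ : IsTwisted d τ) : TensorRing d →+* AddMonoid.End M where
  toFun x := AddMonoidHom.mk' (fun m => ev τ m x) fun m m' => ev_add τ m m' x
  map_one' := by ext m; exact (ev_word τ m [] 1).trans (one_smul _ _)
  map_mul' x y := by ext m; exact (ev_ev hτ m x y).symm
  map_zero' := by ext m; exact map_zero (ev τ m)
  map_add' x y := by ext m; exact map_add (ev τ m) x y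

theorem act_C {M : Type w} [AddCommGroup M] [Module D M] {τ : d.J → M →+ M}
    (hτ : IsTwisted d τ) (a : D) (m : M) : act hτ (C d a) m = a • m :=
  (ev_word τ m [] a)

theorem act_T {M : Type w} [AddCommGroup M] [Module D M] {τ : d.J → M →+ M}
    (hτ : IsTwisted d τ) (j : d.J) (m : M) : act hτ (T d j) m = τ j m :=
  (ev_shift hτ m j 1).trans (congrArg _ ((ev_word τ m [] 1).trans (one_smul _ _)))

theorem C_injective : Function.Injective (C d) := Finsupp.single_injective _

instance : Nontrivial (TensorRing d) := C_injective.nontrivial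

end TwistedTensor

namespace TwistedTensor

variable {D : Type w} [DivisionRing D] {d : Data D}

/-- The left coefficient of a word. -/
noncomputable def coeff (l : List d.Letter) : TensorRing d →+ D := Finsupp.applyAddHom l

theorem coeff_word_self (l : List d.Letter) (a : D) : coeff l (word l a) = a :=
  Finsupp.single_eq_same

theorem coeff_word_ne {l l' : List d.Letter} (h : l ≠ l') (a : D) : coeff l (word l' a) = 0 :=
  Finsupp.single_eq_of_ne h

theorem ext_coeff {x y : TensorRing d} (h : ∀ l, coeff l x = coeff l y) : x = y :=
  Finsupp.ext h

/-- One more than the length of the longest word in the support. -/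
noncomputable def size (x : TensorRing d) : ℕ :=
  (Finsupp.support (M := D) x).sup fun l => l.length + 1

theorem size_le_iff {x : TensorRing d} {n : ℕ} :
    size x ≤ n ↔ ∀ l, n ≤ l.length → coeff l x = 0 := by
  rw [size, Finset.sup_le_iff]
  refine forall_congr' fun l => ?_
  have : l ∈ Finsupp.support (M := D) x ↔ coeff l x ≠ 0 := Finsupp.mem_support_iff
  rw [this, not_imp_comm, Nat.succ_le_iff, not_lt]

theorem size_zero : size (0 : TensorRing d) = 0 :=
  Nat.le_zero.mp (size_le_iff.mpr fun _ _ => map_zero _)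

theorem size_eq_zero {x : TensorRing d} : size x = 0 ↔ x = 0 := by
  refine ⟨fun h => ext_coeff fun l => ?_, fun h => h ▸ size_zero⟩
  rw [map_zero]
  exact size_le_iff.mp h.le l (Nat.zero_le _)

theorem size_pos {x : TensorRing d} (h : x ≠ 0) : 0 < size x :=
  Nat.pos_of_ne_zero fun h' => h (size_eq_zero.mp h')

theorem size_sub_le {x y : TensorRing d} {n : ℕ} (hx : size x ≤ n) (hy : size y ≤ n) :
    size (x - y) ≤ n := by
  rw [size_le_iff] at *
  intro l hl
  rw [map_sub, hx l hl, hy l hl, sub_zero]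

theorem size_sum_le {σ : Type*} (s : Finset σ) {f : σ → TensorRing d} {n : ℕ}
    (h : ∀ i ∈ s, size (f i) ≤ n) : size (∑ i ∈ s, f i) ≤ n := by
  rw [size_le_iff]
  intro l hl
  rw [map_sum]
  exact Finset.sum_eq_zero fun i hi => size_le_iff.mp (h i hi) l hl

theorem size_smul_le (a : D) {x : TensorRing d} {n : ℕ} (hx : size x ≤ n) :
    size (a • x) ≤ n := by
  rw [size_le_iff] at *
  intro l hl
  have : coeff l (a • x) = a * coeff l x := rfl
  rw [this, hx l hl, mul_zero]

theorem size_word_le (l : List d.Letter) (a : D) : size (word l a) ≤ l.length + 1 := by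
  rw [size_le_iff]
  intro l' hl'
  exact coeff_word_ne (by rintro rfl; omega) a

theorem eq_sum_word (x : TensorRing d) :
    x = ∑ l ∈ Finsupp.support (M := D) x, word l (coeff l x) :=
  (Finsupp.sum_single (M := D) x).symm

theorem length_lt_size {x : TensorRing d} {l : List d.Letter} (h : coeff l x ≠ 0) :
    l.length < size x := by
  by_contra h'
  exact h (size_le_iff.mp le_rfl l (not_lt.mp h'))

theorem length_lt_of_mem_support {x : TensorRing d} {l : List d.Letter}
    (h : l ∈ Finsupp.support (M := D) x) : l.length < size x :=
  length_lt_size (Finsupp.mem_support_iff.mp h)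

theorem size_shift_le (j : d.J) {x : TensorRing d} {n : ℕ} (hx : size x ≤ n) :
    size (shift d j x) ≤ n + 1 := by
  rw [eq_sum_word x, map_sum]
  refine size_sum_le _ fun l hl => ?_
  rw [shift_word]
  refine size_sum_le _ fun i _ => (size_word_le _ _).trans ?_
  have := length_lt_of_mem_support hl
  simp only [List.length_cons]
  omega

theorem size_wordAct_le (l : List d.Letter) {x : TensorRing d} {n : ℕ} (hx : size x ≤ n) :
    size (wordAct (shift d) l x) ≤ l.length + n := by
  induction l with
  | nil => simpa using hx
  | cons y l ih =>
    rw [wordAct_cons, List.length_cons, add_right_comm]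
    exact size_shift_le _ (size_smul_le _ ih)

theorem size_mul_le {x y : TensorRing d} {n m : ℕ} (hx : size x ≤ n) (hy : size y ≤ m + 1) :
    size (x * y) ≤ n + m := by
  rw [eq_sum_word x, Finset.sum_mul]
  refine size_sum_le _ fun l hl => ?_
  rw [word_mul]
  refine size_smul_le _ ((size_wordAct_le l hy).trans ?_)
  have := length_lt_of_mem_support hl
  omega

theorem size_mul_C_le {x : TensorRing d} {n : ℕ} (hx : size x ≤ n) (a : D) :
    size (x * C d a) ≤ n :=
  size_mul_le (m := 0) hx (size_word_le [] a)

theorem eq_C_of_size_le_one {x : TensorRing d} (h : size x ≤ 1) : x = C d (coeff [] x) := by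
  refine ext_coeff fun l => ?_
  by_cases hl : l = []
  · subst hl; exact (coeff_word_self _ _).symm
  · rw [size_le_iff.mp h l (List.length_pos_iff.mpr hl)]
    exact (coeff_word_ne hl _).symm

/-- The coefficient of words ending in the letter `x`. -/
noncomputable def cut (x : d.Letter) : TensorRing d →+ TensorRing d :=
  Finsupp.comapDomain.addMonoidHom (f := fun l : List d.Letter => l ++ [x])
    (List.append_left_injective [x])

theorem coeff_cut (x : d.Letter) (l : List d.Letter) (u : TensorRing d) :
    coeff l (cut x u) = coeff (l ++ [x]) u := rfl

theorem size_cut_le (x : d.Letter) {u : TensorRing d} {n : ℕ} (h : size u ≤ n + 1) :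
    size (cut x u) ≤ n := by
  rw [size_le_iff] at *
  intro l hl
  exact h _ (by simpa using hl)

theorem exists_le_size_cut {u : TensorRing d} {n : ℕ} (h : n + 2 ≤ size u) :
    ∃ x, n + 1 ≤ size (cut x u) := by
  by_contra! hn
  have : size u ≤ n + 1 := by
    rw [size_le_iff]
    intro l hl
    rcases List.eq_nil_or_concat' l with rfl | ⟨l', x, rfl⟩
    · simp at hl
    · rw [← coeff_cut]
      refine size_le_iff.mp (Nat.lt_succ_iff.mp (hn x)) _ ?_
      simpa using hl
  omega

theorem cut_mul_letter [DecidableEq d.Letter] (x x' : d.Letter) (u : TensorRing d) :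
    cut x (u * word [x'] 1) = if x' = x then u else 0 := by
  induction u using induction_word with
  | zero => simp
  | add a b ha hb =>
    rw [add_mul, map_add, ha, hb]
    split_ifs <;> simp
  | hword l a =>
    rw [word_mul_word]
    refine ext_coeff fun l' => ?_
    rw [coeff_cut]
    split_ifs with h
    · subst h
      by_cases hl : l' = l
      · subst hl; rw [coeff_word_self, coeff_word_self]
      · rw [coeff_word_ne hl, coeff_word_ne]
        intro h; exact hl (List.append_left_injective [x'] h)
    · rw [map_zero, coeff_word_ne]
      intro h'
      exact h (by simpa using congrArg List.getLast? h'.symm)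

theorem cut_mul (x : d.Letter) (u y : TensorRing d) :
    cut x (u * y) = cut x (u * C d (coeff [] y)) + u * cut x y := by
  classical
  induction y using induction_word with
  | zero => simp
  | add a b ha hb =>
    simp only [mul_add, map_add, ha, hb]
    abel
  | hword l a =>
    rcases List.eq_nil_or_concat' l with rfl | ⟨l', x', rfl⟩
    · rw [coeff_word_self, C_def]
      have : cut x (word [] a) = 0 := by
        refine ext_coeff fun l => ?_
        rw [coeff_cut, map_zero, coeff_word_ne]
        simp
      rw [this, mul_zero, add_zero]
    · rw [coeff_word_ne (by simp), map_zero, mul_zero, map_zero, zero_add, ← word_mul_word,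
        ← mul_assoc, cut_mul_letter, cut_mul_letter, mul_ite, mul_zero]

/-- The maximal size of the entries of a column. -/
noncomputable def columnSize {a : Type} [Fintype a] (x : a → TensorRing d) : ℕ :=
  Finset.univ.sup fun i => size (x i)

theorem size_le_columnSize {a : Type} [Fintype a] (x : a → TensorRing d) (i : a) :
    size (x i) ≤ columnSize x :=
  Finset.le_sup (f := fun i => size (x i)) (Finset.mem_univ i)

theorem columnSize_pos {a : Type} [Fintype a] {x : a → TensorRing d} (h : x ≠ 0) :
    0 < columnSize x := by
  obtain ⟨i, hi⟩ := Function.ne_iff.mp h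
  exact (size_pos hi).trans_le (size_le_columnSize x i)

theorem exists_reduction_of_isUnit (N : ℕ) {a r : Type} [Fintype a] [Fintype r] [DecidableEq r]
    {x : r → a → TensorRing d} {y : r → TensorRing d}
    (h1 : ∀ j, y j ≠ 0 → columnSize (x j) + size (y j) ≤ N + 2)
    (h3 : ∀ i, size (∑ j, x j i * y j) ≤ N)
    (hA : ∃ j, y j ≠ 0 ∧ columnSize (x j) = N + 1) :
    ∃ (j₀ : r) (c : r → TensorRing d), c j₀ = 0 ∧
      columnSize (fun i => x j₀ i + ∑ j, x j i * c j) < columnSize (x j₀) := by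
  obtain ⟨j, hj, hj'⟩ := hA
  have h4 := h1 j hj
  have h5 := eq_C_of_size_le_one (x := y j) (by omega)
  set e := coeff [] (y j)
  have he : e ≠ 0 := by
    intro h
    rw [h, map_zero] at h5
    exact hj h5
  let c : r → TensorRing d := fun j' => if j' = j then 0 else y j' * C d e⁻¹
  refine ⟨j, c, if_pos rfl, ?_⟩
  rw [hj', Nat.lt_succ_iff]
  refine Finset.sup_le fun i _ => ?_
  have key : ∀ j', x j' i * y j' * C d e⁻¹ = x j' i * c j' + if j' = j then x j i else 0 := by
    intro j'
    by_cases h : j' = j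
    · subst h
      rw [mul_assoc, h5, ← map_mul, mul_inv_cancel₀ he]
      simp [c]
    · simp [c, h, mul_assoc]
  have : x j i + ∑ j', x j' i * c j' = (∑ j', x j' i * y j') * C d e⁻¹ := by
    rw [Finset.sum_mul, Finset.sum_congr rfl fun j' _ => key j']
    simp [Finset.sum_add_distrib, add_comm]
  change size (x j i + ∑ j', x j' i * c j') ≤ N
  rw [this]
  exact size_mul_C_le (h3 i) _

theorem exists_reduction (N : ℕ) {a r : Type} [Fintype a] [Fintype r] [DecidableEq r]
    (x : r → a → TensorRing d) (y : r → TensorRing d) (hx : ∀ j, y j ≠ 0 → x j ≠ 0)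
    (h1 : ∀ j, y j ≠ 0 → columnSize (x j) + size (y j) ≤ N + 2)
    (h2 : ∃ j, y j ≠ 0 ∧ columnSize (x j) + size (y j) = N + 2)
    (h3 : ∀ i, size (∑ j, x j i * y j) ≤ N) :
    ∃ (j₀ : r) (c : r → TensorRing d), c j₀ = 0 ∧
      columnSize (fun i => x j₀ i + ∑ j, x j i * c j) < columnSize (x j₀) := by
  induction N generalizing y with
  | zero =>
    exact exists_reduction_of_isUnit 0 h1 h3 (by
      obtain ⟨j, hj, hj'⟩ := h2
      have h4 := size_pos hj
      have h5 := columnSize_pos (hx j hj)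
      exact ⟨j, hj, by omega⟩)
  | succ N ih =>
    by_cases hA : ∃ j, y j ≠ 0 ∧ columnSize (x j) = N + 2
    · exact exists_reduction_of_isUnit (N + 1) h1 h3 hA
    push Not at hA
    obtain ⟨j₁, hj₁, hj₁'⟩ := h2
    have hle : ∀ j, y j ≠ 0 → columnSize (x j) ≤ N + 1 := by
      intro j hj
      have := h1 j hj
      have := size_pos hj
      have := hA j hj
      omega
    obtain ⟨n, hn⟩ : ∃ n, size (y j₁) = n + 2 :=
      ⟨size (y j₁) - 2, by have := hle j₁ hj₁; omega⟩
    obtain ⟨l, hl⟩ := exists_le_size_cut hn.ge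
    have hcut : ∀ j, cut l (y j) ≠ 0 → y j ≠ 0 := fun j hj h => hj (by rw [h, map_zero])
    have hsz : ∀ j, y j ≠ 0 → size (cut l (y j)) + 1 ≤ size (y j) := by
      intro j hj
      obtain ⟨n, hn⟩ := Nat.exists_eq_succ_of_ne_zero (size_pos hj).ne'
      have := size_cut_le l hn.le
      omega
    refine ih (fun j => cut l (y j)) (fun j hj => hx j (hcut j hj)) (fun j hj => ?_)
      ⟨j₁, ?_, ?_⟩ fun i => ?_
    · have := h1 j (hcut j hj)
      have := hsz j (hcut j hj)
      omega
    · intro h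
      rw [h, size_zero] at hl
      omega
    · have := hsz j₁ hj₁
      omega
    · have : ∑ j, x j i * cut l (y j) =
          cut l (∑ j, x j i * y j) - ∑ j, cut l (x j i * C d (coeff [] (y j))) := by
        rw [map_sum, ← Finset.sum_sub_distrib]
        exact Finset.sum_congr rfl fun j _ => by rw [cut_mul, add_sub_cancel_left]
      rw [this]
      refine size_sub_le (size_cut_le l (h3 i)) (size_sum_le _ fun j _ => size_cut_le l ?_)
      by_cases hj : y j = 0
      · rw [hj, map_zero, map_zero, mul_zero, size_zero]
        exact Nat.zero_le _
      · exact size_mul_C_le ((size_le_columnSize (x j) i).trans (hle j hj)) _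

open Matrix in
/-- Relations over the tensor ring are trivializable. -/
theorem trivializesRelations : Semifir.TrivializesRelations (TensorRing d) := by
  intro a b c _ _ _ _ X Y hXY
  induction hn : ∑ j, columnSize (fun i => X i j) using Nat.strong_induction_on
    generalizing X Y with
  | _ n ih =>
  by_cases hdone : ∀ j, (∀ i, X i j = 0) ∨ ∀ l, Y j l = 0
  · exact ⟨1, 1, by simp, by simp, by simpa using hdone⟩
  push Not at hdone
  obtain ⟨j₁, ⟨i₁, hi₁⟩, l, hl⟩ := hdone
  classical
  let x : b → a → TensorRing d := fun j i => X i j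
  let y : b → TensorRing d := fun j => if x j = 0 then 0 else Y j l
  have hxy : ∀ i, ∑ j, x j i * y j = 0 := by
    intro i
    have : (X * Y) i l = 0 := by rw [hXY]; rfl
    rw [← this, mul_apply]
    refine Finset.sum_congr rfl fun j _ => ?_
    by_cases h : x j = 0
    · have : X i j = 0 := congrFun h i
      simp [y, h, this]
    · simp [y, h, x]
  have hx : ∀ j, y j ≠ 0 → x j ≠ 0 := fun j hj h => hj (if_pos h)
  have hj₁ : y j₁ ≠ 0 := by
    have : x j₁ ≠ 0 := fun h => hi₁ (congrFun h i₁)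
    simpa [y, this] using hl
  obtain ⟨j₂, hj₂, hmax⟩ := Finset.exists_max_image (Finset.univ.filter fun j => y j ≠ 0)
    (fun j => columnSize (x j) + size (y j)) ⟨j₁, by simpa using hj₁⟩
  rw [Finset.mem_filter] at hj₂
  have hpos : 2 ≤ columnSize (x j₂) + size (y j₂) := by
    have := columnSize_pos (hx j₂ hj₂.2)
    have := size_pos hj₂.2
    omega
  obtain ⟨N, hN⟩ := Nat.exists_eq_add_of_le' hpos
  obtain ⟨j₀, e, he, hlt⟩ := exists_reduction N x y hx
    (fun j hj => (hmax j (by simpa using hj)).trans hN.le) ⟨j₂, hj₂.2, hN⟩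
    fun i => by rw [hxy, size_zero]; exact Nat.zero_le _
  let W : Matrix b b (TensorRing d) := of fun j j' => if j' = j₀ then e j else 0
  have hWW : W * W = 0 := by
    ext j j'
    simp only [mul_apply, W, of_apply]
    exact Finset.sum_eq_zero fun k _ => by
      by_cases hk : k = j₀
      · subst hk; simp [he]
      · simp [hk]
  have hUV : (1 - W) * (1 + W) = 1 := by
    rw [sub_mul, one_mul, mul_add, mul_one, hWW]; abel
  have hVU : (1 + W) * (1 - W) = 1 := by
    rw [add_mul, one_mul, mul_sub, mul_one, hWW]; abel
  have hXW : ∀ i j, (X * (1 + W) : Matrix a b (TensorRing d)) i j =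
      if j = j₀ then x j₀ i + ∑ k, x k i * e k else X i j := by
    intro i j
    rw [Matrix.mul_add, Matrix.mul_one, Matrix.add_apply, mul_apply]
    by_cases h : j = j₀
    · subst h; simp [W, x]
    · simp [W, h]
  have hmeas : ∑ j, columnSize (fun i => (X * (1 + W) : Matrix a b (TensorRing d)) i j) < n := by
    rw [← hn]
    refine Finset.sum_lt_sum (fun j _ => ?_) ⟨j₀, Finset.mem_univ _, ?_⟩
    · simp only [hXW]
      by_cases h : j = j₀
      · subst h; simpa using hlt.le
      · simp [h]
    · simpa only [hXW, if_true] using hlt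
  have hrel : X * (1 + W) * ((1 - W) * Y) = 0 := by
    rw [Matrix.mul_assoc, ← Matrix.mul_assoc (1 + W), hVU, Matrix.one_mul, hXY]
  obtain ⟨U, V, h1, h2, h3⟩ := ih _ hmeas _ _ hrel rfl
  refine ⟨U * (1 - W), (1 + W) * V, ?_, ?_, ?_⟩
  · rw [mul_assoc, ← mul_assoc (1 - W), hUV, one_mul, h1]
  · rw [mul_assoc, ← mul_assoc V, h2, one_mul, hVU]
  · simpa only [Matrix.mul_assoc] using h3

theorem exists_divisionRing_embedding (d : Data D) :
    ∃ (L : Type w) (_ : DivisionRing L) (φ : TensorRing d →+* L), Function.Injective φ :=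
  Semifir.exists_divisionRing_embedding trivializesRelations

end TwistedTensor

namespace PowerSeriesEmbedding

open PowerSeries nonZeroDivisors

variable {L : Type w} [DivisionRing L]

theorem exists_eq_unit_mul_X_pow {f : PowerSeries L} (hf : f ≠ 0) :
    ∃ (n : ℕ) (u : (PowerSeries L)ˣ), f = (u : PowerSeries L) * (X : PowerSeries L) ^ n := by
  classical
  have hex : ∃ n, coeff n f ≠ 0 := by
    by_contra! h
    exact hf (PowerSeries.ext fun n => by simpa using h n)
  let n := Nat.find hex
  have hn : coeff n f ≠ 0 := Nat.find_spec hex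
  have hlt : ∀ m < n, coeff m f = 0 := fun m hm => not_not.mp (Nat.find_min hex hm)
  let g : PowerSeries L := PowerSeries.mk fun i => coeff (i + n) f
  have hg : constantCoeff g = (Units.mk0 _ hn : L) := by
    rw [← coeff_zero_eq_constantCoeff_apply, coeff_mk, zero_add]; rfl
  refine ⟨n, ⟨g, g.invOfUnit _, mul_invOfUnit g _ hg, invOfUnit_mul g _ hg⟩, ?_⟩
  ext i
  rw [coeff_mul_X_pow']
  split_ifs with h
  · simp [g, Nat.sub_add_cancel h]
  · exact hlt i (not_le.mp h)

instance : NoZeroDivisors (PowerSeries L) where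
  eq_zero_or_eq_zero_of_mul_eq_zero := by
    intro f g h
    by_contra! hne
    obtain ⟨n, u, rfl⟩ := exists_eq_unit_mul_X_pow hne.1
    obtain ⟨m, v, rfl⟩ := exists_eq_unit_mul_X_pow hne.2
    have h1 : (u : PowerSeries L) * ((v : PowerSeries L) * (X : PowerSeries L) ^ (n + m)) = 0 := by
      rw [← h, mul_assoc, ← mul_assoc (X ^ n), (commute_X_pow _ n).eq.symm, mul_assoc, pow_add]
    have h2 : (X : PowerSeries L) ^ (n + m) = 0 := by
      rwa [Units.mul_right_eq_zero, Units.mul_right_eq_zero] at h1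
    have := congrArg (coeff (n + m)) h2
    simp at this

theorem ore_condition (r : PowerSeries L) (s : (PowerSeries L)⁰) :
    ∃ (r' : PowerSeries L) (s' : (PowerSeries L)⁰), s' * r = r' * s := by
  obtain ⟨n, u, hs⟩ := exists_eq_unit_mul_X_pow (nonZeroDivisors.coe_ne_zero s)
  refine ⟨r * ↑u⁻¹, ⟨X ^ n, mem_nonZeroDivisors_of_ne_zero fun h => ?_⟩, ?_⟩
  · have := congrArg (coeff n) h
    simp at this
  · rw [hs, mul_assoc, Units.inv_mul_cancel_left]
    exact X_pow_mul

noncomputable instance : OreLocalization.OreSet ((PowerSeries L)⁰) where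
  ore_right_cancel r₁ r₂ s h := ⟨1, by
    have : (r₁ - r₂) * s = 0 := by rw [sub_mul, h, sub_self]
    rcases mul_eq_zero.mp this with h | h
    · rw [sub_eq_zero.mp h]
    · exact absurd h (nonZeroDivisors.coe_ne_zero s)⟩
  oreNum r s := (ore_condition r s).choose
  oreDenom r s := (ore_condition r s).choose_spec.choose
  ore_eq r s := (ore_condition r s).choose_spec.choose_spec

variable (L) in
theorem exists_divisionRing_embedding :
    ∃ (Q : Type w) (_ : DivisionRing Q) (φ : PowerSeries L →+* Q), Function.Injective φ :=
  ⟨OreLocalization ((PowerSeries L)⁰) (PowerSeries L), inferInstance,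
    OreLocalization.numeratorRingHom, OreLocalization.numeratorHom_inj
      (fun _ h => h.1)⟩

end PowerSeriesEmbedding

/-- The ordinals, with the order of the ordinals and the natural (Hessenberg) sum as addition. -/
def Cplx : Type 1 := Ordinal.{0}

namespace Cplx

open Order

noncomputable instance : ConditionallyCompleteLinearOrderBot Cplx :=
  inferInstanceAs (ConditionallyCompleteLinearOrderBot Ordinal.{0})
noncomputable instance : SuccOrder Cplx := inferInstanceAs (SuccOrder Ordinal.{0})
instance : NoMaxOrder Cplx := inferInstanceAs (NoMaxOrder Ordinal.{0})
instance : WellFoundedLT Cplx := inferInstanceAs (WellFoundedLT Ordinal.{0})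
instance : WellFoundedRelation Cplx := ⟨(· < ·), wellFounded_lt⟩
noncomputable instance : Zero Cplx := ⟨(⊥ : Cplx)⟩

theorem zero_le (a : Cplx) : 0 ≤ a := bot_le

theorem exists_upper {ι : Type 1} [Small.{0} ι] (f : ι → Cplx) : ∃ b, ∀ i, f i < b :=
  ⟨succ (⨆ i, (f i : Cplx)), fun i => lt_succ_of_le
    (Ordinal.le_iSup (fun i => (f i : Ordinal.{0})) i)⟩

theorem small_Iio (a : Cplx) : Small.{0} (Set.Iio a) := Ordinal.small_Iio (a : Ordinal.{0})

attribute [instance] small_Iio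

/-- Natural addition. -/
noncomputable def nadd (a b : Cplx) : Cplx :=
  sInf {c | (∀ x : Set.Iio a, nadd x.1 b < c) ∧ ∀ y : Set.Iio b, nadd a y.1 < c}
termination_by (a, b)
decreasing_by all_goals first | exact Prod.Lex.left _ _ x.2 | exact Prod.Lex.right _ y.2

noncomputable instance : Add Cplx := ⟨nadd⟩

theorem add_def (a b : Cplx) :
    a + b = sInf {c | (∀ x : Set.Iio a, x.1 + b < c) ∧ ∀ y : Set.Iio b, a + y.1 < c} :=
  nadd.eq_1 a b

theorem add_mem (a b : Cplx) :
    a + b ∈ {c | (∀ x : Set.Iio a, x.1 + b < c) ∧ ∀ y : Set.Iio b, a + y.1 < c} := by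
  rw [add_def]
  apply csInf_mem
  obtain ⟨c, hc⟩ := exists_upper fun x : Set.Iio a => x.1 + b
  obtain ⟨d, hd⟩ := exists_upper fun y : Set.Iio b => a + y.1
  exact ⟨max c d, fun x => (hc x).trans_le (le_max_left _ _),
    fun y => (hd y).trans_le (le_max_right _ _)⟩

theorem add_lt_add_right' {x a : Cplx} (h : x < a) (b : Cplx) : x + b < a + b :=
  (add_mem a b).1 ⟨x, h⟩

theorem add_lt_add_left' {y b : Cplx} (h : y < b) (a : Cplx) : a + y < a + b :=
  (add_mem a b).2 ⟨y, h⟩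

theorem add_le_iff {a b c : Cplx} :
    a + b ≤ c ↔ (∀ x < a, x + b < c) ∧ ∀ y < b, a + y < c := by
  refine ⟨fun h => ⟨fun x hx => (add_lt_add_right' hx b).trans_le h,
    fun y hy => (add_lt_add_left' hy a).trans_le h⟩, fun h => ?_⟩
  rw [add_def]
  exact csInf_le' ⟨fun x => h.1 x.1 x.2, fun y => h.2 y.1 y.2⟩

theorem lt_add_iff {a b c : Cplx} :
    c < a + b ↔ (∃ x < a, c ≤ x + b) ∨ ∃ y < b, c ≤ a + y := by
  rw [← not_le, add_le_iff, not_and_or]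
  push Not
  rfl

theorem add_comm' (a b : Cplx) : a + b = b + a := by
  refine le_antisymm (add_le_iff.2 ⟨fun x hx => ?_, fun y hy => ?_⟩)
    (add_le_iff.2 ⟨fun x hx => ?_, fun y hy => ?_⟩)
  · rw [add_comm' x b]; exact add_lt_add_left' hx b
  · rw [add_comm' a y]; exact add_lt_add_right' hy a
  · rw [← add_comm' a x]; exact add_lt_add_left' hx a
  · rw [← add_comm' y b]; exact add_lt_add_right' hy b
termination_by (a, b)

theorem zero_add' (a : Cplx) : 0 + a = a := by
  induction a using WellFoundedLT.induction with
  | _ a ih =>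
    refine le_antisymm (add_le_iff.2 ⟨fun x hx => absurd hx (zero_le x).not_gt, fun y hy => ?_⟩) ?_
    · rwa [ih y hy]
    · refine le_of_forall_lt fun c hc => ?_
      rw [← ih c hc]
      exact add_lt_add_left' hc 0

theorem add_assoc' (a b c : Cplx) : a + b + c = a + (b + c) := by
  refine le_antisymm (add_le_iff.2 ⟨fun x hx => ?_, fun z hz => ?_⟩)
    (add_le_iff.2 ⟨fun x hx => ?_, fun y hy => ?_⟩)
  · rcases lt_add_iff.1 hx with ⟨a', ha, hle⟩ | ⟨b', hb, hle⟩
    · refine lt_of_le_of_lt (b := a' + b + c) ?_ ?_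
      · rcases hle.lt_or_eq with h | h
        · exact (add_lt_add_right' h c).le
        · rw [h]
      · rw [add_assoc' a' b c]; exact add_lt_add_right' ha _
    · refine lt_of_le_of_lt (b := a + b' + c) ?_ ?_
      · rcases hle.lt_or_eq with h | h
        · exact (add_lt_add_right' h c).le
        · rw [h]
      · rw [add_assoc' a b' c]; exact add_lt_add_left' (add_lt_add_right' hb _) _
  · rw [add_assoc' a b z]; exact add_lt_add_left' (add_lt_add_left' hz _) _
  · rw [← add_assoc' x b c]; exact add_lt_add_right' (add_lt_add_right' hx _) _
  · rcases lt_add_iff.1 hy with ⟨b', hb, hle⟩ | ⟨c', hc, hle⟩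
    · refine lt_of_le_of_lt (b := a + (b' + c)) ?_ ?_
      · rcases hle.lt_or_eq with h | h
        · exact (add_lt_add_left' h a).le
        · rw [h]
      · rw [← add_assoc' a b' c]; exact add_lt_add_right' (add_lt_add_left' hb _) _
    · refine lt_of_le_of_lt (b := a + (b + c')) ?_ ?_
      · rcases hle.lt_or_eq with h | h
        · exact (add_lt_add_left' h a).le
        · rw [h]
      · rw [← add_assoc' a b c']; exact add_lt_add_left' hc _
termination_by (a, b, c)

noncomputable instance : AddCommMonoid Cplx where
  add_assoc := add_assoc'
  zero_add := zero_add'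
  add_zero a := by rw [add_comm', zero_add']
  add_comm := add_comm'
  nsmul := nsmulRec

instance : IsOrderedCancelAddMonoid Cplx where
  add_le_add_left a b h c := by
    rcases h.lt_or_eq with h | h
    · exact (add_lt_add_right' h c).le
    · rw [h]
  le_of_add_le_add_left a b c h := le_of_not_gt fun h' => (add_lt_add_left' h' a).not_ge h

theorem le_add_left (a b : Cplx) : a ≤ b + a := le_add_of_nonneg_left (zero_le b)

theorem le_add_right (a b : Cplx) : a ≤ a + b := le_add_of_nonneg_right (zero_le b)

/-- The closure ordinal of `a` under `x ↦ succ (x + x)`. -/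
noncomputable def clos (a : Cplx) : Cplx := ⨆ n : ℕ, (fun x : Cplx => succ (x + x))^[n] a

theorem lt_clos_iff {a x : Cplx} : x < clos a ↔ ∃ n : ℕ, x < (fun x : Cplx => succ (x + x))^[n] a :=
  Ordinal.lt_iSup_iff (f := fun n : ℕ => ((fun x : Cplx => succ (x + x))^[n] a : Cplx))

theorem iterate_mono (a : Cplx) : Monotone fun n : ℕ => (fun x : Cplx => succ (x + x))^[n] a := by
  refine monotone_nat_of_le_succ fun n => ?_
  rw [Function.iterate_succ_apply']
  exact (le_add_of_nonneg_left (zero_le _)).trans (le_succ _)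

theorem lt_clos (a : Cplx) : a < clos a :=
  lt_clos_iff.2 ⟨1, lt_succ_of_le (le_add_of_nonneg_left (zero_le _))⟩

theorem add_lt_clos {a x y : Cplx} (hx : x < clos a) (hy : y < clos a) : x + y < clos a := by
  obtain ⟨n, hn⟩ := lt_clos_iff.1 hx
  obtain ⟨m, hm⟩ := lt_clos_iff.1 hy
  refine lt_clos_iff.2 ⟨max n m + 1, ?_⟩
  rw [Function.iterate_succ_apply']
  exact lt_succ_of_le (add_le_add (hn.le.trans (iterate_mono a (le_max_left n m)))
    (hm.le.trans (iterate_mono a (le_max_right n m))))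

/-- A strictly increasing enumeration of values that are closed under addition from below. -/
noncomputable def wt (c : Cplx) : Cplx :=
  clos (max c (sInf {d | ∀ x : Set.Iio c, wt x.1 < d}))
termination_by c
decreasing_by exact x.2

theorem wt_mem (c : Cplx) :
    sInf {d | ∀ x : Set.Iio c, wt x.1 < d} ∈ {d | ∀ x : Set.Iio c, wt x.1 < d} :=
  csInf_mem (exists_upper fun x : Set.Iio c => wt x.1)

theorem lt_wt (c : Cplx) : c < wt c := by
  rw [wt]; exact (le_max_left _ _).trans_lt (lt_clos _)

theorem wt_pos (c : Cplx) : 0 < wt c := (zero_le c).trans_lt (lt_wt c)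

theorem wt_strictMono : StrictMono wt := fun a b h => by
  conv_rhs => rw [wt]
  exact (wt_mem b ⟨a, h⟩).trans ((le_max_right _ _).trans_lt (lt_clos _))

theorem add_lt_wt {c x y : Cplx} (hx : x < wt c) (hy : y < wt c) : x + y < wt c := by
  rw [wt] at *
  exact add_lt_clos hx hy

end Cplx

/-- A skew Laurent configuration: the powers of `τ` are left independent over a division subring
that is normalised by `τ`. -/
structure SkewLaurent {D : Type w} [DivisionRing D] (K : Subfield D) (τ : D) : Prop where
  conj : ∀ a ∈ K, τ * a * τ⁻¹ ∈ K
  conj_inv : ∀ a ∈ K, τ⁻¹ * a * τ ∈ K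
  indep : LinearIndependent K fun j : ℤ => τ ^ j

namespace SkewLaurent

open Set

variable {D : Type w} [DivisionRing D] {K : Subfield D} {τ : D}

variable (K τ) in
/-- Laurent polynomials in `τ` with exponents in `s` and left coefficients in `K`. -/
def lau (s : Set ℤ) : Submodule K D := Submodule.span K ((fun j : ℤ => τ ^ j) '' s)

theorem ne_zero (h : SkewLaurent K τ) : τ ≠ 0 := by
  simpa using h.indep.ne_zero 1

theorem zpow_conj (h : SkewLaurent K τ) (j : ℤ) : ∀ a ∈ K, τ ^ j * a * τ ^ (-j) ∈ K := by
  have h0 := h.ne_zero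
  induction j with
  | zero => simp
  | succ n ih =>
    intro a ha
    have := h.conj _ (ih a ha)
    rw [zpow_add_one₀ h0, (Commute.self_zpow₀ τ n).symm.eq, neg_add, zpow_add₀ h0, zpow_neg_one]
    simpa only [mul_assoc] using this
  | pred n ih =>
    intro a ha
    have := h.conj_inv _ (ih a ha)
    rw [sub_eq_neg_add, zpow_add₀ h0, zpow_neg_one, neg_add, neg_neg, add_comm 1, zpow_add₀ h0,
      zpow_one]
    simpa only [mul_assoc, neg_neg] using this

theorem lau_mono {s t : Set ℤ} (h : s ⊆ t) : lau K τ s ≤ lau K τ t :=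
  Submodule.span_mono (image_mono h)

theorem zpow_mem_lau {s : Set ℤ} {j : ℤ} (h : j ∈ s) : τ ^ j ∈ lau K τ s :=
  Submodule.subset_span ⟨j, h, rfl⟩

theorem mul_zpow_mem_lau {s : Set ℤ} {j : ℤ} (h : j ∈ s) {a : D} (ha : a ∈ K) :
    a * τ ^ j ∈ lau K τ s :=
  (lau K τ s).smul_mem ⟨a, ha⟩ (zpow_mem_lau h)

theorem mul_mem_lau (h : SkewLaurent K τ) {s t r : Set ℤ} (hr : ∀ i ∈ s, ∀ j ∈ t, i + j ∈ r)
    {x y : D} (hx : x ∈ lau K τ s) (hy : y ∈ lau K τ t) : x * y ∈ lau K τ r := by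
  induction hx using Submodule.span_induction with
  | zero => rw [zero_mul]; exact zero_mem _
  | add a b _ _ iha ihb => rw [add_mul]; exact add_mem iha ihb
  | smul c a _ ih =>
    have := (lau K τ r).smul_mem c ih
    rwa [← smul_mul_assoc] at this
  | mem a ha =>
    obtain ⟨i, hi, rfl⟩ := ha
    induction hy using Submodule.span_induction with
    | zero => rw [mul_zero]; exact zero_mem _
    | add a b _ _ iha ihb => rw [mul_add]; exact add_mem iha ihb
    | smul c a _ ih =>
      have := (lau K τ r).smul_mem ⟨_, h.zpow_conj i c c.2⟩ ih
      convert this using 1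
      change τ ^ i * ((c : D) * a) = (τ ^ i * c * τ ^ (-i)) * (τ ^ i * a)
      rw [mul_assoc _ (τ ^ (-i)), ← mul_assoc (τ ^ (-i)), ← zpow_add₀ h.ne_zero, neg_add_cancel,
        zpow_zero, one_mul, mul_assoc]
    | mem a ha =>
      obtain ⟨j, hj, rfl⟩ := ha
      change τ ^ i * τ ^ j ∈ _
      rw [← zpow_add₀ h.ne_zero]
      exact zpow_mem_lau (hr i hi j hj)

theorem eq_zero_of_mul_zpow_mem (h : SkewLaurent K τ) {a : D} (ha : a ∈ K) {j : ℤ} {s : Set ℤ}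
    (hj : j ∉ s) (hm : a * τ ^ j ∈ lau K τ s) : a = 0 := by
  by_contra h0
  refine h.indep.notMem_span_image hj ?_
  have := (lau K τ s).smul_mem (⟨a, ha⟩ : K)⁻¹ hm
  change a⁻¹ * (a * τ ^ j) ∈ _ at this
  rwa [inv_mul_cancel_left₀ h0] at this

theorem exists_lowest {s : Set ℤ} {x : D} (hx : x ∈ lau K τ s) (h0 : x ≠ 0) :
    ∃ j ∈ s, ∃ a ∈ K, a ≠ 0 ∧ x - a * τ ^ j ∈ lau K τ (Ioi j) := by
  obtain ⟨l, hl, rfl⟩ := (Finsupp.mem_span_image_iff_linearCombination K).1 hx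
  have hne : l.support.Nonempty := by
    rw [Finsupp.support_nonempty_iff]
    rintro rfl
    simp at h0
  let j := l.support.min' hne
  have hj : j ∈ l.support := l.support.min'_mem hne
  refine ⟨j, hl hj, l j, (l j).2, fun h => Finsupp.mem_support_iff.1 hj (Subtype.ext h), ?_⟩
  rw [Finsupp.linearCombination_apply, Finsupp.sum, ← Finset.add_sum_erase _ _ hj]
  change (l j : D) * τ ^ j + _ - _ ∈ _
  rw [add_sub_cancel_left]
  refine sum_mem fun i hi => mul_zpow_mem_lau ?_ (l i).2
  exact lt_of_le_of_ne (l.support.min'_le i (Finset.mem_of_mem_erase hi))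
    (Finset.ne_of_mem_erase hi).symm

theorem exists_bounded {m : ℤ} {x : D} (hx : x ∈ lau K τ (Ici m)) :
    ∃ N : ℕ, ∀ N' : ℕ, N ≤ N' → x ∈ lau K τ (Icc m (m + N')) := by
  induction hx using Submodule.span_induction with
  | zero => exact ⟨0, fun _ _ => zero_mem _⟩
  | add a b _ _ iha ihb =>
    obtain ⟨N, hN⟩ := iha
    obtain ⟨M, hM⟩ := ihb
    exact ⟨max N M, fun N' h => add_mem (hN N' ((le_max_left _ _).trans h))
      (hM N' ((le_max_right _ _).trans h))⟩
  | smul c a _ ih =>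
    obtain ⟨N, hN⟩ := ih
    exact ⟨N, fun N' h => (lau K τ _).smul_mem c (hN N' h)⟩
  | mem a ha =>
    obtain ⟨j, hj, rfl⟩ := ha
    refine ⟨(j - m).toNat, fun N' h => zpow_mem_lau ⟨hj, ?_⟩⟩
    rw [mem_Ici] at hj
    omega

variable (K τ) in
/-- Laurent polynomials with constant term one and no terms of negative degree. -/
def One (b : D) : Prop := b - 1 ∈ lau K τ (Ioi 0)

theorem one_one : One K τ 1 := by rw [One, sub_self]; exact zero_mem _

theorem lau_Ioi_le {m n : ℤ} (h : n ≤ m + 1) : lau K τ (Ioi m) ≤ lau K τ (Ici n) :=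
  lau_mono fun j (hj : m < j) => show n ≤ j by omega

theorem One.mem {b : D} (hb : One K τ b) : b ∈ lau K τ (Ici 0) := by
  have h1 : (1 : D) ∈ lau K τ (Ici 0) := by
    simpa using zpow_mem_lau (K := K) (τ := τ) (s := Ici 0) (j := 0) (by simp)
  have := add_mem (lau_Ioi_le (n := 0) (by norm_num) hb) h1
  rwa [sub_add_cancel] at this

theorem One.mul (h : SkewLaurent K τ) {a b : D} (ha : One K τ a) (hb : One K τ b) :
    One K τ (a * b) := by
  have : a * b - 1 = (a - 1) * b + (b - 1) := by noncomm_ring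
  rw [One, this]
  refine add_mem (h.mul_mem_lau ?_ ha hb.mem) hb
  intro i hi j hj
  rw [mem_Ioi] at *
  rw [mem_Ici] at hj
  omega

theorem One.ne_zero (h : SkewLaurent K τ) {b : D} (hb : One K τ b) : b ≠ 0 := by
  rintro rfl
  rw [One, zero_sub, neg_mem_iff] at hb
  refine one_ne_zero (h.eq_zero_of_mul_zpow_mem (one_mem K) (j := 0) (s := Ioi 0)
    (by simp) ?_)
  simpa using hb

theorem mem_of_mul_one (h : SkewLaurent K τ) {s : Set ℤ} {y b : D} (hy : y ∈ lau K τ s)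
    (hb : One K τ b) {m : ℤ} (hm : y * b ∈ lau K τ (Ici m)) : y ∈ lau K τ (Ici m) := by
  by_cases h0 : y = 0
  · rw [h0]; exact zero_mem _
  obtain ⟨j, -, a, ha, hne, hr⟩ := exists_lowest hy h0
  have hyj : y ∈ lau K τ (Ici j) := by
    have := add_mem (lau_Ioi_le (n := j) (by omega) hr) (mul_zpow_mem_lau (mem_Ici.2 le_rfl) ha)
    rwa [sub_add_cancel] at this
  by_cases hjm : m ≤ j
  · exact lau_mono (Ici_subset_Ici.2 hjm) hyj
  refine absurd (h.eq_zero_of_mul_zpow_mem ha (j := j) (s := Ioi j) (by simp) ?_) hne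
  have h1 : a * τ ^ j = y * b - y * (b - 1) - (y - a * τ ^ j) := by noncomm_ring
  rw [h1]
  refine sub_mem (sub_mem (lau_mono (fun i (hi : m ≤ i) => show j < i by omega) hm)
    (h.mul_mem_lau (fun i (hi : j ≤ i) l (hl : 0 < l) => show j < i + l by omega) hyj hb)) hr

theorem mem_of_one_mul (h : SkewLaurent K τ) {s : Set ℤ} {y b : D} (hy : y ∈ lau K τ s)
    (hb : One K τ b) {m : ℤ} (hm : b * y ∈ lau K τ (Ici m)) : y ∈ lau K τ (Ici m) := by
  by_cases h0 : y = 0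
  · rw [h0]; exact zero_mem _
  obtain ⟨j, -, a, ha, hne, hr⟩ := exists_lowest hy h0
  have hyj : y ∈ lau K τ (Ici j) := by
    have := add_mem (lau_Ioi_le (n := j) (by omega) hr) (mul_zpow_mem_lau (mem_Ici.2 le_rfl) ha)
    rwa [sub_add_cancel] at this
  by_cases hjm : m ≤ j
  · exact lau_mono (Ici_subset_Ici.2 hjm) hyj
  refine absurd (h.eq_zero_of_mul_zpow_mem ha (j := j) (s := Ioi j) (by simp) ?_) hne
  have h1 : a * τ ^ j = b * y - (b - 1) * y - (y - a * τ ^ j) := by noncomm_ring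
  rw [h1]
  refine sub_mem (sub_mem (lau_mono (fun i (hi : m ≤ i) => show j < i by omega) hm)
    (h.mul_mem_lau (fun i (hi : 0 < i) l (hl : j ≤ l) => show j < i + l by omega) hb hyj)) hr

theorem exists_relation (h : SkewLaurent K τ) {m : ℤ} {a b : D} (ha : a ∈ lau K τ (Ici m))
    (hb : One K τ b) :
    ∃ x ∈ lau K τ (Ici 0), ∃ y ∈ lau K τ (Ici m), x * a = y * b ∧ x ≠ 0 := by
  classical
  obtain ⟨N₁, h₁⟩ := exists_bounded ha
  obtain ⟨N₂, h₂⟩ := exists_bounded hb.mem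
  let N := max N₁ N₂
  have haN := h₁ N (le_max_left _ _)
  have hbN := h₂ N (le_max_right _ _)
  let V : Submodule K D := lau K τ (Icc m (m + N + N))
  let v : Fin (N + 1) ⊕ Fin (N + 1) → D :=
    Sum.elim (fun i => τ ^ (i : ℤ) * a) fun i => τ ^ (m + i : ℤ) * b
  have hv : ∀ i, v i ∈ V := by
    rintro (i | i)
    · refine h.mul_mem_lau (s := {(i : ℤ)}) ?_ (zpow_mem_lau rfl) haN
      rintro _ rfl j ⟨hj1, hj2⟩
      have := i.2
      constructor <;> omega
    · refine h.mul_mem_lau (s := {(m + i : ℤ)}) ?_ (zpow_mem_lau rfl) hbN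
      rintro _ rfl j ⟨hj1, hj2⟩
      have := i.2
      constructor <;> omega
  have hfin : ((fun j : ℤ => τ ^ j) '' Icc m (m + N + N)).Finite := (finite_Icc _ _).image _
  have : Module.Finite K V := Module.Finite.span_of_finite K hfin
  have hcard : Module.finrank K V ≤ 2 * N + 1 := by
    have h1 := finrank_span_finset_le_card (R := K)
      ((Finset.Icc m (m + N + N)).image fun j : ℤ => τ ^ j)
    rw [Finset.coe_image, Finset.coe_Icc] at h1
    refine h1.trans (Finset.card_image_le.trans ?_)
    rw [Int.card_Icc]
    omega
  have hdep : ¬ LinearIndependent K fun i => (⟨v i, hv i⟩ : V) := fun hli => by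
    have := hli.fintype_card_le_finrank
    simp at this
    omega
  obtain ⟨g, hg, i₀, hi₀⟩ := Fintype.not_linearIndependent_iff.1 hdep
  have hg' : ∑ i, (g i : D) * v i = 0 := by
    have := congrArg (Subtype.val : V → D) hg
    simpa [Submodule.coe_sum, Subfield.smul_def] using this
  rw [Fintype.sum_sum_type] at hg'
  let x : D := ∑ i : Fin (N + 1), (g (.inl i) : D) * τ ^ (i : ℤ)
  let y : D := ∑ i : Fin (N + 1), (g (.inr i) : D) * τ ^ (m + i : ℤ)
  have hxy : x * a + y * b = 0 := by
    rw [← hg', Finset.sum_mul, Finset.sum_mul]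
    simp [v, mul_assoc]
  refine ⟨x, sum_mem fun i _ => mul_zpow_mem_lau (by simp) (g _).2, -y,
    neg_mem (sum_mem fun i _ => mul_zpow_mem_lau (by simp) (g _).2), ?_, fun hx => hi₀ ?_⟩
  · rw [neg_mul]; exact eq_neg_of_add_eq_zero_left hxy
  · have hy : y = 0 := by
      rw [hx, zero_mul, zero_add] at hxy
      exact (mul_eq_zero.1 hxy).resolve_right (hb.ne_zero h)
    rcases i₀ with i | i
    · refine Fintype.linearIndependent_iff.1
        (h.indep.comp (fun i : Fin (N + 1) => (i : ℤ)) ?_) (fun i => g (.inl i)) hx i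
      intro i j hij
      simpa [Fin.ext_iff] using hij
    · refine Fintype.linearIndependent_iff.1
        (h.indep.comp (fun i : Fin (N + 1) => (m + i : ℤ)) ?_) (fun i => g (.inr i)) hy i
      intro i j hij
      simpa [Fin.ext_iff] using hij

theorem ore (h : SkewLaurent K τ) {m : ℤ} {a b : D} (ha : a ∈ lau K τ (Ici m))
    (hb : One K τ b) :
    ∃ b', One K τ b' ∧ ∃ a' ∈ lau K τ (Ici m), b' * a = a' * b := by
  obtain ⟨x, hx, y, hy, hxy, h0⟩ := h.exists_relation ha hb
  obtain ⟨j, hj, c, hc, hc0, hr⟩ := exists_lowest hx h0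
  have hz : (c * τ ^ j)⁻¹ ∈ lau K τ {-j} := by
    rw [mul_inv_rev, ← zpow_neg]
    refine h.mul_mem_lau (s := {-j}) (t := {0}) ?_ (zpow_mem_lau rfl) ?_
    · simp
    · simpa using mul_zpow_mem_lau (K := K) (τ := τ) (s := {0}) (j := 0) rfl (inv_mem hc)
  have hne : c * τ ^ j ≠ 0 := mul_ne_zero hc0 (zpow_ne_zero _ h.ne_zero)
  have hb' : One K τ ((c * τ ^ j)⁻¹ * x) := by
    have : (c * τ ^ j)⁻¹ * x - 1 = (c * τ ^ j)⁻¹ * (x - c * τ ^ j) := by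
      rw [mul_sub, inv_mul_cancel₀ hne]
    rw [One, this]
    refine h.mul_mem_lau ?_ hz hr
    rintro _ rfl i (hi : j < i)
    rw [mem_Ioi]
    omega
  have hb'a : (c * τ ^ j)⁻¹ * x * a = (c * τ ^ j)⁻¹ * y * b := by rw [mul_assoc, hxy, mul_assoc]
  refine ⟨_, hb', _, ?_, hb'a⟩
  refine h.mem_of_mul_one (h.mul_mem_lau (r := univ) (by simp) hz hy) hb ?_
  rw [← hb'a]
  refine h.mul_mem_lau ?_ hb'.mem ha
  intro i (hi : 0 ≤ i) l (hl : m ≤ l)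
  rw [mem_Ici]
  omega

variable (K τ) in
/-- Elements of `τ`-adic valuation at least `m`. -/
def Val (m : ℤ) (x : D) : Prop := ∃ b, One K τ b ∧ b * x ∈ lau K τ (Ici m)

theorem val_of_mem {m : ℤ} {x : D} (hx : x ∈ lau K τ (Ici m)) : Val K τ m x :=
  ⟨1, one_one, by rwa [one_mul]⟩

theorem val_zero {m : ℤ} : Val K τ m 0 := val_of_mem (zero_mem _)

theorem Val.mono {m n : ℤ} (hmn : n ≤ m) {x : D} : Val K τ m x → Val K τ n x :=
  fun ⟨b, hb, hx⟩ => ⟨b, hb, lau_mono (Ici_subset_Ici.2 hmn) hx⟩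

theorem Val.neg {m : ℤ} {x : D} : Val K τ m x → Val K τ m (-x) :=
  fun ⟨b, hb, hx⟩ => ⟨b, hb, by rw [mul_neg]; exact neg_mem hx⟩

theorem Val.add (h : SkewLaurent K τ) {m : ℤ} {x y : D} :
    Val K τ m x → Val K τ m y → Val K τ m (x + y) := by
  rintro ⟨b, hb, hx⟩ ⟨c, hc, hy⟩
  obtain ⟨d, hd, e, he, hde⟩ := h.ore hb.mem hc
  refine ⟨d * b, hd.mul h hb, ?_⟩
  rw [mul_add]
  refine add_mem ?_ ?_
  · rw [mul_assoc]
    exact h.mul_mem_lau (fun i (hi : 0 ≤ i) l (hl : m ≤ l) => show m ≤ i + l by omega) hd.mem hx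
  · rw [hde, mul_assoc]
    exact h.mul_mem_lau (fun i (hi : 0 ≤ i) l (hl : m ≤ l) => show m ≤ i + l by omega) he hy

theorem Val.mul (h : SkewLaurent K τ) {m n : ℤ} {x y : D} :
    Val K τ m x → Val K τ n y → Val K τ (m + n) (x * y) := by
  rintro ⟨b, hb, hx⟩ ⟨c, hc, hy⟩
  obtain ⟨d, hd, e, he, hde⟩ := h.ore hx hc
  refine ⟨d * b, hd.mul h hb, ?_⟩
  rw [mul_assoc, ← mul_assoc b, ← mul_assoc, hde, mul_assoc]
  exact h.mul_mem_lau (fun i (hi : m ≤ i) l (hl : n ≤ l) => show m + n ≤ i + l by omega) he hy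

theorem Val.mem (h : SkewLaurent K τ) {m : ℤ} {x : D} {s : Set ℤ} :
    Val K τ m x → x ∈ lau K τ s → x ∈ lau K τ (Ici m) :=
  fun ⟨_, hb, hx⟩ hs => h.mem_of_one_mul hs hb hx

theorem eq_zero_of_val (h : SkewLaurent K τ) {x : D} (hx : ∀ m, Val K τ m x) : x = 0 := by
  obtain ⟨b, hb, hp⟩ := hx 0
  by_contra h0
  have hne : b * x ≠ 0 := mul_ne_zero (hb.ne_zero h) h0
  obtain ⟨j, -, a, ha, ha0, hr⟩ := exists_lowest hp hne
  have hv : Val K τ (j + 1) (b * x) := by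
    simpa using (val_of_mem hb.mem).mul h (hx (j + 1))
  have h1 := hv.mem h hp
  refine ha0 (h.eq_zero_of_mul_zpow_mem ha (j := j) (s := Ici (j + 1)) (by simp) ?_)
  have := sub_mem h1 (lau_Ioi_le (n := j + 1) le_rfl hr)
  rwa [sub_sub_cancel] at this

theorem val_inv_one_sub (h : SkewLaurent K τ) {y : D} (hy : Val K τ 1 y) :
    1 - y ≠ 0 ∧ Val K τ 0 (1 - y)⁻¹ := by
  obtain ⟨b, hb, hp⟩ := hy
  have hb1 : One K τ (b * (1 - y)) := by
    have : b * (1 - y) - 1 = (b - 1) - b * y := by noncomm_ring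
    rw [One, this]
    exact sub_mem hb (lau_mono (fun i (hi : 1 ≤ i) => show 0 < i by omega) hp)
  have hne : 1 - y ≠ 0 := right_ne_zero_of_mul (hb1.ne_zero h)
  exact ⟨hne, _, hb1, by rw [mul_assoc, mul_inv_cancel₀ hne, mul_one]; exact hb.mem⟩

end SkewLaurent

namespace SkewLaurent

variable {ι : Type} {D : Type w} [DivisionRing D] {K : ι → Subfield D} {τ : ι → D}

variable (K τ) in
/-- Families whose members all have valuation at least `m`. -/
def PVal (m : ℤ) (x : ι → D) : Prop := ∀ i, Val (K i) (τ i) m (x i)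

theorem PVal.mono {m n : ℤ} (hmn : n ≤ m) {x : ι → D} (hx : PVal K τ m x) : PVal K τ n x :=
  fun i => (hx i).mono hmn

theorem PVal.add (h : ∀ i, SkewLaurent (K i) (τ i)) {m : ℤ} {x y : ι → D} (hx : PVal K τ m x)
    (hy : PVal K τ m y) : PVal K τ m (x + y) :=
  fun i => (hx i).add (h i) (hy i)

theorem PVal.sum (h : ∀ i, SkewLaurent (K i) (τ i)) {α : Type*} {s : Finset α} {m : ℤ}
    {x : α → ι → D} (hx : ∀ a ∈ s, PVal K τ m (x a)) : PVal K τ m (∑ a ∈ s, x a) := by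
  classical
  induction s using Finset.induction_on with
  | empty => intro i; exact val_zero
  | insert a s ha ih =>
    rw [Finset.sum_insert ha]
    exact (hx a (Finset.mem_insert_self _ _)).add h
      (ih fun b hb => hx b (Finset.mem_insert_of_mem hb))

theorem PVal.mul (h : ∀ i, SkewLaurent (K i) (τ i)) {m n : ℤ} {x y : ι → D} (hx : PVal K τ m x)
    (hy : PVal K τ n y) : PVal K τ (m + n) (x * y) :=
  fun i => (hx i).mul (h i) (hy i)

theorem pval_mul_zpow {a : ι → D} (ha : ∀ i, a i ∈ K i) (j : ℤ) : PVal K τ j (a * τ ^ j) :=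
  fun i => val_of_mem (mul_zpow_mem_lau (Set.mem_Ici.2 le_rfl) (ha i))

theorem pval_zero_of_mem {a : ι → D} (ha : ∀ i, a i ∈ K i) : PVal K τ 0 a := by
  simpa using pval_mul_zpow (τ := τ) ha 0

variable (K τ) in
/-- `x` has arbitrarily precise Laurent expansions with coefficients in `X`. -/
def Ex (X : Set (ι → D)) (x : ι → D) : Prop :=
  ∀ M : ℤ, ∃ c : ℤ →₀ (ι → D), (∀ j, c j ∈ X) ∧ PVal K τ M (x - c.sum fun j a => a * τ ^ j)

theorem Ex.mono {X Y : Set (ι → D)} (hXY : X ⊆ Y) {x : ι → D} (hx : Ex K τ X x) : Ex K τ Y x :=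
  fun M => let ⟨c, hc, hv⟩ := hx M; ⟨c, fun j => hXY (hc j), hv⟩

theorem ex_single {X : Set (ι → D)} {a : ι → D} (ha : a ∈ X) (h0 : (0 : ι → D) ∈ X) (j : ℤ) :
    Ex K τ X (a * τ ^ j) := by
  classical
  refine fun M => ⟨Finsupp.single j a, fun i => ?_, fun i => ?_⟩
  · rw [Finsupp.single_apply]
    split_ifs
    exacts [ha, h0]
  · rw [Finsupp.sum_single_index (zero_mul _), sub_self]
    exact val_zero

theorem ex_of_mem {X : Set (ι → D)} {a : ι → D} (ha : a ∈ X) (h0 : (0 : ι → D) ∈ X) :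
    Ex K τ X a := by
  simpa using ex_single (K := K) (τ := τ) ha h0 0

theorem Ex.add (h : ∀ i, SkewLaurent (K i) (τ i)) {X Y Z : Set (ι → D)}
    (hZ : ∀ a ∈ X, ∀ b ∈ Y, a + b ∈ Z) {x y : ι → D} (hx : Ex K τ X x) (hy : Ex K τ Y y) :
    Ex K τ Z (x + y) := fun M => by
  classical
  obtain ⟨c, hc, hcv⟩ := hx M
  obtain ⟨d, hd, hdv⟩ := hy M
  refine ⟨c + d, fun j => hZ _ (hc j) _ (hd j), ?_⟩
  rw [Finsupp.sum_add_index' (fun _ => zero_mul _) (fun _ _ _ => add_mul _ _ _), add_sub_add_comm]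
  exact hcv.add h hdv

theorem ex_sum_mul_zpow {Z : AddSubgroup (ι → D)} (h : ∀ i, SkewLaurent (K i) (τ i)) {α : Type*}
    {s : Finset α} {f : α → ι → D} (hf : ∀ a ∈ s, Ex K τ Z (f a)) :
    Ex K τ Z (∑ a ∈ s, f a) := by
  classical
  induction s using Finset.induction_on with
  | empty => exact ex_of_mem Z.zero_mem Z.zero_mem
  | insert a s ha ih =>
    rw [Finset.sum_insert ha]
    exact (hf a (Finset.mem_insert_self _ _)).add h (fun a ha b hb => Z.add_mem ha hb)
      (ih fun b hb => hf b (Finset.mem_insert_of_mem hb))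

theorem Ex.of_approx (h : ∀ i, SkewLaurent (K i) (τ i)) {X : Set (ι → D)} {x : ι → D}
    (H : ∀ M, ∃ y, Ex K τ X y ∧ PVal K τ M (x - y)) : Ex K τ X x := fun M => by
  obtain ⟨y, hy, hxy⟩ := H M
  obtain ⟨c, hc, hv⟩ := hy M
  refine ⟨c, hc, ?_⟩
  rw [← sub_add_sub_cancel x y]
  exact hxy.add h hv

theorem pval_finsupp_sum (h : ∀ i, SkewLaurent (K i) (τ i)) {c : ℤ →₀ (ι → D)}
    (hc : ∀ j i, c j i ∈ K i) {m : ℤ} (hm : ∀ j < m, c j = 0) :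
    PVal K τ m (c.sum fun j a => a * τ ^ j) := by
  refine PVal.sum h fun j hj => ?_
  by_cases hjm : j < m
  · exact absurd (hm j hjm) (Finsupp.mem_support_iff.1 hj)
  · exact (pval_mul_zpow (hc j) j).mono (not_lt.1 hjm)

theorem exists_pval_finsupp_sum (h : ∀ i, SkewLaurent (K i) (τ i)) {c : ℤ →₀ (ι → D)}
    (hc : ∀ j i, c j i ∈ K i) : ∃ m, PVal K τ m (c.sum fun j a => a * τ ^ j) := by
  classical
  by_cases hne : c.support.Nonempty
  · exact ⟨c.support.min' hne, pval_finsupp_sum h hc fun j hj => by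
      by_contra h0
      exact hj.not_ge (c.support.min'_le j (Finsupp.mem_support_iff.2 h0))⟩
  · exact ⟨0, pval_finsupp_sum h hc fun j _ => by
      rw [Finsupp.support_nonempty_iff, not_not] at hne
      rw [hne]; rfl⟩

theorem Ex.exists_pval (h : ∀ i, SkewLaurent (K i) (τ i)) {X : Set (ι → D)} {x : ι → D}
    (hX : ∀ a ∈ X, ∀ i, a i ∈ K i) (hx : Ex K τ X x) : ∃ m, PVal K τ m x := by
  obtain ⟨c, hc, hv⟩ := hx 0
  obtain ⟨m, hm⟩ := exists_pval_finsupp_sum (τ := τ) h fun j => hX _ (hc j)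
  refine ⟨min 0 m, ?_⟩
  rw [← sub_add_cancel x (c.sum fun j a => a * τ ^ j)]
  exact (hv.mono (min_le_left _ _)).add h (hm.mono (min_le_right _ _))

theorem pi_zpow_add (h : ∀ i, SkewLaurent (K i) (τ i)) (m n : ℤ) : τ ^ (m + n) = τ ^ m * τ ^ n :=
  funext fun i => zpow_add₀ (h i).ne_zero m n

theorem mul_zpow_mul_mul_zpow (h : ∀ i, SkewLaurent (K i) (τ i)) (a b : ι → D) (m n : ℤ) :
    a * τ ^ m * (b * τ ^ n) = a * (τ ^ m * b * τ ^ (-m)) * τ ^ (m + n) := by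
  have h1 : τ ^ (-m) * τ ^ (m + n) = τ ^ n := by rw [← pi_zpow_add h, neg_add_cancel_left]
  simp only [mul_assoc]
  rw [h1]

theorem Ex.mul (h : ∀ i, SkewLaurent (K i) (τ i)) {X Y : Set (ι → D)} {Z : AddSubgroup (ι → D)}
    (hX : ∀ a ∈ X, ∀ i, a i ∈ K i) (hY : ∀ a ∈ Y, ∀ i, a i ∈ K i)
    (hZ : ∀ a ∈ X, ∀ b ∈ Y, ∀ j : ℤ, a * (τ ^ j * b * τ ^ (-j)) ∈ Z) {x y : ι → D}
    (hx : Ex K τ X x) (hy : Ex K τ Y y) : Ex K τ Z (x * y) := by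
  classical
  refine Ex.of_approx h fun M => ?_
  obtain ⟨m, hm⟩ := hx.exists_pval h hX
  obtain ⟨n, hn⟩ := hy.exists_pval h hY
  obtain ⟨c, hc, hcv⟩ := hx (max m (M - n))
  obtain ⟨d, hd, hdv⟩ := hy (M - m)
  refine ⟨(c.sum fun j a => a * τ ^ j) * (d.sum fun j a => a * τ ^ j), ?_, ?_⟩
  · rw [Finsupp.sum, Finsupp.sum, Finset.sum_mul_sum]
    refine ex_sum_mul_zpow h fun i _ => ex_sum_mul_zpow h fun j _ => ?_
    rw [mul_zpow_mul_mul_zpow h]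
    exact ex_single (hZ _ (hc i) _ (hd j) i) Z.zero_mem _
  · have hc' : PVal K τ m (c.sum fun j a => a * τ ^ j) := by
      have := hm.add h ((PVal.mul h (pval_zero_of_mem (a := -1)
        (fun i => neg_mem (one_mem _))) (hcv.mono (le_max_left _ _))).mono (n := m) (by simp))
      simpa using this
    have e : ∀ X Y : ι → D, x * y - X * Y = (x - X) * y + X * (y - Y) := fun X Y => by
      noncomm_ring
    rw [e]
    refine PVal.add h ((hcv.mul h hn).mono ?_) ((hc'.mul h hdv).mono ?_)
    · have := le_max_right m (M - n); omega
    · omega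

theorem PVal.pow (h : ∀ i, SkewLaurent (K i) (τ i)) {y : ι → D} (hy : PVal K τ 1 y) (n : ℕ) :
    PVal K τ n (y ^ n) := by
  induction n with
  | zero => rw [pow_zero]; exact pval_zero_of_mem fun i => one_mem _
  | succ n ih => rw [pow_succ]; exact_mod_cast ih.mul h hy

theorem Ex.inv [Nonempty ι] (h : ∀ i, SkewLaurent (K i) (τ i)) {Y : Set (ι → D)}
    {R : Subring (ι → D)} (hR : ∀ a ∈ R, ∀ i, a i ∈ K i)
    (hτ : ∀ a ∈ R, ∀ j : ℤ, τ ^ j * a * τ ^ (-j) ∈ R) (hYR : Y ⊆ R)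
    (hinv : ∀ a ∈ Y, a ≠ 0 → (∀ i, a i ≠ 0) ∧ a⁻¹ ∈ R) {q : ι → D} (hq : ∀ i, q i ≠ 0)
    (hY : Ex K τ Y q) : Ex K τ R q⁻¹ := by
  classical
  have hmul : ∀ {x y : ι → D}, Ex K τ R x → Ex K τ R y → Ex K τ R (x * y) := fun hx hy =>
    hx.mul (Z := R.toAddSubgroup) h hR hR
      (fun a ha b hb j => R.mul_mem ha (hτ b hb j)) hy
  have hex : ∃ M, ¬ PVal K τ M q := by
    by_contra! hcon
    obtain ⟨i⟩ := ‹Nonempty ι›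
    exact hq i (eq_zero_of_val (h i) fun m => hcon m i)
  obtain ⟨M, hM⟩ := hex
  obtain ⟨c, hc, hcv⟩ := hY M
  have hcK : ∀ j i, c j i ∈ K i := fun j => hR _ (hYR (hc j))
  have hex' : ∃ j < M, c j ≠ 0 := by
    by_contra! hcon
    refine hM ?_
    rw [← sub_add_cancel q (c.sum fun j a => a * τ ^ j)]
    exact hcv.add h (pval_finsupp_sum h hcK hcon)
  obtain ⟨j', hj', hj'0⟩ := hex'
  have hne : c.support.Nonempty := ⟨j', Finsupp.mem_support_iff.2 hj'0⟩
  let j := c.support.min' hne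
  have hj : j ∈ c.support := c.support.min'_mem hne
  have hjM : j < M := (c.support.min'_le _ (Finsupp.mem_support_iff.2 hj'0)).trans_lt hj'
  obtain ⟨ha0, haR⟩ := hinv _ (hc j) (Finsupp.mem_support_iff.1 hj)
  set a := c j with ha
  have hqa : PVal K τ (j + 1) (q - a * τ ^ j) := by
    have e : q - a * τ ^ j = (q - c.sum fun j a => a * τ ^ j) +
        ∑ i ∈ c.support.erase j, c i * τ ^ i := by
      rw [Finsupp.sum, ← Finset.add_sum_erase _ _ hj]
      abel
    rw [e]
    refine (hcv.mono hjM).add h (PVal.sum h fun i hi => (pval_mul_zpow (hcK i) i).mono ?_)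
    exact lt_of_le_of_ne (c.support.min'_le i (Finset.mem_of_mem_erase hi))
      (Finset.ne_of_mem_erase hi).symm
  let z : ι → D := (τ ^ (-j) * a⁻¹ * τ ^ j) * τ ^ (-j)
  have hz : Ex K τ R z := ex_single (by simpa using hτ _ haR (-j)) R.zero_mem _
  have hz' : PVal K τ (-j) z := pval_mul_zpow (hR _ (by simpa using hτ _ haR (-j))) _
  have hzi : ∀ i, z i * (a i * τ i ^ j) = 1 := fun i => by
    have := (h i).ne_zero
    have h1 := ha0 i
    change τ i ^ (-j) * (a i)⁻¹ * τ i ^ j * τ i ^ (-j) * (a i * τ i ^ j) = 1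
    rw [mul_assoc _ (τ i ^ j), ← zpow_add₀ this, add_neg_cancel, zpow_zero, mul_one, mul_assoc,
      inv_mul_cancel_left₀ h1, ← zpow_add₀ this, neg_add_cancel, zpow_zero]
  let y : ι → D := 1 - z * q
  have hy1 : PVal K τ 1 y := by
    have e : y = -1 * z * (q - a * τ ^ j) := by
      have : z * (a * τ ^ j) = 1 := funext hzi
      simp only [y, mul_sub, mul_assoc, this]
      noncomm_ring
    rw [e]
    exact (((pval_zero_of_mem (a := -1) (fun i => neg_mem (one_mem _))).mul h hz').mul h
      hqa).mono (by omega)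
  have hexy : Ex K τ R y := by
    have e : y = 1 + (-1 * z) * q := by simp only [y]; noncomm_ring
    rw [e]
    exact (ex_of_mem R.one_mem R.zero_mem).add h (fun a ha b hb => R.add_mem ha hb)
      (hmul (hmul (ex_of_mem (neg_mem R.one_mem) R.zero_mem) hz) (hY.mono hYR))
  have hpow : ∀ n : ℕ, Ex K τ R (y ^ n) := fun n => by
    induction n with
    | zero => rw [pow_zero]; exact ex_of_mem R.one_mem R.zero_mem
    | succ n ih => rw [pow_succ]; exact hmul ih hexy
  have hgeom : Ex K τ R (1 - y)⁻¹ := by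
    refine Ex.of_approx h fun M => ⟨∑ n ∈ Finset.range M.toNat, y ^ n,
      ex_sum_mul_zpow (Z := R.toAddSubgroup) h fun n _ => hpow n, ?_⟩
    have e : (1 - y)⁻¹ - ∑ n ∈ Finset.range M.toNat, y ^ n = (1 - y)⁻¹ * y ^ M.toNat := by
      have h1 : (1 - y)⁻¹ * (1 - y) = 1 :=
        funext fun i => inv_mul_cancel₀ (val_inv_one_sub (h i) (hy1 i)).1
      have h2 := mul_neg_geom_sum y M.toNat
      calc _ = (1 - y)⁻¹ - (1 - y)⁻¹ * (1 - y) * ∑ n ∈ Finset.range M.toNat, y ^ n := by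
            rw [h1, one_mul]
        _ = _ := by rw [mul_assoc, h2, mul_sub, mul_one, sub_sub_cancel]
    rw [e]
    have h0 : PVal K τ 0 (1 - y)⁻¹ := fun i => (val_inv_one_sub (h i) (hy1 i)).2
    exact (h0.mul h (hy1.pow h _)).mono (by omega)
  have e : q⁻¹ = (1 - y)⁻¹ * z := by
    funext i
    have h1 : (1 - y) i = z i * q i := by simp [y]
    have h2 : z i ≠ 0 := left_ne_zero_of_mul_eq_one (hzi i)
    change (q i)⁻¹ = ((1 - y) i)⁻¹ * z i
    rw [h1, mul_inv_rev, inv_mul_cancel_right₀ h2]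
  rw [e]
  exact hmul hgeom hz

end SkewLaurent

namespace Hughes

open MonoidAlgebra

variable {k A : Type*} [DivisionRing k] [Group A] {ι : Type} {D : Type w} [DivisionRing D]

/-- The family of images of `c • a` under a family of homomorphisms from the group algebra. -/
noncomputable def unit (φ : ι → MonoidAlgebra k A →+* D) (c : k) (a : A) : ι → D :=
  fun i => φ i (single a c)

variable (φ : ι → MonoidAlgebra k A →+* D)

theorem unit_mul_unit (c d : k) (a b : A) :
    unit φ c a * unit φ d b = unit φ (c * d) (a * b) := by
  funext i
  simp only [Pi.mul_apply, unit, ← map_mul, single_mul_single]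

theorem unit_one : unit φ 1 1 = 1 := by
  funext i
  simp only [unit, Pi.one_apply, ← MonoidAlgebra.one_def, map_one]

theorem neg_unit (c : k) (a : A) : -unit φ c a = unit φ (-c) a := by
  funext i
  simp only [unit, Pi.neg_apply, ← map_neg]
  congr 1
  exact (single_neg a c).symm

theorem unit_mul_inv {c : k} (hc : c ≠ 0) (a : A) : unit φ c a * unit φ c⁻¹ a⁻¹ = 1 := by
  rw [unit_mul_unit, mul_inv_cancel₀ hc, mul_inv_cancel, unit_one]

theorem inv_mul_unit {c : k} (hc : c ≠ 0) (a : A) : unit φ c⁻¹ a⁻¹ * unit φ c a = 1 := by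
  rw [unit_mul_unit, inv_mul_cancel₀ hc, inv_mul_cancel, unit_one]

theorem unit_ne_zero {c : k} (hc : c ≠ 0) (a : A) (i : ι) : unit φ c a i ≠ 0 :=
  left_ne_zero_of_mul_eq_one (congrFun (unit_mul_inv φ hc a) i)

theorem inv_unit {c : k} (hc : c ≠ 0) (a : A) : (unit φ c a)⁻¹ = unit φ c⁻¹ a⁻¹ :=
  funext fun i => inv_eq_of_mul_eq_one_right (congrFun (unit_mul_inv φ hc a) i)

theorem unit_zpow (a : A) (j : ℤ) : unit φ 1 a ^ j = unit φ 1 (a ^ j) := by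
  have hnat : ∀ n : ℕ, unit φ 1 a ^ n = unit φ 1 (a ^ n) := fun n => by
    induction n with
    | zero => rw [pow_zero, pow_zero, unit_one]
    | succ n ih => rw [pow_succ, pow_succ, ih, unit_mul_unit, one_mul]
  cases j with
  | ofNat n => simp [hnat]
  | negSucc n => rw [zpow_negSucc, zpow_negSucc, hnat, inv_unit φ one_ne_zero, inv_one]

/-- The three kinds of formal rational expressions: monomials, sums, and sums whose leading label
is trivial. -/
inductive Kind
  | mon | sum | led

/-- Families admitting a rational expression of a given kind and complexity, with labels in `S`. -/
inductive Cx (S : Set A) : Kind → Cplx → (ι → D) → Prop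
  | one : Cx S .mon 0 1
  | inv {β γ m q} : Cx S .mon β m → Cx S .led γ q → (∀ i, q i ≠ 0) →
      Cx S .mon (β + γ.wt) (q⁻¹ * m)
  | zero : Cx S .sum 0 0
  | add {β γ m p c s} : Cx S .mon β m → s ∈ S → c ≠ 0 → Cx S .sum γ p →
      Cx S .sum (γ + β.wt) (m * unit φ c s + p)
  | led {β γ m p} : Cx S .mon β m → Cx S .sum γ p → Cx S .led (γ + β.wt) (m + p)

namespace Cx

variable {φ} {S T : Set A} {kd : Kind} {β γ δ : Cplx} {x m p q : ι → D}

theorem mono (hST : S ⊆ T) (h : Cx φ S kd β x) : Cx φ T kd β x := by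
  induction h with
  | one => exact one
  | inv _ _ h ihm ihq => exact inv ihm ihq h
  | zero => exact zero
  | add _ hs hc _ ihm ihp => exact add ihm (hST hs) hc ihp
  | led _ _ ihm ihp => exact led ihm ihp

theorem exists_finset (h : Cx φ S kd β x) : ∃ F : Finset A, ↑F ⊆ S ∧ Cx φ F kd β x := by
  classical
  induction h with
  | one => exact ⟨∅, by simp, one⟩
  | inv _ _ h ihm ihq =>
    obtain ⟨F, hF, hm⟩ := ihm
    obtain ⟨G, hG, hq⟩ := ihq
    exact ⟨F ∪ G, by simp [hF, hG], inv (hm.mono (by simp)) (hq.mono (by simp)) h⟩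
  | zero => exact ⟨∅, by simp, zero⟩
  | @add _ _ _ _ _ s _ hs hc _ ihm ihp =>
    obtain ⟨F, hF, hm⟩ := ihm
    obtain ⟨G, hG, hp⟩ := ihp
    refine ⟨insert s (F ∪ G), by simp [Set.insert_subset_iff, hs, hF, hG],
      add (hm.mono ?_) (by simp) hc (hp.mono ?_)⟩ <;>
    · intro a ha
      simp only [Finset.coe_insert, Finset.coe_union]
      tauto
  | led _ _ ihm ihp =>
    obtain ⟨F, hF, hm⟩ := ihm
    obtain ⟨G, hG, hp⟩ := ihp
    exact ⟨F ∪ G, by simp [hF, hG], led (hm.mono (by simp)) (hp.mono (by simp))⟩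

theorem conj {c : k} (hc : c ≠ 0) {a : A} (ha : ∀ s ∈ S, a * s * a⁻¹ ∈ T) (h : Cx φ S kd β x) :
    Cx φ T kd β (unit φ c a * x * unit φ c⁻¹ a⁻¹) := by
  have hmul : ∀ y z : ι → D, unit φ c a * (y * z) * unit φ c⁻¹ a⁻¹ =
      unit φ c a * y * unit φ c⁻¹ a⁻¹ * (unit φ c a * z * unit φ c⁻¹ a⁻¹) := fun y z => by
    have := inv_mul_unit φ hc a
    simp only [mul_assoc]
    rw [← mul_assoc (unit φ c⁻¹ a⁻¹) (unit φ c a), this, one_mul]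
  induction h with
  | one => rw [mul_one, unit_mul_inv φ hc]; exact one
  | @inv _ _ _ q _ _ h ihm ihq =>
    rw [hmul]
    have hinv : unit φ c a * q⁻¹ * unit φ c⁻¹ a⁻¹ = (unit φ c a * q * unit φ c⁻¹ a⁻¹)⁻¹ := by
      rw [mul_inv_rev, mul_inv_rev, inv_unit φ hc, inv_unit φ (inv_ne_zero hc), inv_inv, inv_inv,
        mul_assoc]
    rw [hinv]
    exact inv ihm ihq fun i => mul_ne_zero (mul_ne_zero (unit_ne_zero φ hc a i) (h i))
      (unit_ne_zero φ (inv_ne_zero hc) _ i)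
  | zero => rw [mul_zero, zero_mul]; exact zero
  | @add _ _ _ _ d s _ hs hd _ ihm ihp =>
    rw [mul_add, add_mul, hmul, unit_mul_unit φ c d, unit_mul_unit]
    exact add ihm (ha s hs) (mul_ne_zero (mul_ne_zero hc hd) (inv_ne_zero hc)) ihp
  | led _ _ ihm ihp => rw [mul_add, add_mul]; exact led ihm ihp

theorem eq_zero (h : Cx φ S .sum 0 x) : x = 0 := by
  generalize hγ : (0 : Cplx) = γ at h
  cases h with
  | zero => rfl
  | @add β γ _ _ _ _ _ _ _ _ =>
    exact absurd hγ ((Cplx.wt_pos β).trans_le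
      (Cplx.le_add_left _ _)).ne

theorem led_pos (h : Cx φ S .led γ x) : 0 < γ := by
  cases h with
  | @led β => exact (Cplx.wt_pos β).trans_le (Cplx.le_add_left _ _)

theorem mon_mul (hm : Cx φ S kd β m) : kd = .mon → Cx φ S .mon γ x → Cx φ S .mon (β + γ) (m * x) := by
  induction hm with
  | one => intro _ hx; rwa [zero_add, one_mul]
  | inv _ hq h ihm _ =>
    intro _ hx
    rw [mul_assoc, add_right_comm]
    exact inv (ihm rfl hx) hq h
  | _ => intro h; cases h

theorem sum_add (hp : Cx φ S kd β p) : kd = .sum → Cx φ S .sum γ x → Cx φ S .sum (β + γ) (p + x) := by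
  induction hp with
  | zero => intro _ hx; rwa [zero_add, zero_add]
  | @add β₀ γ₀ m p c s hm hs hc _ _ ihp =>
    intro _ hx
    rw [add_assoc (m * unit φ c s), add_right_comm γ₀]
    exact add hm hs hc (ihp rfl hx)
  | _ => intro h; cases h

theorem sum_neg (hp : Cx φ S kd β p) : kd = .sum → Cx φ S .sum β (-p) := by
  induction hp with
  | zero => intro _; rw [neg_zero]; exact zero
  | add hm hs hc _ _ ihp =>
    intro _
    rw [neg_add, ← mul_neg, neg_unit]
    exact add hm hs (neg_ne_zero.2 hc) (ihp rfl)
  | _ => intro h; cases h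

variable {N : Subgroup A}

theorem sum_mul_unit (hp : Cx φ N kd β p) {c : k} (hc : c ≠ 0) {a : A} (ha : a ∈ N) :
    kd = .sum → Cx φ N .sum β (p * unit φ c a) := by
  induction hp with
  | zero => intro _; rw [zero_mul]; exact zero
  | add hm hs hd _ _ ihp =>
    intro _
    rw [add_mul, mul_assoc, unit_mul_unit]
    exact add hm (mul_mem hs ha) (mul_ne_zero hd hc) (ihp rfl)
  | _ => intro h; cases h

theorem word (hm : Cx φ S .mon β m) {c : k} (hc : c ≠ 0) {a : A} (ha : a ∈ S) :
    Cx φ S .sum β.wt (m * unit φ c a) := by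
  simpa using add hm ha hc zero

theorem led_to_sum (hq : Cx φ S .led γ q) (h1 : (1 : A) ∈ S) : Cx φ S .sum γ q := by
  cases hq with
  | led hm hp =>
    have := add hm h1 (one_ne_zero (α := k)) hp
    rwa [unit_one, mul_one] at this

theorem sum_cases (hp : Cx φ N .sum γ p) :
    (p = 0 ∧ γ = 0) ∨ ∃ q c s, Cx φ N .led γ q ∧ c ≠ 0 ∧ s ∈ N ∧ p = q * unit φ c s := by
  cases hp with
  | zero => exact Or.inl ⟨rfl, rfl⟩
  | @add β γ m p c s hm hs hc hp =>
    refine Or.inr ⟨m + p * unit φ c⁻¹ s⁻¹, c, s, led hm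
      (hp.sum_mul_unit (inv_ne_zero hc) (inv_mem hs) rfl), hc, hs, ?_⟩
    rw [add_mul, mul_assoc p, inv_mul_unit φ hc, mul_one]

theorem sum_inv (hp : Cx φ N .sum γ p) (h0 : p ≠ 0) (hne : (∃ i, p i = 0) → p = 0) :
    (∀ i, p i ≠ 0) ∧ ∃ m c s, Cx φ N .mon γ.wt m ∧ c ≠ 0 ∧ s ∈ N ∧ p⁻¹ = m * unit φ c s := by
  have hpi : ∀ i, p i ≠ 0 := by
    by_contra! h
    exact h0 (hne h)
  refine ⟨hpi, ?_⟩
  rcases hp.sum_cases with h | ⟨q, c, s, hq, hc, hs, rfl⟩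
  · exact absurd h.1 h0
  have hqi : ∀ i, q i ≠ 0 := fun i => left_ne_zero_of_mul (hpi i)
  have hq' := (inv one hq hqi).conj (T := N) (inv_ne_zero hc) (a := s⁻¹) fun t ht =>
    mul_mem (mul_mem (inv_mem hs) ht) (inv_mem (inv_mem hs))
  rw [zero_add, mul_one, inv_inv, inv_inv] at hq'
  refine ⟨_, c⁻¹, s⁻¹, hq', inv_ne_zero hc, inv_mem hs, ?_⟩
  rw [mul_inv_rev, inv_unit φ hc, mul_assoc _ (unit φ c s), unit_mul_inv φ hc, mul_one]

end Cx

variable {φ} in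
theorem unit_mul_word (c : k) (hc : c ≠ 0) (a : A) (m : ι → D) (d : k) (b : A) :
    unit φ c a * (m * unit φ d b) =
      unit φ c a * m * unit φ c⁻¹ a⁻¹ * unit φ (c * d) (a * b) := by
  rw [← unit_mul_unit, mul_assoc _ (unit φ c⁻¹ a⁻¹), ← mul_assoc (unit φ c⁻¹ a⁻¹),
    inv_mul_unit φ hc, one_mul]
  simp only [mul_assoc]

/-- The additive group generated by words whose weights lie in `B`. -/
def words (N : Subgroup A) (B : Set Cplx) : AddSubgroup (ι → D) :=
  AddSubgroup.closure {x | ∃ β ∈ B, ∃ m c s, Cx φ N .mon β m ∧ c ≠ 0 ∧ s ∈ N ∧ x = m * unit φ c s}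

/-- Sums of complexity less than `γ`. -/
def sumsLT (N : Subgroup A) (γ : Cplx) : Set (ι → D) := {p | ∃ δ < γ, Cx φ N .sum δ p}

/-- Sums of complexity at most `γ`. -/
def sumsLE (N : Subgroup A) (γ : Cplx) : Set (ι → D) := {p | ∃ δ ≤ γ, Cx φ N .sum δ p}

variable {φ} {N : Subgroup A} {B B' B'' : Set Cplx}

theorem word_mem {β : Cplx} (hβ : β ∈ B) {m : ι → D} (hm : Cx φ N .mon β m) {c : k} (hc : c ≠ 0)
    {s : A} (hs : s ∈ N) : m * unit φ c s ∈ words φ N B :=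
  AddSubgroup.subset_closure ⟨β, hβ, m, c, s, hm, hc, hs, rfl⟩

theorem mon_mem {β : Cplx} (hβ : β ∈ B) {m : ι → D} (hm : Cx φ N .mon β m) :
    m ∈ words φ N B := by
  simpa [unit_one] using word_mem hβ hm (one_ne_zero (α := k)) (one_mem N)

theorem mul_mem_words (hB : ∀ β ∈ B, ∀ γ ∈ B', β + γ ∈ B'') {x y : ι → D} (hx : x ∈ words φ N B)
    (hy : y ∈ words φ N B') : x * y ∈ words φ N B'' := by
  induction hx using AddSubgroup.closure_induction with
  | zero => rw [zero_mul]; exact zero_mem _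
  | add a b _ _ iha ihb => rw [add_mul]; exact add_mem iha ihb
  | neg a _ ih => rw [neg_mul]; exact neg_mem ih
  | mem a ha =>
    obtain ⟨β, hβ, m, c, s, hm, hc, hs, rfl⟩ := ha
    induction hy using AddSubgroup.closure_induction with
    | zero => rw [mul_zero]; exact zero_mem _
    | add a b _ _ iha ihb => rw [mul_add]; exact add_mem iha ihb
    | neg a _ ih => rw [mul_neg]; exact neg_mem ih
    | mem b hb =>
      obtain ⟨γ, hγ, n, d, t, hn, hd, ht, rfl⟩ := hb
      rw [mul_assoc, unit_mul_word c hc, ← mul_assoc]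
      exact word_mem (hB β hβ γ hγ) (hm.mon_mul rfl (hn.conj hc fun u hu =>
        mul_mem (mul_mem hs hu) (inv_mem hs))) (mul_ne_zero hc hd) (mul_mem hs ht)

theorem conj_mem_words {a : A} (ha : ∀ s ∈ N, a * s * a⁻¹ ∈ N) {c : k} (hc : c ≠ 0) {x : ι → D}
    (hx : x ∈ words φ N B) : unit φ c a * x * unit φ c⁻¹ a⁻¹ ∈ words φ N B := by
  induction hx using AddSubgroup.closure_induction with
  | zero => rw [mul_zero, zero_mul]; exact zero_mem _
  | add a b _ _ iha ihb => rw [mul_add, add_mul]; exact add_mem iha ihb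
  | neg a _ ih => rw [mul_neg, neg_mul]; exact neg_mem ih
  | mem x hx =>
    obtain ⟨β, hβ, m, d, s, hm, hd, hs, rfl⟩ := hx
    rw [unit_mul_word c hc, mul_assoc _ (unit φ (c * d) (a * s)), unit_mul_unit]
    exact word_mem hβ (hm.conj hc ha) (mul_ne_zero (mul_ne_zero hc hd) (inv_ne_zero hc)) (ha s hs)

theorem words_subset_sumsLT (β : Cplx) :
    (words φ N (Set.Iio β) : Set (ι → D)) ⊆ sumsLT φ N β.wt := by
  intro x hx
  induction hx using AddSubgroup.closure_induction with
  | zero => exact ⟨0, β.wt_pos, Cx.zero⟩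
  | add a b _ _ iha ihb =>
    obtain ⟨γ, hγ, ha⟩ := iha
    obtain ⟨δ, hδ, hb⟩ := ihb
    exact ⟨_, Cplx.add_lt_wt hγ hδ, ha.sum_add rfl hb⟩
  | neg a _ ih =>
    obtain ⟨γ, hγ, ha⟩ := ih
    exact ⟨γ, hγ, ha.sum_neg rfl⟩
  | mem x hx =>
    obtain ⟨γ, hγ, m, d, s, hm, hd, hs, rfl⟩ := hx
    exact ⟨_, Cplx.wt_strictMono hγ, hm.word hd hs⟩

theorem sumsLT_subset_words (β : Cplx) : sumsLT φ N β.wt ⊆ (words φ N (Set.Iio β) : Set (ι → D)) := by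
  rintro x ⟨γ, hγ, hx⟩
  have key : ∀ {kd γ x}, Cx φ N kd γ x → kd = .sum → γ < β.wt → x ∈ words φ N (Set.Iio β) := by
    intro kd γ x hx
    induction hx with
    | zero => exact fun _ _ => zero_mem _
    | @add δ γ _ _ _ _ hm hs hc _ _ ih =>
      intro _ hlt
      have h1 : δ.wt < β.wt := (Cplx.le_add_left δ.wt γ).trans_lt hlt
      have h2 : γ < β.wt := (Cplx.le_add_right γ δ.wt).trans_lt hlt
      have h3 : δ ∈ Set.Iio β := Cplx.wt_strictMono.lt_iff_lt.1 h1
      exact add_mem (word_mem h3 hm hc hs) (ih rfl h2)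
    | _ => intro h; cases h
  exact key hx rfl hγ

theorem sumsLT_mono {γ δ : Cplx} (h : γ ≤ δ) : sumsLT φ N γ ⊆ sumsLT φ N δ :=
  fun _ ⟨ε, hε, hx⟩ => ⟨ε, hε.trans_le h, hx⟩

variable (φ) in
/-- The division subring generated by the `i`-th image of the group algebra of `N`. -/
def gen (N : Subgroup A) (i : ι) : Subfield D :=
  Subfield.closure {x | ∃ a ∈ N, ∃ c, x = φ i (single a c)}

theorem unit_mem_gen {a : A} (ha : a ∈ N) (c : k) (i : ι) : unit φ c a i ∈ gen φ N i :=
  Subfield.subset_closure ⟨a, ha, c, rfl⟩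

theorem Cx.mem_gen {S : Set A} (hS : S ⊆ N) {kd : Kind} {γ : Cplx} {x : ι → D}
    (h : Cx φ S kd γ x) (i : ι) : x i ∈ gen φ N i := by
  induction h with
  | one => exact one_mem _
  | inv _ _ _ ihm ihq => exact mul_mem (inv_mem ihq) ihm
  | zero => exact zero_mem _
  | add _ hs _ _ ihm ihp => exact add_mem (mul_mem ihm (unit_mem_gen (hS hs) _ _)) ihp
  | led _ _ ihm ihp => exact add_mem ihm ihp

theorem words_mem_gen {x : ι → D} (hx : x ∈ words φ N B) (i : ι) : x i ∈ gen φ N i := by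
  induction hx using AddSubgroup.closure_induction with
  | zero => exact zero_mem _
  | add a b _ _ iha ihb => exact add_mem iha ihb
  | neg a _ ih => exact neg_mem ih
  | mem x hx =>
    obtain ⟨γ, hγ, m, d, s, hm, hd, hs, rfl⟩ := hx
    exact mul_mem (hm.mem_gen le_rfl i) (unit_mem_gen hs _ _)

end Hughes

namespace Hughes

open MonoidAlgebra SkewLaurent

variable {k A : Type*} [DivisionRing k] [Group A] {ι : Type} {D : Type w} [DivisionRing D]

/-- A subgroup with an integer-valued degree and an element of degree one. -/
structure Grading (A : Type*) [Group A] where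
  /-- the graded subgroup -/
  H : Subgroup A
  /-- the degree -/
  deg : A → ℤ
  deg_mul : ∀ a ∈ H, ∀ b ∈ H, deg (a * b) = deg a + deg b
  /-- an element of degree one -/
  t : A
  t_mem : t ∈ H
  deg_t : deg t = 1

namespace Grading

variable (g : Grading A)

theorem deg_one : g.deg 1 = 0 := by
  have := g.deg_mul 1 (one_mem _) 1 (one_mem _)
  rw [mul_one] at this
  omega

theorem deg_inv {a : A} (ha : a ∈ g.H) : g.deg a⁻¹ = -g.deg a := by
  have := g.deg_mul a ha a⁻¹ (inv_mem ha)
  rw [mul_inv_cancel, deg_one] at this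
  omega

theorem deg_zpow {a : A} (ha : a ∈ g.H) (j : ℤ) : g.deg (a ^ j) = j * g.deg a := by
  induction j with
  | zero => simp [deg_one]
  | succ n ih =>
    rw [zpow_add_one, g.deg_mul _ (zpow_mem ha _) _ ha, ih]
    ring
  | pred n ih =>
    rw [zpow_sub_one, g.deg_mul _ (zpow_mem ha _) _ (inv_mem ha), ih, g.deg_inv ha]
    ring

/-- The subgroup of elements of degree zero. -/
def N : Subgroup A where
  carrier := {a | a ∈ g.H ∧ g.deg a = 0}
  mul_mem' ha hb := ⟨mul_mem ha.1 hb.1, by rw [g.deg_mul _ ha.1 _ hb.1, ha.2, hb.2, add_zero]⟩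
  one_mem' := ⟨one_mem _, g.deg_one⟩
  inv_mem' ha := ⟨inv_mem ha.1, by rw [g.deg_inv ha.1, ha.2, neg_zero]⟩

theorem conj_mem {a : A} (ha : a ∈ g.H) : ∀ s ∈ g.N, a * s * a⁻¹ ∈ g.N := fun s hs =>
  ⟨mul_mem (mul_mem ha hs.1) (inv_mem ha), by
    rw [g.deg_mul _ (mul_mem ha hs.1) _ (inv_mem ha), g.deg_mul _ ha _ hs.1, hs.2, g.deg_inv ha]
    ring⟩

theorem mul_t_zpow_mem {a : A} (ha : a ∈ g.H) : a * g.t ^ (-g.deg a) ∈ g.N :=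
  ⟨mul_mem ha (zpow_mem g.t_mem _), by
    rw [g.deg_mul _ ha _ (zpow_mem g.t_mem _), g.deg_zpow g.t_mem, g.deg_t]
    ring⟩

end Grading

/-- A family of homomorphisms from the group algebra is Hughes-free if powers of degree-one
elements are independent over the division subring generated by the elements of degree zero. -/
def HughesFree (φ : ι → MonoidAlgebra k A →+* D) : Prop :=
  ∀ g : Grading A, g.H.FG → ∀ i,
    LinearIndependent (gen φ g.N i) fun j : ℤ => φ i (single g.t 1) ^ j

variable {φ : ι → MonoidAlgebra k A →+* D}

theorem conj_mem_gen {N : Subgroup A} {a : A} (ha : ∀ s ∈ N, a * s * a⁻¹ ∈ N) {i : ι} {x : D}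
    (hx : x ∈ gen φ N i) : unit φ 1 a i * x * unit φ 1 a⁻¹ i ∈ gen φ N i := by
  have h1 : unit φ 1 a i * unit φ 1 a⁻¹ i = 1 := by
    simpa using congrFun (unit_mul_inv φ (one_ne_zero (α := k)) a) i
  have h2 : unit φ 1 a⁻¹ i * unit φ 1 a i = 1 := by
    simpa using congrFun (inv_mul_unit φ (one_ne_zero (α := k)) a) i
  have hmul : ∀ y z : D, unit φ 1 a i * (y * z) * unit φ 1 a⁻¹ i =
      unit φ 1 a i * y * unit φ 1 a⁻¹ i * (unit φ 1 a i * z * unit φ 1 a⁻¹ i) := fun y z => by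
    simp only [mul_assoc]
    rw [← mul_assoc (unit φ 1 a⁻¹ i) (unit φ 1 a i), h2, one_mul]
  induction hx using Subfield.closure_induction with
  | mem x hx =>
    obtain ⟨b, hb, c, rfl⟩ := hx
    have : unit φ 1 a i * φ i (single b c) * unit φ 1 a⁻¹ i = unit φ c (a * b * a⁻¹) i := by
      simp only [unit, ← map_mul, single_mul_single, one_mul, mul_one]
    rw [this]
    exact unit_mem_gen (ha b hb) c i
  | one => rw [mul_one, h1]; exact one_mem _
  | add x y _ _ hx hy => rw [mul_add, add_mul]; exact add_mem hx hy
  | neg x _ hx => rw [mul_neg, neg_mul]; exact neg_mem hx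
  | inv x _ hx =>
    have : unit φ 1 a i * x⁻¹ * unit φ 1 a⁻¹ i = (unit φ 1 a i * x * unit φ 1 a⁻¹ i)⁻¹ := by
      rw [mul_inv_rev, mul_inv_rev, inv_eq_of_mul_eq_one_right h1, inv_eq_of_mul_eq_one_right h2,
        mul_assoc]
    rw [this]
    exact inv_mem hx
  | mul x y _ _ hx hy => rw [hmul]; exact mul_mem hx hy

theorem HughesFree.skewLaurent (hφ : HughesFree φ) (g : Grading A) (hg : g.H.FG) (i : ι) :
    SkewLaurent (gen φ g.N i) (unit φ 1 g.t i) where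
  conj a ha := by
    have h := conj_mem_gen (g.conj_mem g.t_mem) ha
    have e := congrFun (inv_unit φ (one_ne_zero (α := k)) g.t) i
    rw [inv_one] at e
    rwa [← e] at h
  conj_inv a ha := by
    have h := conj_mem_gen (g.conj_mem (inv_mem g.t_mem)) ha
    have e := congrFun (inv_unit φ (one_ne_zero (α := k)) g.t) i
    rw [inv_one] at e
    rwa [inv_inv, ← e] at h
  indep := hφ g hg i

variable (φ) in
/-- Existence of Laurent expansions with respect to a grading. -/
abbrev GEx (g : Grading A) (X : Set (ι → D)) (x : ι → D) : Prop :=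
  Ex (gen φ g.N) (unit φ 1 g.t) X x

theorem conj_zpow_mem_words {g : Grading A} {B : Set Cplx} {x : ι → D} (hx : x ∈ words φ g.N B)
    (j : ℤ) : unit φ 1 g.t ^ j * x * unit φ 1 g.t ^ (-j) ∈ words φ g.N B := by
  rw [unit_zpow, unit_zpow, zpow_neg]
  simpa using conj_mem_words (g.conj_mem (zpow_mem g.t_mem j)) (one_ne_zero (α := k)) hx

theorem GEx.mul_words {g : Grading A} (h : ∀ i, SkewLaurent (gen φ g.N i) (unit φ 1 g.t i))
    {B B' B'' : Set Cplx} (hB : ∀ β ∈ B, ∀ γ ∈ B', β + γ ∈ B'') {x y : ι → D}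
    (hx : GEx φ g (words φ g.N B) x) (hy : GEx φ g (words φ g.N B') y) :
    GEx φ g (words φ g.N B'') (x * y) :=
  Ex.mul h (fun _ ha => words_mem_gen ha) (fun _ ha => words_mem_gen ha)
    (fun _ ha _ hb j => mul_mem_words hB ha (conj_zpow_mem_words hb j)) hx hy

/-- Words of small weight form a ring. -/
def wordsRing (φ : ι → MonoidAlgebra k A →+* D) (N : Subgroup A) (γ : Cplx) :
    Subring (ι → D) where
  __ := words φ N (Set.Iio γ.wt)
  one_mem' := mon_mem (B := Set.Iio γ.wt) γ.wt_pos Cx.one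
  mul_mem' ha hb := mul_mem_words (fun _ h₁ _ h₂ => Cplx.add_lt_wt h₁ h₂) ha hb

theorem GEx.inv [Nonempty ι] {g : Grading A}
    (h : ∀ i, SkewLaurent (gen φ g.N i) (unit φ 1 g.t i)) {γ : Cplx}
    (hgood : ∀ δ < γ, ∀ p, Cx φ g.N .sum δ p → (∃ i, p i = 0) → p = 0) {q : ι → D}
    (hq : ∀ i, q i ≠ 0) (hex : GEx φ g (sumsLT φ g.N γ) q) :
    GEx φ g (words φ g.N (Set.Iio γ.wt)) q⁻¹ := by
  have hsub : sumsLT φ g.N γ ⊆ (wordsRing φ g.N γ : Set (ι → D)) :=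
    (sumsLT_mono ((Cplx.lt_wt γ).trans (Cplx.lt_wt _)).le).trans (sumsLT_subset_words _)
  refine Ex.inv (R := wordsRing φ g.N γ) h (fun a ha => words_mem_gen ha)
    (fun a ha j => conj_zpow_mem_words ha j) hsub ?_ hq hex
  rintro a ⟨δ, hδ, ha⟩ h0
  obtain ⟨hne, m, c, s, hm, hc, hs, he⟩ := ha.sum_inv h0 (hgood δ hδ a ha)
  refine ⟨hne, ?_⟩
  have hlt : δ.wt ∈ Set.Iio γ.wt := Cplx.wt_strictMono hδ
  have hw := word_mem hlt hm hc hs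
  rw [he]
  change m * unit φ c s ∈ words φ g.N (Set.Iio γ.wt)
  exact hw

/-- A monomial is either homogeneous or has an expansion with words of smaller weight. -/
def DichMon (φ : ι → MonoidAlgebra k A →+* D) (g : Grading A) (S : Set A) (β : Cplx)
    (m : ι → D) : Prop :=
  Cx φ (S ∩ g.N) .mon β m ∨ GEx φ g (words φ g.N (Set.Iio β)) m

/-- A sum is either homogeneous or has an expansion with sums of smaller complexity. -/
def DichSum (φ : ι → MonoidAlgebra k A →+* D) (g : Grading A) (S : Set A) (γ : Cplx)
    (p : ι → D) : Prop :=
  (∃ (d : ℤ) (p' : ι → D), Cx φ g.N .sum γ p' ∧ p = p' * unit φ 1 g.t ^ d ∧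
    (d = 0 → Cx φ (S ∩ g.N) .sum γ p)) ∨ GEx φ g (sumsLT φ g.N γ) p

/-- A sum with trivial leading label is either homogeneous of degree zero or has an expansion with
sums of smaller complexity. -/
def DichLed (φ : ι → MonoidAlgebra k A →+* D) (g : Grading A) (S : Set A) (γ : Cplx)
    (q : ι → D) : Prop :=
  Cx φ (S ∩ g.N) .led γ q ∨ GEx φ g (sumsLT φ g.N γ) q

theorem zero_mem_sumsLE (N : Subgroup A) (γ : Cplx) : (0 : ι → D) ∈ sumsLE φ N γ :=
  ⟨0, Cplx.zero_le γ, Cx.zero⟩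

theorem unit_split (g : Grading A) (c : k) (s : A) :
    unit φ c s = unit φ c (s * g.t ^ (-g.deg s)) * unit φ 1 g.t ^ g.deg s := by
  rw [unit_zpow, unit_mul_unit, mul_one, mul_assoc, ← zpow_add, neg_add_cancel, zpow_zero, mul_one]

theorem DichMon.inv [Nonempty ι] {g : Grading A} {S : Set A}
    (h : ∀ i, SkewLaurent (gen φ g.N i) (unit φ 1 g.t i)) {β γ : Cplx}
    (hgood : ∀ δ < γ, ∀ p, Cx φ g.N .sum δ p → (∃ i, p i = 0) → p = 0) {m q : ι → D}
    (hq : ∀ i, q i ≠ 0) (hdm : DichMon φ g S β m) (hdq : DichLed φ g S γ q) :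
    DichMon φ g S (β + γ.wt) (q⁻¹ * m) := by
  have hinv : GEx φ g (words φ g.N (Set.Iio γ.wt)) q⁻¹ ∨ Cx φ (S ∩ g.N) .led γ q :=
    hdq.symm.imp_left fun h' => h'.inv h hgood hq
  have hm1 : Cx φ (S ∩ g.N) .mon β m → GEx φ g (words φ g.N {β}) m := fun hm =>
    ex_of_mem (mon_mem (Set.mem_singleton β) (hm.mono Set.inter_subset_right)) (zero_mem _)
  have hq1 : Cx φ (S ∩ g.N) .led γ q → GEx φ g (words φ g.N {γ.wt}) q⁻¹ := fun hq' => by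
    refine ex_of_mem (mon_mem (Set.mem_singleton γ.wt) ?_) (zero_mem _)
    have := Cx.inv Cx.one (hq'.mono Set.inter_subset_right) hq
    rwa [zero_add, mul_one] at this
  rcases hinv with hqe | hqh <;> rcases hdm with hmh | hme
  · refine Or.inr (GEx.mul_words h (fun δ hδ ε hε => ?_) hqe (hm1 hmh))
    have hδ' : δ < γ.wt := hδ
    have hε' : ε = β := hε
    have : δ + ε < β + γ.wt := by rw [hε', add_comm δ]; exact add_lt_add_right hδ' β
    exact this
  · refine Or.inr (GEx.mul_words h (fun δ hδ ε hε => ?_) hqe hme)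
    have hδ' : δ < γ.wt := hδ
    have hε' : ε < β := hε
    have : δ + ε < β + γ.wt := by rw [add_comm δ]; exact add_lt_add hε' hδ'
    exact this
  · exact Or.inl (Cx.inv hmh hqh hq)
  · refine Or.inr (GEx.mul_words h (fun δ hδ ε hε => ?_) (hq1 hqh) hme)
    have hδ' : δ = γ.wt := hδ
    have hε' : ε < β := hε
    have : δ + ε < β + γ.wt := by rw [hδ', add_comm γ.wt]; exact add_lt_add_left hε' γ.wt
    exact this

theorem DichSum.add {g : Grading A} {S : Set A}
    (h : ∀ i, SkewLaurent (gen φ g.N i) (unit φ 1 g.t i)) {β γ : Cplx} {m p : ι → D} {c : k}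
    (hc : c ≠ 0) {s : A} (hs : s ∈ g.H) (hdm : DichMon φ g S β m) (hdp : DichSum φ g S γ p) :
    (∃ p' : ι → D, Cx φ g.N .sum (γ + β.wt) p' ∧
      m * unit φ c s + p = p' * unit φ 1 g.t ^ g.deg s ∧
      (g.deg s = 0 → Cx φ (S ∩ g.N) .mon β m ∧ Cx φ (S ∩ g.N) .sum γ p)) ∨
    GEx φ g (sumsLT φ g.N (γ + β.wt)) (m * unit φ c s + p) := by
  classical
  have hple : GEx φ g (sumsLE φ g.N γ) p := by
    rcases hdp with ⟨d, p', hp', rfl, -⟩ | hp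
    · exact ex_single (X := sumsLE φ g.N γ) ⟨γ, le_rfl, hp'⟩ (zero_mem_sumsLE _ _) d
    · have hsub : sumsLT φ g.N γ ⊆ sumsLE φ g.N γ := fun x ⟨δ, hδ, hx⟩ => ⟨δ, hδ.le, hx⟩
      exact Ex.mono hsub hp
  have hsN := g.mul_t_zpow_mem hs
  rcases hdm with hm | hm
  · have hw : Cx φ g.N .sum β.wt (m * unit φ c (s * g.t ^ (-g.deg s))) :=
      (hm.mono Set.inter_subset_right).word hc hsN
    have he : m * unit φ c s =
        m * unit φ c (s * g.t ^ (-g.deg s)) * unit φ 1 g.t ^ g.deg s := by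
      rw [mul_assoc, ← unit_split]
    rcases hdp with ⟨d, p', hp', hpe, hp0⟩ | hp
    · by_cases hγ : γ = 0
      · subst hγ
        have hp0 := hp'.eq_zero
        subst hp0
        rw [zero_mul] at hpe
        subst hpe
        exact Or.inl ⟨m * unit φ c (s * g.t ^ (-g.deg s)), by rw [zero_add]; exact hw,
          by rw [add_zero]; exact he, fun _ => ⟨hm, Cx.zero⟩⟩
      by_cases hd : d = g.deg s
      · subst hd
        refine Or.inl ⟨_, ?_, by rw [hpe, he, ← add_mul], fun h0 => ⟨hm, hp0 h0⟩⟩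
        have := hw.sum_add rfl hp'
        rwa [add_comm] at this
      · refine Or.inr fun M => ⟨Finsupp.single (g.deg s) (m * unit φ c (s * g.t ^ (-g.deg s))) +
          Finsupp.single d p', fun j => ?_, fun i => ?_⟩
        · have hγ' : 0 < γ := lt_of_le_of_ne (Cplx.zero_le γ) (Ne.symm hγ)
          rw [Finsupp.add_apply, Finsupp.single_apply, Finsupp.single_apply]
          split_ifs with h1 h2
          · exact absurd (h2.trans h1.symm) hd
          · rw [add_zero]
            exact ⟨_, lt_add_of_pos_left _ hγ', hw⟩
          · rw [zero_add]
            exact ⟨_, lt_add_of_pos_right _ β.wt_pos, hp'⟩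
          · rw [add_zero]
            exact ⟨0, hγ'.trans_le (Cplx.le_add_right _ _), Cx.zero⟩
        · rw [Finsupp.sum_add_index' (fun _ => zero_mul _) (fun _ _ _ => add_mul _ _ _),
            Finsupp.sum_single_index (zero_mul _), Finsupp.sum_single_index (zero_mul _), he, hpe,
            sub_self]
          exact val_zero
    · refine Or.inr (Ex.add (X := sumsLE φ g.N β.wt) (Y := sumsLT φ g.N γ) h ?_ ?_ hp)
      · rintro a ⟨δ, hδ, ha⟩ b ⟨ε, hε, hb⟩
        refine ⟨δ + ε, ?_, ha.sum_add rfl hb⟩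
        rw [add_comm]
        exact add_lt_add_of_lt_of_le hε hδ
      · rw [he]
        exact ex_single (X := sumsLE φ g.N β.wt) ⟨_, le_rfl, hw⟩ (zero_mem_sumsLE _ _) _
  · refine Or.inr (Ex.add (X := sumsLT φ g.N β.wt) (Y := sumsLE φ g.N γ) h ?_ ?_ hple)
    · rintro a ⟨δ, hδ, ha⟩ b ⟨ε, hε, hb⟩
      refine ⟨δ + ε, ?_, ha.sum_add rfl hb⟩
      rw [add_comm]
      exact add_lt_add_of_le_of_lt hε hδ
    · refine Ex.mono (words_subset_sumsLT β) ?_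
      have hu : GEx φ g (words φ g.N {0}) (unit φ c s) := by
        rw [unit_split g]
        refine ex_single ?_ (zero_mem _) _
        simpa using word_mem (φ := φ) (Set.mem_singleton (0 : Cplx)) Cx.one hc hsN
      refine GEx.mul_words h ?_ hm hu
      rintro δ hδ _ rfl
      rwa [add_zero]

theorem dichotomy [Nonempty ι] {g : Grading A} {S : Set A} (hS : S ⊆ g.H)
    (h : ∀ i, SkewLaurent (gen φ g.N i) (unit φ 1 g.t i)) {Γ : Cplx}
    (hgood : ∀ δ < Γ, ∀ p, Cx φ g.N .sum δ p → (∃ i, p i = 0) → p = 0) {kd : Kind} {β : Cplx}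
    {x : ι → D} (hx : Cx φ S kd β x) (hβ : β ≤ Γ) :
    (kd = .mon → DichMon φ g S β x) ∧ (kd = .sum → DichSum φ g S β x) ∧
      (kd = .led → DichLed φ g S β x) := by
  induction hx with
  | one => exact ⟨fun _ => Or.inl Cx.one, fun h => (by cases h), fun h => (by cases h)⟩
  | @inv β γ m q _ _ hne ihm ihq =>
    have hγ : γ.wt ≤ Γ := (Cplx.le_add_left _ _).trans hβ
    have hγ' : γ ≤ Γ := (Cplx.lt_wt γ).le.trans hγ
    exact ⟨fun _ => DichMon.inv h (fun δ hδ => hgood δ (hδ.trans_le hγ')) hne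
      ((ihm ((Cplx.le_add_right _ _).trans hβ)).1 rfl) ((ihq hγ').2.2 rfl),
      fun h => (by cases h), fun h => (by cases h)⟩
  | zero =>
    exact ⟨fun h => (by cases h), fun _ => Or.inl ⟨0, 0, Cx.zero, by rw [zero_mul], fun _ => Cx.zero⟩,
      fun h => (by cases h)⟩
  | @add β γ m p c s _ hs hc _ ihm ihp =>
    have hm := (ihm (((Cplx.lt_wt β).le.trans (Cplx.le_add_left _ _)).trans hβ)).1 rfl
    have hp := (ihp ((Cplx.le_add_right _ _).trans hβ)).2.1 rfl
    refine ⟨fun h => (by cases h), fun _ => ?_, fun h => (by cases h)⟩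
    rcases DichSum.add h hc (hS hs) hm hp with ⟨p', hp', he, h0⟩ | h'
    · exact Or.inl ⟨_, p', hp', he, fun hd =>
        Cx.add (h0 hd).1 ⟨hs, hS hs, hd⟩ hc (h0 hd).2⟩
    · exact Or.inr h'
  | @led β γ m p _ _ ihm ihp =>
    have hm := (ihm (((Cplx.lt_wt β).le.trans (Cplx.le_add_left _ _)).trans hβ)).1 rfl
    have hp := (ihp ((Cplx.le_add_right _ _).trans hβ)).2.1 rfl
    refine ⟨fun h => (by cases h), fun h => (by cases h), fun _ => ?_⟩
    have key := DichSum.add h (one_ne_zero (α := k)) (one_mem g.H) hm hp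
    rw [unit_one, mul_one] at key
    rcases key with ⟨p', -, -, h0⟩ | h'
    · exact Or.inl (Cx.led (h0 g.deg_one).1 (h0 g.deg_one).2)
    · exact Or.inr h'

end Hughes

namespace Hughes

open MonoidAlgebra SkewLaurent

variable {k A : Type*} [DivisionRing k] [Group A] {ι : Type} {D : Type w} [DivisionRing D]
  {φ : ι → MonoidAlgebra k A →+* D}

open Classical in
theorem exists_grading (hA : LocallyIndicable A) {H : Subgroup A} (hH : H.FG) (h0 : H ≠ ⊥) :
    ∃ g : Grading A, g.H = H := by
  obtain ⟨f, hf⟩ := hA H h0 hH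
  obtain ⟨t, ht⟩ := hf (Multiplicative.ofAdd 1)
  refine ⟨⟨H, fun a => if h : a ∈ H then (f ⟨a, h⟩).toAdd else 0, fun a ha b hb => ?_, t, t.2, ?_⟩,
    rfl⟩
  · rw [dif_pos ha, dif_pos hb, dif_pos (mul_mem ha hb), ← toAdd_mul, ← map_mul]
    rfl
  · rw [dif_pos t.2, Subtype.coe_eta, ht]
    rfl

theorem Grading.exists_rescale (g : Grading A) {C : Subgroup A} (hC : C ≤ g.H) {x : A}
    (hx : x ∈ C) (hx0 : g.deg x ≠ 0) :
    ∃ (l : ℤ) (g' : Grading A), 0 < l ∧ g'.H = C ∧ ∀ a ∈ C, g.deg a = l * g'.deg a := by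
  classical
  have hex : ∃ n : ℕ, 0 < n ∧ ∃ y ∈ C, g.deg y = n := by
    rcases lt_or_gt_of_ne hx0 with h | h
    · exact ⟨(-g.deg x).toNat, by omega, x⁻¹, inv_mem hx, by rw [g.deg_inv (hC hx)]; omega⟩
    · exact ⟨(g.deg x).toNat, by omega, x, hx, by omega⟩
  obtain ⟨hpos, s, hs, hsd⟩ := Nat.find_spec hex
  set l := Nat.find hex with hl
  have hdvd : ∀ a ∈ C, (l : ℤ) ∣ g.deg a := fun a ha => by
    by_contra hnd
    have h1 : 0 < g.deg a % l := by
      have h2 := Int.emod_nonneg (g.deg a) (b := (l : ℤ)) (by omega)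
      have h3 : g.deg a % l ≠ 0 := fun h => hnd (Int.dvd_of_emod_eq_zero h)
      omega
    have h2 := Int.emod_lt_of_pos (g.deg a) (b := (l : ℤ)) (by omega)
    refine Nat.find_min hex (m := (g.deg a % l).toNat) (by omega) ⟨by omega,
      a * s ^ (-(g.deg a / l)), mul_mem ha (zpow_mem hs _), ?_⟩
    rw [g.deg_mul _ (hC ha) _ (zpow_mem (hC hs) _), g.deg_zpow (hC hs), hsd]
    have h3 := Int.emod_add_mul_ediv (g.deg a) l
    rw [Int.toNat_of_nonneg h1.le]
    linarith
  have hl0 : (l : ℤ) ≠ 0 := by omega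
  refine ⟨l, ⟨C, fun a => g.deg a / l, fun a ha b hb => ?_, s, hs, ?_⟩, by omega, rfl,
    fun a ha => ?_⟩
  · rw [g.deg_mul _ (hC ha) _ (hC hb), Int.add_ediv_of_dvd_left (hdvd a ha)]
  · rw [hsd, Int.ediv_self hl0]
  · exact (Int.mul_ediv_cancel' (hdvd a ha)).symm

theorem gen_mono {N N' : Subgroup A} (h : N ≤ N') (i : ι) : gen φ N i ≤ gen φ N' i :=
  Subfield.closure_mono fun _ ⟨a, ha, c, e⟩ => ⟨a, h ha, c, e⟩

/-- An element of degree `d` is a degree-zero unit times the `d`-th power of the uniformiser. -/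
theorem unit_split_apply (g : Grading A) (c : k) (s : A) (i : ι) :
    unit φ c s i = unit φ c (s * g.t ^ (-g.deg s)) i * unit φ 1 g.t i ^ g.deg s :=
  congrFun (unit_split g c s) i

theorem lau_le_lau_of_rescale {g g' : Grading A} (hH : g'.H ≤ g.H) {l : ℤ}
    (hl : ∀ a ∈ g'.H, g.deg a = l * g'.deg a) {s r : Set ℤ} (hsr : ∀ j ∈ s, l * j ∈ r) (i : ι)
    {x : D} (hx : x ∈ lau (gen φ g'.N i) (unit φ 1 g'.t i) s) :
    x ∈ lau (gen φ g.N i) (unit φ 1 g.t i) r := by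
  have hN : g'.N ≤ g.N := fun a ha => ⟨hH ha.1, by rw [hl a ha.1, ha.2, mul_zero]⟩
  induction hx using Submodule.span_induction with
  | zero => exact zero_mem _
  | add a b _ _ iha ihb => exact add_mem iha ihb
  | smul c a _ ih =>
    exact (lau (gen φ g.N i) (unit φ 1 g.t i) r).smul_mem ⟨c, gen_mono hN i c.2⟩ ih
  | mem a ha =>
    obtain ⟨j, hj, rfl⟩ := ha
    have hmem : g'.t ^ j ∈ g.H := zpow_mem (hH g'.t_mem) j
    have hd : g.deg (g'.t ^ j) = l * j := by
      rw [g.deg_zpow (hH g'.t_mem), hl _ g'.t_mem, g'.deg_t]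
      ring
    have he : unit φ 1 g'.t i ^ j = unit φ 1 (g'.t ^ j) i := congrFun (unit_zpow φ g'.t j) i
    change unit φ 1 g'.t i ^ j ∈ _
    rw [he, unit_split_apply g 1 (g'.t ^ j), hd]
    refine mul_zpow_mem_lau (hsr j hj) (unit_mem_gen ?_ _ _)
    rw [← hd]
    exact g.mul_t_zpow_mem hmem

theorem val_of_rescale {g g' : Grading A} (hH : g'.H ≤ g.H) {l : ℤ} (hl0 : 0 < l)
    (hl : ∀ a ∈ g'.H, g.deg a = l * g'.deg a) (i : ι) {m : ℤ} {x : D}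
    (hx : Val (gen φ g'.N i) (unit φ 1 g'.t i) m x) :
    Val (gen φ g.N i) (unit φ 1 g.t i) (l * m) x := by
  obtain ⟨b, hb, hbx⟩ := hx
  refine ⟨b, lau_le_lau_of_rescale hH hl (fun j hj => ?_) i hb,
    lau_le_lau_of_rescale hH hl (fun j hj => ?_) i hbx⟩
  · exact mul_pos hl0 hj
  · exact mul_le_mul_of_nonneg_left hj hl0.le

theorem mul_unit_eq {g : Grading A} (i : ι) (x : D) (c : k) (a : A) :
    x * unit φ c a i = x * unit φ c (a * g.t ^ (-g.deg a)) i * unit φ 1 g.t i ^ g.deg a := by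
  rw [mul_assoc, ← unit_split_apply]

theorem mul_unit_mem_lau {g : Grading A} {i : ι} {x : D} (hx : x ∈ gen φ g.N i) (c : k) {a : A}
    (ha : a ∈ g.H) {s : Set ℤ} (hs : g.deg a ∈ s) :
    x * unit φ c a i ∈ lau (gen φ g.N i) (unit φ 1 g.t i) s := by
  rw [mul_unit_eq (g := g)]
  exact mul_zpow_mem_lau hs (mul_mem hx (unit_mem_gen (g.mul_t_zpow_mem ha) _ _))

/-- The homogeneous components of a sum of homogeneous terms are determined by the sum. -/
theorem sum_filter_deg_eq_zero {g : Grading A} {i : ι}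
    (h : SkewLaurent (gen φ g.N i) (unit φ 1 g.t i)) {α : Type*} (T : Finset α) (x : α → D)
    (c : α → k) (a : α → A) (hx : ∀ p ∈ T, x p ∈ gen φ g.N i) (ha : ∀ p ∈ T, a p ∈ g.H)
    {Δ : ℤ} {s : Set ℤ} (hs : Δ ∉ s)
    (hsum : ∑ p ∈ T, x p * unit φ (c p) (a p) i ∈ lau (gen φ g.N i) (unit φ 1 g.t i) s) :
    ∑ p ∈ T with g.deg (a p) = Δ, x p * unit φ (c p) (a p) i = 0 := by
  classical
  have h1 : ∑ p ∈ T with g.deg (a p) = Δ, x p * unit φ (c p) (a p) i =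
      (∑ p ∈ T with g.deg (a p) = Δ, x p * unit φ (c p) (a p * g.t ^ (-g.deg (a p))) i) *
        unit φ 1 g.t i ^ Δ := by
    rw [Finset.sum_mul]
    refine Finset.sum_congr rfl fun p hp => ?_
    rw [mul_unit_eq (g := g)]
    congr 2
    exact (Finset.mem_filter.1 hp).2
  rw [h1]
  convert zero_mul _
  refine h.eq_zero_of_mul_zpow_mem (j := Δ) (s := {j | j ≠ Δ}) (sum_mem fun p hp => ?_) (by simp) ?_
  · have hp' := (Finset.mem_filter.1 hp).1
    exact mul_mem (hx p hp') (unit_mem_gen (g.mul_t_zpow_mem (ha p hp')) _ _)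
  · rw [← h1]
    have h2 := Finset.sum_filter_add_sum_filter_not T (fun p => g.deg (a p) = Δ)
      fun p => x p * unit φ (c p) (a p) i
    rw [← eq_sub_iff_add_eq] at h2
    rw [h2]
    refine sub_mem (lau_mono (fun j hj => ?_) hsum) (sum_mem fun p hp => ?_)
    · rintro rfl
      exact hs hj
    · obtain ⟨hp1, hp2⟩ := Finset.mem_filter.1 hp
      exact mul_unit_mem_lau (hx p hp1) _ (ha p hp1) hp2

theorem Cx.exists_const [Nonempty ι] {S : Set A} (hS : ∀ s ∈ S, s = 1) {kd : Kind} {γ : Cplx}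
    {x : ι → D} (h : Cx φ S kd γ x) : ∃ c : k, x = unit φ c 1 := by
  have hadd : ∀ c d : k, unit φ c 1 + unit φ d 1 = unit φ (c + d) 1 := fun c d => by
    funext i
    simp only [Pi.add_apply, unit, ← map_add, ← single_add]
  have hz : unit φ 0 1 = 0 := by
    funext i
    simp [unit]
  induction h with
  | one => exact ⟨1, unit_one φ |>.symm⟩
  | inv _ _ hne ihm ihq =>
    obtain ⟨c, rfl⟩ := ihm
    obtain ⟨d, rfl⟩ := ihq
    have hd : d ≠ 0 := by
      rintro rfl
      obtain ⟨i⟩ := ‹Nonempty ι›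
      exact hne i (congrFun hz i)
    exact ⟨d⁻¹ * c, by rw [inv_unit φ hd, inv_one, unit_mul_unit, mul_one]⟩
  | zero => exact ⟨0, hz.symm⟩
  | add _ hs _ _ ihm ihp =>
    obtain ⟨c, rfl⟩ := ihm
    obtain ⟨d, rfl⟩ := ihp
    rw [hS _ hs, unit_mul_unit, mul_one, hadd]
    exact ⟨_, rfl⟩
  | led _ _ ihm ihp =>
    obtain ⟨c, rfl⟩ := ihm
    obtain ⟨d, rfl⟩ := ihp
    exact ⟨_, hadd c d⟩

end Hughes

namespace Hughes

open MonoidAlgebra SkewLaurent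

variable {k A : Type*} [DivisionRing k] [Group A] {ι : Type} {D : Type w} [DivisionRing D]

/-- Finitely many led sums with labels in `C`, together with coefficients in distinct cosets
of `C`. -/
structure CosetSystem (φ : ι → MonoidAlgebra k A →+* D) (C : Subgroup A) (J : Finset ℕ)
    (S : ℕ → Finset A) (γ : ℕ → Cplx) (q : ℕ → ι → D) (c : ℕ → k) (b : ℕ → A) : Prop where
  labels : ∀ i ∈ J, (S i : Set A) ⊆ C
  cx : ∀ i ∈ J, Cx φ (S i) .led (γ i) (q i)
  ne : ∀ i ∈ J, c i ≠ 0
  coset : ∀ i ∈ J, ∀ j ∈ J, b i * (b j)⁻¹ ∈ C → i = j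

/-- Systems of given total complexity and number of labels are independent. -/
def Indep (φ : ι → MonoidAlgebra k A →+* D) (C : Subgroup A) (κ : Cplx) (n : ℕ) : Prop :=
  ∀ J S γ q c b, CosetSystem φ C J S γ q c b → ∑ i ∈ J, γ i = κ → ∑ i ∈ J, (S i).card = n →
    ∀ ε, ∑ i ∈ J, q i ε * unit φ (c i) (b i) ε = 0 → ∀ i ∈ J, q i = 0

variable {φ : ι → MonoidAlgebra k A →+* D} {C : Subgroup A} {J : Finset ℕ}
  {S : ℕ → Finset A} {γ : ℕ → Cplx} {q : ℕ → ι → D} {c : ℕ → k} {b : ℕ → A}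

theorem CosetSystem.subset (h : CosetSystem φ C J S γ q c b) {J' : Finset ℕ} (hJ : J' ⊆ J) :
    CosetSystem φ C J' S γ q c b :=
  ⟨fun i hi => h.labels i (hJ hi), fun i hi => h.cx i (hJ hi), fun i hi => h.ne i (hJ hi),
    fun i hi j hj => h.coset i (hJ hi) j (hJ hj)⟩

theorem eq_zero_of_indep {κ : Cplx} (IH : ∀ κ' < κ, ∀ n, Indep φ C κ' n) {N : Subgroup A}
    (hN : N ≤ C) : ∀ δ < κ, ∀ p, Cx φ N .sum δ p → (∃ i, p i = 0) → p = 0 := by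
  rintro δ hδ p hp ⟨ε, hε⟩
  rcases hp.sum_cases with h | ⟨q, c, s, hq, hc, hs, rfl⟩
  · exact h.1
  obtain ⟨F, hF, hq⟩ := hq.exists_finset
  have hq0 := IH δ hδ F.card {0} (fun _ => F) (fun _ => δ) (fun _ => q) (fun _ => c) (fun _ => s)
    ⟨fun _ _ => hF.trans hN, fun _ _ => hq, fun _ _ => hc, fun i hi j hj _ => by
      rw [Finset.mem_singleton.1 hi, Finset.mem_singleton.1 hj]⟩
    (Finset.sum_singleton _ _) (Finset.sum_singleton _ _) ε
    (by rw [Finset.sum_singleton]; exact hε) 0 (Finset.mem_singleton_self 0)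
  rw [hq0, zero_mul]

theorem CosetSystem.sum_lt (h : CosetSystem φ C J S γ q c b) {J' : Finset ℕ} (hJ : J' ⊆ J)
    {δ : ℕ → Cplx} (hle : ∀ i ∈ J', δ i ≤ γ i) (hlt : ∃ i ∈ J, i ∈ J' → δ i < γ i) :
    ∑ i ∈ J', δ i < ∑ i ∈ J, γ i := by
  classical
  have h1 : ∑ i ∈ J', δ i = ∑ i ∈ J, if i ∈ J' then δ i else 0 := by
    rw [← Finset.sum_filter, Finset.filter_mem_eq_inter, Finset.inter_eq_right.2 hJ]
  rw [h1]
  refine Finset.sum_lt_sum (fun i _ => ?_) ?_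
  · split_ifs with hi
    exacts [hle i hi, Cplx.zero_le _]
  · obtain ⟨i, hi, hi'⟩ := hlt
    refine ⟨i, hi, ?_⟩
    split_ifs with hiJ
    exacts [hi' hiJ, (h.cx i hi).led_pos]

/-- The case in which all labels have degree zero. -/
theorem CosetSystem.eq_zero_of_labels_mem (h : CosetSystem φ C J S γ q c b)
    (IH : ∀ κ' < ∑ i ∈ J, γ i, ∀ n, Indep φ C κ' n) {g : Grading A} {ε : ι}
    (hg : SkewLaurent (gen φ g.N ε) (unit φ 1 g.t ε)) (hS : ∀ i ∈ J, (S i : Set A) ⊆ g.N)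
    (hb : ∀ i ∈ J, b i ∈ g.H) {i₀ i₁ : ℕ} (hi₀ : i₀ ∈ J) (hi₁ : i₁ ∈ J)
    (hne : g.deg (b i₁) ≠ g.deg (b i₀)) (h0 : ∑ i ∈ J, q i ε * unit φ (c i) (b i) ε = 0) :
    ∀ i ∈ J, q i = 0 := by
  intro i hi
  have h1 := sum_filter_deg_eq_zero hg J (fun i => q i ε) c b
    (fun i hi => (h.cx i hi).mem_gen (hS i hi) ε) hb (Δ := g.deg (b i)) (s := ∅)
    (Set.notMem_empty _) (by rw [h0]; exact zero_mem _)
  refine IH _ (h.sum_lt (Finset.filter_subset _ _) (fun _ _ => le_rfl) ?_) _ _ S γ q c b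
    (h.subset (Finset.filter_subset (fun j => g.deg (b j) = g.deg (b i)) J)) rfl rfl ε h1 i
    (Finset.mem_filter.2 ⟨hi, rfl⟩)
  by_cases hd : g.deg (b i₀) = g.deg (b i)
  · exact ⟨i₁, hi₁, fun hm => absurd ((Finset.mem_filter.1 hm).2.trans hd.symm) hne⟩
  · exact ⟨i₀, hi₀, fun hm => absurd (Finset.mem_filter.1 hm).2 hd⟩

/-- The inductive step when the members of the system have expansions with coefficients of smaller
complexity. -/
theorem CosetSystem.eq_zero_of_expansion [Nonempty ι] (h : CosetSystem φ C J S γ q c b)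
    (IH : ∀ κ' < ∑ i ∈ J, γ i, ∀ n, Indep φ C κ' n) {g g' : Grading A}
    (hg : ∀ i, SkewLaurent (gen φ g.N i) (unit φ 1 g.t i))
    (hg' : ∀ i, SkewLaurent (gen φ g'.N i) (unit φ 1 g'.t i)) (hH : g'.H ≤ g.H) (hC : g'.H ≤ C)
    {l : ℤ} (hl0 : 0 < l) (hl : ∀ a ∈ g'.H, g.deg a = l * g'.deg a)
    (hb : ∀ i ∈ J, b i ∈ g.H) {X : ℕ → Set (ι → D)}
    (hX : ∀ i ∈ J, ∀ p ∈ X i, ∃ δ ≤ γ i, Cx φ g'.N .sum δ p)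
    (hX' : ∃ i ∈ J, ∀ p ∈ X i, ∃ δ < γ i, Cx φ g'.N .sum δ p)
    (hq : ∀ i ∈ J, GEx φ g' (X i) (q i)) {ε : ι}
    (h0 : ∑ i ∈ J, q i ε * unit φ (c i) (b i) ε = 0) : ∀ i ∈ J, q i = 0 := by
  classical
  have hN : g'.N ≤ g.N := fun a ha => ⟨hH ha.1, by rw [hl a ha.1, ha.2, mul_zero]⟩
  have hXgen : ∀ i ∈ J, ∀ p ∈ X i, ∀ j, p j ∈ gen φ g'.N j := fun i hi p hp j => by
    obtain ⟨δ, -, hδ⟩ := hX i hi p hp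
    exact hδ.mem_gen le_rfl j
  suffices H : ∀ M, ∀ i ∈ J, PVal (gen φ g'.N) (unit φ 1 g'.t) M (q i) from fun i hi =>
    funext fun j => eq_zero_of_val (hg' j) fun M => H M i hi j
  intro M
  obtain ⟨R, hR0, hR⟩ : ∃ R : ℤ, 0 ≤ R ∧ ∀ i ∈ J, ∀ j ∈ J, g.deg (b i) - g.deg (b j) ≤ l * R := by
    have hsum : ∀ i ∈ J, |g.deg (b i)| ≤ ∑ j ∈ J, |g.deg (b j)| := fun i hi =>
      Finset.single_le_sum (fun j _ => abs_nonneg (g.deg (b j))) hi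
    have hpos : 0 ≤ ∑ j ∈ J, |g.deg (b j)| := Finset.sum_nonneg fun j _ => abs_nonneg _
    refine ⟨2 * ∑ j ∈ J, |g.deg (b j)|, by positivity, fun i hi j hj => ?_⟩
    have h1 := (le_abs_self _).trans (hsum i hi)
    have h2 := (neg_le_abs _).trans (hsum j hj)
    nlinarith
  have hex : ∀ i, ∃ d : ℤ →₀ (ι → D), i ∈ J → (∀ j, d j ∈ X i) ∧
      PVal (gen φ g'.N) (unit φ 1 g'.t) (M + R)
        (q i - d.sum fun j a => a * unit φ 1 g'.t ^ j) := fun i => by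
    by_cases hi : i ∈ J
    · obtain ⟨d, hd⟩ := hq i hi (M + R)
      exact ⟨d, fun _ => hd⟩
    · exact ⟨0, fun h => absurd h hi⟩
  choose d hd using hex
  suffices H : ∀ i ∈ J, ∀ j < M, d i j = 0 by
    intro i hi
    have h1 := ((hd i hi).2.mono (show M ≤ M + R by omega)).add hg'
      (pval_finsupp_sum hg' (fun j => hXgen i hi _ ((hd i hi).1 j)) (H i hi))
    rwa [sub_add_cancel] at h1
  intro i₂ hi₂ j₂ hj₂
  set Δ : ℤ := l * j₂ + g.deg (b i₂) with hΔ
  let T : Finset (Σ _ : ℕ, ℤ) := J.sigma fun i => (d i).support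
  let x : (Σ _ : ℕ, ℤ) → D := fun p => d p.1 p.2 ε
  let a : (Σ _ : ℕ, ℤ) → A := fun p => g'.t ^ p.2 * b p.1
  have hTJ : ∀ p ∈ T, p.1 ∈ J := fun p hp => (Finset.mem_sigma.1 hp).1
  have hxg : ∀ p ∈ T, x p ∈ gen φ g.N ε := fun p hp =>
    gen_mono hN ε (hXgen p.1 (hTJ p hp) _ ((hd p.1 (hTJ p hp)).1 p.2) ε)
  have hag : ∀ p ∈ T, a p ∈ g.H := fun p hp =>
    mul_mem (zpow_mem (hH g'.t_mem) _) (hb p.1 (hTJ p hp))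
  have hadeg : ∀ p ∈ T, g.deg (a p) = l * p.2 + g.deg (b p.1) := fun p hp => by
    rw [g.deg_mul _ (zpow_mem (hH g'.t_mem) _) _ (hb p.1 (hTJ p hp)), g.deg_zpow (hH g'.t_mem),
      hl _ g'.t_mem, g'.deg_t]
    ring
  have hterm : ∀ (i : ℕ) (j : ℤ), d i j ε * unit φ 1 g'.t ε ^ j * unit φ (c i) (b i) ε =
      d i j ε * unit φ (c i) (g'.t ^ j * b i) ε := fun i j => by
    have h1 : unit φ 1 g'.t ε ^ j = unit φ 1 (g'.t ^ j) ε := congrFun (unit_zpow φ g'.t j) ε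
    have h2 : unit φ 1 (g'.t ^ j) ε * unit φ (c i) (b i) ε =
        unit φ (1 * c i) (g'.t ^ j * b i) ε := congrFun (unit_mul_unit φ _ _ _ _) ε
    rw [mul_assoc, h1, h2, one_mul]
  have hTsum : ∑ p ∈ T, x p * unit φ (c p.1) (a p) ε =
      ∑ i ∈ J, ((d i).sum fun j a => a * unit φ 1 g'.t ^ j) ε * unit φ (c i) (b i) ε := by
    rw [Finset.sum_sigma]
    refine Finset.sum_congr rfl fun i _ => ?_
    rw [Finsupp.sum, Finset.sum_apply, Finset.sum_mul]
    exact Finset.sum_congr rfl fun j _ => (hterm i j).symm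
  have hval : Val (gen φ g.N ε) (unit φ 1 g.t ε) (Δ + 1)
      (∑ p ∈ T, x p * unit φ (c p.1) (a p) ε) := by
    have hv : ∀ i ∈ J, Val (gen φ g.N ε) (unit φ 1 g.t ε) (Δ + 1)
        ((q i - (d i).sum fun j a => a * unit φ 1 g'.t ^ j) ε * unit φ (c i) (b i) ε) := by
      intro i hi
      have h1 := val_of_rescale hH hl0 hl ε ((hd i hi).2 ε)
      have h2 : unit φ (c i) (b i) ε ∈
          lau (gen φ g.N ε) (unit φ 1 g.t ε) (Set.Ici (g.deg (b i))) := by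
        have := mul_unit_mem_lau (φ := φ) (g := g) (i := ε) (one_mem _) (c i) (hb i hi)
          (s := Set.Ici (g.deg (b i))) (by simp)
        rwa [one_mul] at this
      refine (h1.mul (hg ε) (val_of_mem h2)).mono ?_
      have h3 := hR i₂ hi₂ i hi
      have h4 : l * j₂ + l ≤ l * M := by nlinarith
      rw [mul_add, hΔ]
      linarith
    have hs : ∀ s ⊆ J, Val (gen φ g.N ε) (unit φ 1 g.t ε) (Δ + 1)
        (∑ i ∈ s, (q i - (d i).sum fun j a => a * unit φ 1 g'.t ^ j) ε *
          unit φ (c i) (b i) ε) := by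
      intro s
      induction s using Finset.induction_on with
      | empty => exact fun _ => val_zero
      | insert i s hi ih =>
        intro hs
        rw [Finset.sum_insert hi]
        exact (hv i (hs (Finset.mem_insert_self _ _))).add (hg ε)
          (ih fun j hj => hs (Finset.mem_insert_of_mem hj))
    have h1 := (hs J subset_rfl).neg
    have h2 : ∑ i ∈ J, (q i - (d i).sum fun j a => a * unit φ 1 g'.t ^ j) ε *
        unit φ (c i) (b i) ε = -∑ p ∈ T, x p * unit φ (c p.1) (a p) ε := by
      rw [hTsum, ← zero_sub, ← h0, ← Finset.sum_sub_distrib]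
      exact Finset.sum_congr rfl fun i _ => by rw [Pi.sub_apply, sub_mul]
    rwa [h2, neg_neg] at h1
  have hmem : ∑ p ∈ T, x p * unit φ (c p.1) (a p) ε ∈
      lau (gen φ g.N ε) (unit φ 1 g.t ε) (Set.Ici (Δ + 1)) :=
    hval.mem (hg ε) (s := Set.univ) (sum_mem fun p hp =>
      mul_unit_mem_lau (hxg p hp) _ (hag p hp) (Set.mem_univ _))
  have hcomp := sum_filter_deg_eq_zero (hg ε) T x (fun p => c p.1) a hxg hag (Δ := Δ)
    (s := Set.Ici (Δ + 1)) (by simp) hmem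
  let e : ℕ → ℤ := fun i => (Δ - g.deg (b i)) / l
  have he : ∀ i j, l * j + g.deg (b i) = Δ → e i = j := fun i j hij => by
    change (Δ - g.deg (b i)) / l = j
    rw [← hij, add_sub_cancel_right, Int.mul_ediv_cancel_left _ hl0.ne']
  let J' := J.filter fun i => l * e i + g.deg (b i) = Δ ∧ d i (e i) ≠ 0
  have hJ' : J' ⊆ J := Finset.filter_subset _ _
  have hcomp' : ∑ i ∈ J', d i (e i) ε * unit φ (c i) (g'.t ^ e i * b i) ε = 0 := by
    rw [← hcomp]
    refine Finset.sum_bij' (fun i _ => ⟨i, e i⟩) (fun p _ => p.1) ?_ ?_ ?_ ?_ ?_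
    · intro i hi
      obtain ⟨h1, h2, h3⟩ := Finset.mem_filter.1 hi
      have hT : (⟨i, e i⟩ : Σ _ : ℕ, ℤ) ∈ T :=
        Finset.mem_sigma.2 ⟨h1, Finsupp.mem_support_iff.2 h3⟩
      exact Finset.mem_filter.2 ⟨hT, (hadeg _ hT).trans h2⟩
    · intro p hp
      obtain ⟨h1, h2⟩ := Finset.mem_filter.1 hp
      rw [hadeg p h1] at h2
      have h3 := he _ _ h2
      exact Finset.mem_filter.2 ⟨hTJ p h1, by rw [h3]; exact h2, by
        rw [h3]; exact Finsupp.mem_support_iff.1 (Finset.mem_sigma.1 h1).2⟩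
    · intro i _
      rfl
    · intro p hp
      obtain ⟨h1, h2⟩ := Finset.mem_filter.1 hp
      rw [hadeg p h1] at h2
      exact Sigma.ext rfl (heq_of_eq (he _ _ h2))
    · intro i _
      rfl
  have hnew : ∀ i, ∃ (δ : Cplx) (F : Finset A) (q' : ι → D) (c' : k) (s' : A), i ∈ J' →
      δ ≤ γ i ∧ ((∀ p ∈ X i, ∃ δ < γ i, Cx φ g'.N .sum δ p) → δ < γ i) ∧
      (F : Set A) ⊆ g'.N ∧ Cx φ F .led δ q' ∧ c' ≠ 0 ∧ s' ∈ g'.N ∧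
      d i (e i) = q' * unit φ c' s' := fun i => by
    by_cases hi : i ∈ J'
    · obtain ⟨h1, h2, h3⟩ := Finset.mem_filter.1 hi
      have hdX := (hd i h1).1 (e i)
      obtain ⟨δ, hδ, hδ', hcx⟩ : ∃ δ ≤ γ i,
          ((∀ p ∈ X i, ∃ δ < γ i, Cx φ g'.N .sum δ p) → δ < γ i) ∧
            Cx φ g'.N .sum δ (d i (e i)) := by
        by_cases hlt : ∀ p ∈ X i, ∃ δ < γ i, Cx φ g'.N .sum δ p
        · obtain ⟨δ, hδ, hcx⟩ := hlt _ hdX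
          exact ⟨δ, hδ.le, fun _ => hδ, hcx⟩
        · obtain ⟨δ, hδ, hcx⟩ := hX i h1 _ hdX
          exact ⟨δ, hδ, fun h => absurd h hlt, hcx⟩
      rcases hcx.sum_cases with h | ⟨q', c', s', hq', hc', hs', hq''⟩
      · exact absurd h.1 h3
      obtain ⟨F, hF, hq'⟩ := hq'.exists_finset
      exact ⟨δ, F, q', c', s', fun _ => ⟨hδ, hδ', hF, hq', hc', hs', hq''⟩⟩
    · exact ⟨0, ∅, 0, 0, 1, fun h => absurd h hi⟩
  choose δ F q' c' s' hnew using hnew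
  have hNC : g'.N ≤ C := fun a ha => hC ha.1
  have hsys : CosetSystem φ C J' F δ q' (fun i => c' i * c i)
      (fun i => s' i * (g'.t ^ e i * b i)) := by
    refine ⟨fun i hi => (hnew i hi).2.2.1.trans hNC, fun i hi => (hnew i hi).2.2.2.1,
      fun i hi => mul_ne_zero (hnew i hi).2.2.2.2.1 (h.ne i (hJ' hi)), fun i hi j hj hij => ?_⟩
    refine h.coset i (hJ' hi) j (hJ' hj) ?_
    have hti : s' i * g'.t ^ e i ∈ C :=
      mul_mem (hNC (hnew i hi).2.2.2.2.2.1) (zpow_mem (hC g'.t_mem) _)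
    have htj : s' j * g'.t ^ e j ∈ C :=
      mul_mem (hNC (hnew j hj).2.2.2.2.2.1) (zpow_mem (hC g'.t_mem) _)
    have h1 : b i * (b j)⁻¹ = (s' i * g'.t ^ e i)⁻¹ *
        (s' i * (g'.t ^ e i * b i) * (s' j * (g'.t ^ e j * b j))⁻¹) * (s' j * g'.t ^ e j) := by
      group
    rw [h1]
    exact mul_mem (mul_mem (inv_mem hti) hij) htj
  have hlt : ∑ i ∈ J', δ i < ∑ i ∈ J, γ i := by
    obtain ⟨i, hi, hXi⟩ := hX'
    exact h.sum_lt hJ' (fun i hi => (hnew i hi).1) ⟨i, hi, fun hi' => (hnew i hi').2.1 hXi⟩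
  have hq'0 := IH _ hlt _ J' F δ q' _ _ hsys rfl rfl ε (by
    rw [← hcomp']
    refine Finset.sum_congr rfl fun i hi => ?_
    have h1 : unit φ (c' i) (s' i) ε * unit φ (c i) (g'.t ^ e i * b i) ε =
        unit φ (c' i * c i) (s' i * (g'.t ^ e i * b i)) ε :=
      congrFun (unit_mul_unit φ _ _ _ _) ε
    rw [(hnew i hi).2.2.2.2.2.2, Pi.mul_apply, mul_assoc, h1])
  by_contra hne
  have he₂ := he i₂ j₂ rfl
  have hi₂' : i₂ ∈ J' := Finset.mem_filter.2 ⟨hi₂, by rw [he₂], by rw [he₂]; exact hne⟩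
  have h1 := (hnew i₂ hi₂').2.2.2.2.2.2
  rw [hq'0 i₂ hi₂', zero_mul, he₂] at h1
  exact hne h1

end Hughes

namespace Hughes

open MonoidAlgebra SkewLaurent

variable {k A : Type*} [DivisionRing k] [Group A] {ι : Type} {D : Type w} [DivisionRing D]
  {φ : ι → MonoidAlgebra k A →+* D} {C : Subgroup A} {J : Finset ℕ}
  {S : ℕ → Finset A} {γ : ℕ → Cplx} {q : ℕ → ι → D} {c : ℕ → k} {b : ℕ → A}

theorem CosetSystem.eq_zero_of_ne_bot [Nonempty ι] (hφ : HughesFree φ)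
    (h : CosetSystem φ C J S γ q c b) (IH : ∀ κ' < ∑ i ∈ J, γ i, ∀ n, Indep φ C κ' n)
    (IH' : ∀ n < ∑ i ∈ J, (S i).card, Indep φ C (∑ i ∈ J, γ i) n) {g : Grading A}
    (hg : g.H = Subgroup.closure ((⋃ i ∈ J, (S i : Set A)) ∪ b '' J)) {i₀ : ℕ} (hi₀ : i₀ ∈ J)
    (hb₀ : b i₀ = 1) {ε : ι} (h0 : ∑ i ∈ J, q i ε * unit φ (c i) (b i) ε = 0) :
    ∀ i ∈ J, q i = 0 := by
  classical
  have hfin : (⋃ i ∈ J, (S i : Set A)).Finite := J.finite_toSet.biUnion fun i _ => (S i).finite_toSet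
  have hFG : g.H.FG := Subgroup.fg_iff _ |>.2 ⟨_, hg.symm, hfin.union (J.finite_toSet.image b)⟩
  have hSU : ∀ i ∈ J, (S i : Set A) ⊆ ⋃ i ∈ J, (S i : Set A) := fun i hi =>
    Set.subset_biUnion_of_mem (u := fun i => (S i : Set A)) (Finset.mem_coe.2 hi)
  have hSg : ∀ i ∈ J, (S i : Set A) ⊆ g.H := fun i hi a ha => by
    rw [hg]
    exact Subgroup.subset_closure (Or.inl (hSU i hi ha))
  have hbg : ∀ i ∈ J, b i ∈ g.H := fun i hi => by
    rw [hg]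
    exact Subgroup.subset_closure (Or.inr ⟨i, hi, rfl⟩)
  have hskew := hφ.skewLaurent g hFG
  by_cases hlab : ∀ i ∈ J, (S i : Set A) ⊆ g.N
  · have hex : ∃ i₁ ∈ J, g.deg (b i₁) ≠ 0 := by
      by_contra! hall
      have hle : g.H ≤ g.N := by
        conv_lhs => rw [hg]
        rw [Subgroup.closure_le, Set.union_subset_iff]
        refine ⟨Set.iUnion₂_subset hlab, ?_⟩
        rintro _ ⟨i, hi, rfl⟩
        exact ⟨hbg i hi, hall i hi⟩
      have h1 := (hle g.t_mem).2
      rw [g.deg_t] at h1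
      exact one_ne_zero h1
    obtain ⟨i₁, hi₁, hne⟩ := hex
    refine h.eq_zero_of_labels_mem IH (hskew ε) hlab hbg hi₀ hi₁ ?_ h0
    rwa [hb₀, g.deg_one]
  · push Not at hlab
    obtain ⟨i₁, hi₁, hnot⟩ := hlab
    obtain ⟨x, hxS, hxN⟩ := Set.not_subset.1 hnot
    have hx0 : g.deg x ≠ 0 := fun h => hxN ⟨hSg i₁ hi₁ hxS, h⟩
    have hle : Subgroup.closure (⋃ i ∈ J, (S i : Set A)) ≤ g.H :=
      (Subgroup.closure_le _).2 (Set.iUnion₂_subset hSg)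
    obtain ⟨l, g', hl0, hg', hl⟩ := g.exists_rescale hle
      (Subgroup.subset_closure (hSU i₁ hi₁ hxS)) hx0
    rw [← hg'] at hle hl
    have hFG' : g'.H.FG := Subgroup.fg_iff _ |>.2 ⟨_, hg'.symm, hfin⟩
    have hC : g'.H ≤ C := by
      rw [hg', Subgroup.closure_le]
      exact Set.iUnion₂_subset h.labels
    have hSg' : ∀ i ∈ J, (S i : Set A) ⊆ g'.H := fun i hi a ha => by
      rw [hg']
      exact Subgroup.subset_closure (hSU i hi ha)
    have hskew' := hφ.skewLaurent g' hFG'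
    have hNC : g'.N ≤ C := fun a ha => hC ha.1
    have hdich : ∀ i ∈ J, DichLed φ g' (S i) (γ i) (q i) := fun i hi => by
      refine (dichotomy (hSg' i hi) hskew' (Γ := γ i) ?_ (h.cx i hi) le_rfl).2.2 rfl
      intro δ hδ
      refine eq_zero_of_indep IH hNC δ (hδ.trans_le ?_)
      exact Finset.single_le_sum (fun j _ => Cplx.zero_le (γ j)) hi
    by_cases hhom : ∀ i ∈ J, Cx φ ((S i : Set A) ∩ g'.N) .led (γ i) (q i)
    · have hcard : ∑ i ∈ J, ((S i).filter (· ∈ g'.N)).card < ∑ i ∈ J, (S i).card := by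
        refine Finset.sum_lt_sum (fun i _ => Finset.card_filter_le _ _) ⟨i₁, hi₁, ?_⟩
        refine Finset.card_lt_card (Finset.filter_ssubset.2 ⟨x, hxS, fun hx => hx0 ?_⟩)
        rw [hl x hx.1, hx.2, mul_zero]
      refine IH' _ hcard J (fun i => (S i).filter (· ∈ g'.N)) γ q c b
        ⟨fun i hi => ?_, fun i hi => ?_, h.ne, h.coset⟩ rfl rfl ε h0
      · rw [Finset.coe_filter]
        exact fun a ha => h.labels i hi ha.1
      · rw [Finset.coe_filter]
        exact hhom i hi
    · push Not at hhom
      obtain ⟨i₂, hi₂, hhom⟩ := hhom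
      have hlt := (hdich i₂ hi₂).resolve_left hhom
      refine h.eq_zero_of_expansion IH hskew hskew' hle hC hl0 hl hbg
        (X := fun i => if i = i₂ then sumsLT φ g'.N (γ i) else sumsLE φ g'.N (γ i))
        (fun i _ p hp => ?_) ⟨i₂, hi₂, fun p hp => ?_⟩ (fun i hi => ?_) h0
      · split_ifs at hp
        · obtain ⟨δ, hδ, hp⟩ := hp
          exact ⟨δ, hδ.le, hp⟩
        · exact hp
      · simp only [if_true] at hp
        exact hp
      · split_ifs with heq
        · rw [heq]
          exact hlt
        · rcases hdich i hi with h1 | h1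
          · refine ex_of_mem ?_ (zero_mem_sumsLE _ _)
            exact ⟨γ i, le_rfl, (h1.mono Set.inter_subset_right).led_to_sum (one_mem g'.N)⟩
          · have hsub : sumsLT φ g'.N (γ i) ⊆ sumsLE φ g'.N (γ i) :=
              fun _ ⟨δ, hδ, hx⟩ => ⟨δ, hδ.le, hx⟩
            exact Ex.mono hsub h1

theorem CosetSystem.eq_zero_of_eq_bot [Nonempty ι] (h : CosetSystem φ C J S γ q c b)
    (hH : Subgroup.closure ((⋃ i ∈ J, (S i : Set A)) ∪ b '' J) = ⊥) {ε : ι}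
    (h0 : ∑ i ∈ J, q i ε * unit φ (c i) (b i) ε = 0) : ∀ i ∈ J, q i = 0 := by
  intro i hi
  rw [Subgroup.closure_eq_bot_iff] at hH
  have hb : ∀ j ∈ J, b j = 1 := fun j hj => hH (Or.inr ⟨j, hj, rfl⟩)
  have hJ : ∀ j ∈ J, j ≠ i → q j ε * unit φ (c j) (b j) ε = 0 := fun j hj hji => by
    refine absurd (h.coset j hj i hi ?_) hji
    rw [hb j hj, hb i hi, inv_one, mul_one]
    exact one_mem C
  rw [Finset.sum_eq_single_of_mem i hi hJ] at h0
  have hS : ∀ s ∈ (S i : Set A), s = 1 := fun s hs =>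
    hH (Or.inl (Set.mem_biUnion (Finset.mem_coe.2 hi) hs))
  obtain ⟨d, hd⟩ := (h.cx i hi).exists_const hS
  have hq : q i ε = 0 := (mul_eq_zero.1 h0).resolve_right (unit_ne_zero φ (h.ne i hi) _ ε)
  have hd0 : d = 0 := by
    by_contra hne
    exact unit_ne_zero φ hne 1 ε (by rw [← hd]; exact hq)
  rw [hd, hd0]
  funext j
  simp [unit]

theorem CosetSystem.eq_zero_of_lt [Nonempty ι] (hA : LocallyIndicable A) (hφ : HughesFree φ)
    (h : CosetSystem φ C J S γ q c b) (IH : ∀ κ' < ∑ i ∈ J, γ i, ∀ n, Indep φ C κ' n)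
    (IH' : ∀ n < ∑ i ∈ J, (S i).card, Indep φ C (∑ i ∈ J, γ i) n) {ε : ι}
    (h0 : ∑ i ∈ J, q i ε * unit φ (c i) (b i) ε = 0) : ∀ i ∈ J, q i = 0 := by
  rcases J.eq_empty_or_nonempty with rfl | ⟨i₀, hi₀⟩
  · simp
  have h' : CosetSystem φ C J S γ q c fun i => b i * (b i₀)⁻¹ :=
    ⟨h.labels, h.cx, h.ne, fun i hi j hj hij => h.coset i hi j hj (by
      rwa [mul_inv_rev, inv_inv, mul_assoc, inv_mul_cancel_left] at hij)⟩
  have h0' : ∑ i ∈ J, q i ε * unit φ (c i) (b i * (b i₀)⁻¹) ε = 0 := by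
    have h1 : ∀ i, unit φ (c i) (b i * (b i₀)⁻¹) ε =
        unit φ (c i) (b i) ε * unit φ 1 (b i₀)⁻¹ ε := fun i => by
      have := congrFun (unit_mul_unit φ (c i) 1 (b i) (b i₀)⁻¹) ε
      rw [mul_one] at this
      exact this.symm
    simp only [h1, ← mul_assoc]
    rw [← Finset.sum_mul, h0, zero_mul]
  by_cases hH : Subgroup.closure ((⋃ i ∈ J, (S i : Set A)) ∪ (fun i => b i * (b i₀)⁻¹) '' J) = ⊥
  · exact h'.eq_zero_of_eq_bot hH h0'
  · have hfin : (⋃ i ∈ J, (S i : Set A)).Finite :=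
      J.finite_toSet.biUnion fun i _ => (S i).finite_toSet
    obtain ⟨g, hg⟩ := exists_grading hA
      (Subgroup.fg_iff _ |>.2 ⟨_, rfl, hfin.union (J.finite_toSet.image _)⟩) hH
    exact h'.eq_zero_of_ne_bot hφ IH IH' hg hi₀ (mul_inv_cancel _) h0'

/-- Rational expressions over a subgroup are independent on distinct cosets, in every component. -/
theorem indep [Nonempty ι] (hA : LocallyIndicable A) (hφ : HughesFree φ) (C : Subgroup A)
    (κ : Cplx) (n : ℕ) : Indep φ C κ n := by
  induction κ using WellFoundedLT.induction generalizing n with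
  | ind κ IH =>
    induction n using Nat.strong_induction_on with
    | _ n IH' =>
      rintro J S γ q c b h rfl rfl ε h0
      exact h.eq_zero_of_lt hA hφ IH IH' h0

end Hughes

namespace Hughes

open MonoidAlgebra SkewLaurent

variable {k A : Type*} [DivisionRing k] [Group A] {ι : Type} {D : Type w} [DivisionRing D]
  {φ : ι → MonoidAlgebra k A →+* D}

theorem Cx.eq_zero_of_apply [Nonempty ι] (hA : LocallyIndicable A) (hφ : HughesFree φ)
    {C : Subgroup A} {δ : Cplx} {p : ι → D} (hp : Cx φ C .sum δ p) {i : ι} (hi : p i = 0) :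
    p = 0 :=
  eq_zero_of_indep (κ := δ.wt) (fun κ' _ n => indep hA hφ C κ' n) le_rfl δ (Cplx.lt_wt δ) p hp
    ⟨i, hi⟩

variable (φ) in
/-- The ring of all families given by rational expressions with labels in `C`. -/
def rational (C : Subgroup A) : Subring (ι → D) where
  carrier := {p | ∃ δ, Cx φ C .sum δ p}
  zero_mem' := ⟨0, Cx.zero⟩
  one_mem' := ⟨_, by
    rw [← add_zero (1 : ι → D)]
    exact (Cx.led Cx.one Cx.zero).led_to_sum (one_mem C)⟩
  add_mem' := fun ⟨_, hp⟩ ⟨_, hq⟩ => ⟨_, hp.sum_add rfl hq⟩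
  neg_mem' := fun ⟨_, hp⟩ => ⟨_, hp.sum_neg rfl⟩
  mul_mem' := by
    rintro p q ⟨γ, hp⟩ ⟨δ, hq⟩
    have key : ∀ {r : ι → D} {β : Cplx}, Cx φ C .sum β r → β ≤ max γ δ →
        r ∈ wordsRing φ C (max γ δ).wt := fun {r β} hr hβ => by
      have h1 : r ∈ sumsLT φ C (max γ δ).wt := ⟨β, hβ.trans_lt (Cplx.lt_wt _), hr⟩
      have h2 : r ∈ sumsLT φ C (max γ δ).wt.wt.wt :=
        sumsLT_mono ((Cplx.lt_wt _).trans (Cplx.lt_wt _)).le h1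
      exact sumsLT_subset_words _ h2
    have h1 := mul_mem (key hp (le_max_left _ _)) (key hq (le_max_right _ _))
    obtain ⟨δ, -, h2⟩ := words_subset_sumsLT _ h1
    exact ⟨δ, h2⟩

theorem mem_rational {C : Subgroup A} {p : ι → D} :
    p ∈ rational φ C ↔ ∃ δ, Cx φ C .sum δ p := Iff.rfl

theorem unit_mem_rational {C : Subgroup A} {a : A} (ha : a ∈ C) (c : k) :
    unit φ c a ∈ rational φ C := by
  by_cases hc : c = 0
  · have : unit φ c a = 0 := by
      funext i
      simp [unit, hc]
    rw [this]
    exact zero_mem _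
  · have := Cx.one.word (φ := φ) hc ha
    rw [one_mul] at this
    exact mem_rational.2 ⟨_, this⟩

theorem inv_mem_rational [Nonempty ι] (hA : LocallyIndicable A) (hφ : HughesFree φ)
    {C : Subgroup A} {p : ι → D} (hp : p ∈ rational φ C) : p⁻¹ ∈ rational φ C := by
  by_cases h0 : p = 0
  · have : (0 : ι → D)⁻¹ = 0 := funext fun i => inv_zero
    rw [h0, this]
    exact zero_mem _
  · obtain ⟨δ, hp⟩ := mem_rational.1 hp
    obtain ⟨-, m, c, s, hm, hc, hs, he⟩ := hp.sum_inv h0 fun ⟨i, hi⟩ =>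
      hp.eq_zero_of_apply hA hφ hi
    rw [he]
    exact mem_rational.2 ⟨_, hm.word hc hs⟩

theorem exists_rational_of_mem_gen [Nonempty ι] (hA : LocallyIndicable A) (hφ : HughesFree φ)
    {C : Subgroup A} {i : ι} {x : D} (hx : x ∈ gen φ C i) : ∃ p ∈ rational φ C, p i = x := by
  induction hx using Subfield.closure_induction with
  | mem x hx =>
    obtain ⟨a, ha, c, rfl⟩ := hx
    exact ⟨_, unit_mem_rational ha c, rfl⟩
  | one => exact ⟨1, one_mem _, rfl⟩
  | add x y _ _ hx hy =>
    obtain ⟨p, hp, rfl⟩ := hx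
    obtain ⟨q, hq, rfl⟩ := hy
    exact ⟨_, add_mem hp hq, rfl⟩
  | neg x _ hx =>
    obtain ⟨p, hp, rfl⟩ := hx
    exact ⟨_, neg_mem hp, rfl⟩
  | inv x _ hx =>
    obtain ⟨p, hp, rfl⟩ := hx
    exact ⟨_, inv_mem_rational hA hφ hp, rfl⟩
  | mul x y _ _ hx hy =>
    obtain ⟨p, hp, rfl⟩ := hx
    obtain ⟨q, hq, rfl⟩ := hy
    exact ⟨_, mul_mem hp hq, rfl⟩

/-- Any two components of a Hughes-free family generate isomorphic division rings. -/
theorem exists_ringHom_gen [Nonempty ι] (hA : LocallyIndicable A) (hφ : HughesFree φ)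
    (C : Subgroup A) (i j : ι) : ∃ α : gen φ C i →+* D, ∀ (a : A) (ha : a ∈ C) (c : k),
      α ⟨unit φ c a i, unit_mem_gen ha c i⟩ = unit φ c a j := by
  have hex : ∀ x : gen φ C i, ∃ p ∈ rational φ C, p i = x := fun x =>
    exists_rational_of_mem_gen hA hφ x.2
  choose p hp hpx using hex
  have huniq : ∀ (x : gen φ C i) (r : ι → D), r ∈ rational φ C → r i = x → p x = r := by
    intro x r hr hrx
    obtain ⟨δ, hδ⟩ := mem_rational.1 (sub_mem (hp x) hr)
    have h1 : (p x - r) i = 0 := by rw [Pi.sub_apply, hpx, hrx, sub_self]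
    exact sub_eq_zero.1 (hδ.eq_zero_of_apply hA hφ h1)
  refine ⟨⟨⟨⟨fun x => p x j, ?_⟩, fun x y => ?_⟩, ?_, fun x y => ?_⟩, fun a ha c => ?_⟩
  · change p 1 j = 1
    rw [huniq 1 1 (one_mem _) rfl]
    rfl
  · change p (x * y) j = p x j * p y j
    rw [huniq (x * y) (p x * p y) (mul_mem (hp x) (hp y)) (by rw [Pi.mul_apply, hpx, hpx]; rfl)]
    rfl
  · change p 0 j = 0
    rw [huniq 0 0 (zero_mem _) rfl]
    rfl
  · change p (x + y) j = p x j + p y j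
    rw [huniq (x + y) (p x + p y) (add_mem (hp x) (hp y)) (by rw [Pi.add_apply, hpx, hpx]; rfl)]
    rfl
  · change p _ j = _
    rw [huniq _ (unit φ c a) (unit_mem_rational ha c) rfl]

theorem coset_sum_eq_zero [Nonempty ι] (hA : LocallyIndicable A) (hφ : HughesFree φ)
    (C : Subgroup A) (i : ι) (J : Finset ℕ) (b : ℕ → A)
    (hb : ∀ m ∈ J, ∀ n ∈ J, b m * (b n)⁻¹ ∈ C → m = n) (x : ℕ → D)
    (hx : ∀ n ∈ J, x n ∈ gen φ C i) (h0 : ∑ n ∈ J, x n * unit φ 1 (b n) i = 0) :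
    ∀ n ∈ J, x n = 0 := by
  classical
  set J' := J.filter fun n => x n ≠ 0 with hJ'
  have hsub : J' ⊆ J := Finset.filter_subset _ _
  have hex : ∀ n, ∃ (δ : Cplx) (F : Finset A) (q : ι → D) (c : k) (s : A), n ∈ J' →
      (F : Set A) ⊆ C ∧ Cx φ F .led δ q ∧ c ≠ 0 ∧ s ∈ C ∧ x n = q i * unit φ c s i := fun n => by
    by_cases hn : n ∈ J'
    · obtain ⟨hn, hn0⟩ := Finset.mem_filter.1 hn
      obtain ⟨p, hp, hpx⟩ := exists_rational_of_mem_gen hA hφ (hx n hn)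
      obtain ⟨δ, hp⟩ := mem_rational.1 hp
      rcases hp.sum_cases with h | ⟨q, c, s, hq, hc, hs, rfl⟩
      · exact absurd (by rw [← hpx, h.1]; rfl) hn0
      obtain ⟨F, hF, hq⟩ := hq.exists_finset
      exact ⟨δ, F, q, c, s, fun _ => ⟨hF, hq, hc, hs, hpx.symm⟩⟩
    · exact ⟨0, ∅, 0, 0, 1, fun h => absurd h hn⟩
  choose δ F q c s hex using hex
  have hsys : CosetSystem φ C J' F δ q c fun n => s n * b n := by
    refine ⟨fun n hn => (hex n hn).1, fun n hn => (hex n hn).2.1, fun n hn => (hex n hn).2.2.1,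
      fun m hm n hn hmn => hb m (hsub hm) n (hsub hn) ?_⟩
    have h1 : b m * (b n)⁻¹ = (s m)⁻¹ * (s m * b m * (s n * b n)⁻¹) * s n := by group
    rw [h1]
    exact mul_mem (mul_mem (inv_mem (hex m hm).2.2.2.1) hmn) (hex n hn).2.2.2.1
  have hq0 := indep hA hφ C _ _ J' F δ q c _ hsys rfl rfl i (by
    rw [← h0, ← Finset.sum_filter_of_ne (p := fun n => x n ≠ 0)
      (fun n _ h => left_ne_zero_of_mul h)]
    refine Finset.sum_congr rfl fun n hn => ?_
    have h1 := congrFun (unit_mul_unit φ (c n) 1 (s n) (b n)) i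
    rw [mul_one] at h1
    rw [(hex n hn).2.2.2.2, ← h1, Pi.mul_apply, mul_assoc])
  intro n hn
  by_contra hne
  have hn' : n ∈ J' := Finset.mem_filter.2 ⟨hn, hne⟩
  refine hne ?_
  rw [(hex n hn').2.2.2.2, hq0 n hn', Pi.zero_apply, zero_mul]

/-- Elements of distinct cosets of a subgroup are independent over the division ring that the
subgroup generates. -/
theorem linearIndependent_coset [Nonempty ι] (hA : LocallyIndicable A) (hφ : HughesFree φ)
    (C : Subgroup A) (i : ι) {X : Type*} (b : X → A) (hb : ∀ x y, b x * (b y)⁻¹ ∈ C → x = y) :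
    LinearIndependent (gen φ C i) fun x => unit φ 1 (b x) i := by
  classical
  rw [linearIndependent_iff']
  intro s f hf x hx
  have : Nonempty X := ⟨x⟩
  obtain ⟨e, he⟩ : ∃ e : X → ℕ, Set.InjOn e s := by
    refine ⟨fun x => if h : x ∈ s then s.equivFin ⟨x, h⟩ else 0, fun x hx y hy hxy => ?_⟩
    simp only [dif_pos (Finset.mem_coe.1 hx), dif_pos (Finset.mem_coe.1 hy)] at hxy
    simpa using s.equivFin.injective (Fin.ext hxy)
  have hinv : ∀ y ∈ s, Function.invFunOn e s (e y) = y := fun y hy =>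
    he (Function.invFunOn_mem ⟨y, hy, rfl⟩) hy (Function.invFunOn_eq ⟨y, hy, rfl⟩)
  have h1 := coset_sum_eq_zero hA hφ C i (s.image e) (fun n => b (Function.invFunOn e s n))
    (fun m hm n hn hmn => by
      obtain ⟨y, hy, rfl⟩ := Finset.mem_image.1 hm
      obtain ⟨z, hz, rfl⟩ := Finset.mem_image.1 hn
      rw [hinv y hy, hinv z hz] at hmn
      rw [hb y z hmn])
    (fun n => f (Function.invFunOn e s n)) (fun n _ => (f _).2) (by
      rw [Finset.sum_image he, ← hf]
      exact Finset.sum_congr rfl fun y hy => by rw [hinv y hy, Subfield.smul_def, smul_eq_mul]) (e x)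
    (Finset.mem_image_of_mem e hx)
  rw [hinv x hx] at h1
  exact Subtype.ext h1

theorem inv_mem_divisionClosure {s : Set D} {x : D} (hx : x ∈ divisionClosure s) :
    x⁻¹ ∈ divisionClosure s := by
  by_cases h0 : x = 0
  · rwa [h0, inv_zero, ← h0]
  refine Subring.mem_sInf.2 fun S hS => ?_
  obtain ⟨y, hy, hxy, -⟩ := hS.1 x (Subring.mem_sInf.1 hx S hS) h0
  rwa [inv_eq_of_mul_eq_one_right hxy]

theorem ringZPow_eq_zpow (x : D) (j : ℤ) : ringZPow x j = x ^ j := by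
  unfold ringZPow
  split_ifs with h
  · conv_rhs => rw [← Int.toNat_of_nonneg h]
    rw [zpow_natCast]
  · conv_rhs => rw [← neg_neg j, ← Int.toNat_of_nonneg (show 0 ≤ -j by omega)]
    rw [zpow_neg, zpow_natCast, Ring.inverse_eq_inv, inv_pow]

/-- Families of pullbacks of a Hughes-free embedding along injective homomorphisms. -/
theorem hughesFree_of_isHughesFreeEmbedding {B : Type*} [Group B]
    {φ : ι → MonoidAlgebra k B →+* D} {φA : MonoidAlgebra k A →+* D}
    (hφA : IsHughesFreeEmbedding φA) (f : ι → B →* A) (hf : ∀ i, Function.Injective (f i))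
    (hφ : ∀ i b c, φ i (single b c) = φA (single (f i b) c)) : HughesFree φ := by
  intro g hg i
  have hmem : ∀ a : g.H.map (f i), ∃ b ∈ g.H, f i b = a := fun a => a.2
  choose pre hpre hpre' using hmem
  have hpre_mul : ∀ a b, pre (a * b) = pre a * pre b := fun a b => by
    apply hf i
    rw [map_mul, hpre', hpre', hpre']
    rfl
  let d : g.H.map (f i) →* Multiplicative ℤ :=
    { toFun := fun a => Multiplicative.ofAdd (g.deg (pre a))
      map_one' := by
        have : pre 1 = 1 := hf i (by rw [hpre', map_one]; rfl)
        rw [this, g.deg_one]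
        rfl
      map_mul' := fun a b => by
        rw [hpre_mul, g.deg_mul _ (hpre a) _ (hpre b)]
        rfl }
  have hpre_f : ∀ b (hb : b ∈ g.H), pre ⟨f i b, b, hb, rfl⟩ = b := fun b hb =>
    hf i (hpre' _)
  have hd : ∀ b (hb : b ∈ g.H), d ⟨f i b, b, hb, rfl⟩ = Multiplicative.ofAdd (g.deg b) :=
    fun b hb => by
      change Multiplicative.ofAdd (g.deg (pre _)) = _
      rw [hpre_f b hb]
  have hsurj : Function.Surjective d := fun z =>
    ⟨_, (hd (g.t ^ z.toAdd) (zpow_mem g.t_mem _)).trans (by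
      rw [g.deg_zpow g.t_mem, g.deg_t, mul_one]
      rfl)⟩
  have hfg : (g.H.map (f i)).FG := by
    obtain ⟨s, hs⟩ := hg
    exact (Subgroup.fg_iff _).2 ⟨f i '' s, by rw [← MonoidHom.map_closure, hs],
      s.finite_toSet.image _⟩
  have key := hφA.2.2 (g.H.map (f i)) hfg d.ker ⟨f i g.t, g.t, g.t_mem, rfl⟩
    ⟨d, hsurj, rfl, by rw [hd _ g.t_mem, g.deg_t]⟩
  set R : Subring D := divisionClosure (Set.range (φA.comp (MonoidAlgebra.mapDomainRingHom k
    ((g.H.map (f i)).subtype.comp d.ker.subtype)))) with hR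
  have hgen : ∀ x ∈ gen φ g.N i, x ∈ R := by
    intro x hx
    induction hx using Subfield.closure_induction with
    | mem x hx =>
      obtain ⟨b, hb, c, rfl⟩ := hx
      refine subset_divisionClosure _ ⟨single ⟨⟨f i b, b, hb.1, rfl⟩, ?_⟩ c, ?_⟩
      · rw [MonoidHom.mem_ker, hd b hb.1, hb.2]
        rfl
      · rw [RingHom.comp_apply, MonoidAlgebra.mapDomainRingHom_apply,
          MonoidAlgebra.mapDomain_single, hφ]
        rfl
    | one => exact one_mem R
    | add x y _ _ hx hy => exact R.add_mem hx hy
    | neg x _ hx => exact R.neg_mem hx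
    | inv x _ hx => exact inv_mem_divisionClosure hx
    | mul x y _ _ hx hy => exact R.mul_mem hx hy
  rw [linearIndependent_iff]
  intro l hl
  have h1 := key (l.mapRange (fun x : gen φ g.N i => (x : D)) rfl) (fun j => hgen _ (l j).2) (by
    rw [Finsupp.sum_mapRange_index (fun _ => zero_mul _), ← hl, Finsupp.linearCombination_apply]
    refine Finsupp.sum_congr fun j _ => ?_
    rw [ringZPow_eq_zpow, hφ]
    rfl)
  ext j
  exact DFunLike.congr_fun h1 j

end Hughes

namespace TwistedTensor

variable {D : Type w} [DivisionRing D] {d : Data D}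

/-- Words starting with two letters of the same type, the first one with coefficient `1`. -/
def Stalls (l : List d.Letter) : Prop :=
  ∃ j i i' l', l = ⟨j, i⟩ :: ⟨j, i'⟩ :: l' ∧ d.basis j i = 1

open Classical in
/-- The projection killing the stalling words. -/
noncomputable def prune : TensorRing d →ₗ[D] TensorRing d :=
  Finsupp.linearCombination D fun l => if Stalls l then 0 else word l 1

theorem prune_word_of_stalls {l : List d.Letter} (h : Stalls l) (a : D) :
    prune (word l a) = 0 := by
  refine (Finsupp.linearCombination_single D a l).trans ?_
  rw [if_pos h, smul_zero]

theorem prune_word {l : List d.Letter} (h : ¬ Stalls l) (a : D) :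
    prune (word l a) = word l a := by
  refine (Finsupp.linearCombination_single D a l).trans ?_
  rw [if_neg h, smul_word, mul_one]

variable (d) in
/-- The shift operators, made square-zero by killing the stalling words. -/
noncomputable def sqShift (j : d.J) : TensorRing d →+ TensorRing d :=
  prune.toAddMonoidHom.comp (shift d j)

theorem sqShift_apply (j : d.J) (x : TensorRing d) : sqShift d j x = prune (shift d j x) := rfl

theorem isTwisted_sqShift : IsTwisted d (sqShift d) := fun j e x => by
  rw [sqShift_apply, isTwisted_shift, map_smul, sqShift_apply]

theorem sqShift_basis {j : d.J} {i : d.ι j} {l : List d.Letter} (h : ¬ Stalls (⟨j, i⟩ :: l)) :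
    sqShift d j (word l (d.basis j i)) = word (⟨j, i⟩ :: l) 1 := by
  rw [sqShift_apply, shift_basis, prune_word h]

theorem sqShift_sqShift (hα : ∀ j (e : d.E j), d.α j e = e) {j : d.J} {o : d.ι j}
    (ho : d.basis j o = 1) (x : TensorRing d) : sqShift d j (sqShift d j x) = 0 := by
  induction x using induction_word with
  | zero => simp
  | add x y hx hy => simp only [map_add, hx, hy, add_zero]
  | hword l a =>
    rw [sqShift_apply j (word l a), shift_word, Finsupp.sum, map_sum, map_sum]
    refine Finset.sum_eq_zero fun i _ => ?_
    generalize (d.basis j).repr a i = e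
    by_cases h : Stalls (⟨j, i⟩ :: l)
    · rw [prune_word_of_stalls h, map_zero]
    · have he : (d.basis j).repr (e : D) = Finsupp.single o e := by
        have : (e : D) = e • d.basis j o := by rw [ho, Subfield.smul_def, smul_eq_mul, mul_one]
        rw [this, map_smul, Module.Basis.repr_self, Finsupp.smul_single, smul_eq_mul, mul_one]
      rw [prune_word h, hα, sqShift_apply, shift_word, he, Finsupp.sum_single_index (by simp),
        prune_word_of_stalls ⟨j, o, i, l, rfl, ho⟩]

end TwistedTensor

namespace PowerSeries

variable {R : Type*} [Semiring R]

/-- The coefficients of `p` vanish beyond degree `n`, where the coefficient is `r`. -/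
def HasTop (n : ℕ) (p : PowerSeries R) (r : R) : Prop :=
  (∀ m, n < m → coeff m p = 0) ∧ coeff n p = r

theorem HasTop.mul {n m : ℕ} {p q : PowerSeries R} {r s : R} (hp : HasTop n p r)
    (hq : HasTop m q s) : HasTop (n + m) (p * q) (r * s) := by
  have key : ∀ x : ℕ × ℕ, n + m ≤ x.1 + x.2 → x ≠ (n, m) → coeff x.1 p * coeff x.2 q = 0 := by
    rintro ⟨i, j⟩ hij hne
    rcases lt_or_ge n i with h | h
    · rw [hp.1 _ h, zero_mul]
    rcases lt_or_ge m j with h' | h'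
    · rw [hq.1 _ h', mul_zero]
    · simp only at hij
      exact absurd (Prod.ext (by simp only; omega) (by simp only; omega)) hne
  constructor
  · intro N hN
    rw [coeff_mul]
    refine Finset.sum_eq_zero fun x hx => ?_
    rw [Finset.HasAntidiagonal.mem_antidiagonal] at hx
    refine key x (by omega) ?_
    rintro rfl
    simp only at hx
    omega
  · rw [coeff_mul, Finset.sum_eq_single (n, m), hp.2, hq.2]
    · intro x hx hne
      rw [Finset.HasAntidiagonal.mem_antidiagonal] at hx
      exact key x hx.ge hne
    · intro h
      exact (h (Finset.HasAntidiagonal.mem_antidiagonal.2 rfl)).elim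

theorem hasTop_C (r : R) : HasTop 0 (C r) r :=
  ⟨fun m hm => by rw [coeff_C, if_neg hm.ne'], by simp⟩

theorem hasTop_one : HasTop 0 (1 : PowerSeries R) 1 :=
  ⟨fun m hm => by rw [coeff_one, if_neg hm.ne'], by simp⟩

theorem hasTop_linear (r : R) : HasTop 1 (1 + C r * X) r := by
  constructor
  · rintro (_ | m) hm
    · omega
    · rw [map_add, coeff_one, if_neg (by omega), coeff_succ_mul_X, coeff_C, if_neg (by omega),
        zero_add]
  · rw [map_add, coeff_one, if_neg one_ne_zero, coeff_succ_mul_X, zero_add]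
    simp

theorem linear_mul_linear {R : Type*} [Ring R] {r : R} (hr : r * r = 0) :
    (1 + C r * X) * (1 + C (-r) * X) = 1 := by
  have h : C r * X * (C r * X) = (0 : PowerSeries R) := by
    rw [mul_assoc, ← mul_assoc X, (commute_X (C r)).symm.eq, mul_assoc, ← mul_assoc, ← map_mul,
      hr, map_zero, zero_mul]
  rw [map_neg, neg_mul, add_mul, mul_add, mul_add, mul_neg (C r * X), h]
  simp

theorem isUnit_linear {R : Type*} [Ring R] (r : R) : IsUnit (1 + C r * X : PowerSeries R) := by
  have h : constantCoeff (1 + C r * X : PowerSeries R) = ((1 : Rˣ) : R) := by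
    simp
  exact ⟨⟨_, _, mul_invOfUnit _ 1 h, invOfUnit_mul _ 1 h⟩, rfl⟩

end PowerSeries

namespace HNNExtension

open MonoidAlgebra NormalWord

variable {k A : Type*} [DivisionRing k] [Group A] {C₁ C₂ : Subgroup A} {ψ : C₁ ≃* C₂}

theorem exists_monoidAlgebra_lift {R : Type*} [Ring R] (F : MonoidAlgebra k A →+* R) (s : Rˣ)
    (hs : ∀ (c : C₁) (r : k), (s : R) * F (single (c : A) r) = F (single (ψ c : A) r) * s) :
    ∃ Φ : MonoidAlgebra k (HNNExtension A C₁ C₂ ψ) →+* R,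
      (∀ a r, Φ (single (of a) r) = F (single a r)) ∧
      ∀ u : ℤˣ, Φ (single (t ^ (u : ℤ)) 1) = (s ^ (u : ℤ) : Rˣ) := by
  let f : A →* Rˣ := MonoidHom.toHomUnits ((F : MonoidAlgebra k A →* R).comp (MonoidAlgebra.of k A))
  have hf : ∀ a, (f a : R) = F (single a 1) := fun a => rfl
  let g : HNNExtension A C₁ C₂ ψ →* Rˣ := lift f s fun c => by
    ext
    rw [Units.val_mul, Units.val_mul, hf, hf, hs]
  have hcomm : ∀ (r : k) x, Commute (F (single 1 r)) (g x : R) := by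
    intro r x
    induction x using HNNExtension.induction_on with
    | of a =>
      rw [lift_of, hf, commute_iff_eq, ← map_mul, ← map_mul, single_mul_single, single_mul_single]
      simp
    | t =>
      rw [lift_t, commute_iff_eq]
      simpa using (hs 1 r).symm
    | mul x y hx hy => rw [map_mul, Units.val_mul]; exact hx.mul_right hy
    | inv x hx => rw [map_inv]; exact hx.units_inv_right
  have hcomm' : ∀ r x, Commute (F.comp singleOneRingHom r) ((Units.coeHom R).comp g x) := hcomm
  refine ⟨liftNCRingHom (F.comp singleOneRingHom) ((Units.coeHom R).comp g) hcomm', ?_, ?_⟩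
  · intro a r
    rw [liftNCRingHom_single]
    change F (single 1 r) * (g (of a) : R) = _
    rw [lift_of, hf, ← map_mul, single_mul_single, one_mul, mul_one]
  · intro u
    rw [liftNCRingHom_single, map_one, one_mul]
    change ((g (t ^ (u : ℤ)) : Rˣ) : R) = _
    rw [map_zpow, lift_t]

theorem hasTop_list {R : Type*} [Ring R]
    {Φ : MonoidAlgebra k (HNNExtension A C₁ C₂ ψ) →+* PowerSeries R} {y : ℤˣ → R} {c : A → R}
    (hc : ∀ a, Φ (single (of a) 1) = PowerSeries.C (c a))
    (hy : ∀ u : ℤˣ, PowerSeries.HasTop 2 (Φ (single (t ^ (u : ℤ)) 1)) (y u))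
    (l : List (ℤˣ × A)) :
    PowerSeries.HasTop (2 * l.length)
      (Φ (single (l.map fun x => t ^ (x.1 : ℤ) * of x.2).prod 1))
      (l.map fun x => y x.1 * c x.2).prod := by
  induction l with
  | nil =>
    simp only [List.map_nil, List.prod_nil, List.length_nil, mul_zero]
    rw [← MonoidAlgebra.one_def, map_one]
    exact PowerSeries.hasTop_one
  | cons x l ih =>
    rw [List.map_cons, List.prod_cons, List.map_cons, List.prod_cons, List.length_cons,
      show 2 * (l.length + 1) = 2 + 0 + 2 * l.length by ring]
    have h1 : ∀ g h : HNNExtension A C₁ C₂ ψ,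
        Φ (single (g * h) 1) = Φ (single g 1) * Φ (single h 1) := fun g h => by
      rw [← map_mul, single_mul_single, one_mul]
    rw [h1, h1]
    refine ((hy _).mul ?_).mul ih
    rw [hc]
    exact PowerSeries.hasTop_C _

open TwistedTensor in
/-- A homomorphism from the group algebra is injective as soon as the top coefficients of normal
words act as expected. -/
theorem injective_of_hasTop {L : Type w} [DivisionRing L] {δ : Data L}
    {f : MonoidAlgebra k A →+* L} (hf : Function.Injective f) {d : TransversalPair A C₁ C₂}
    {W : List (ℤˣ × A) → List δ.Letter}
    (hW : ∀ w w' : NormalWord d, W w.toList = W w'.toList → w.toList = w'.toList)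
    {Φ : MonoidAlgebra k (HNNExtension A C₁ C₂ ψ) →+*
      PowerSeries (AddMonoid.End (TensorRing δ))}
    (hΦ : ∀ (w : NormalWord d) (r : k), ∃ θ,
      PowerSeries.HasTop (2 * w.toList.length) (Φ (single (w.prod ψ) r)) θ ∧
      θ (word [] 1) = word (W w.toList) (f (single w.head r))) :
    Function.Injective Φ := by
  classical
  rw [injective_iff_map_eq_zero]
  intro x hx
  by_contra hne
  let nf : HNNExtension A C₁ C₂ ψ → NormalWord d := NormalWord.equiv ψ d
  have hnf : ∀ g, (nf g).prod ψ = g := (NormalWord.equiv ψ d).symm_apply_apply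
  have hsupp : x.coeff.support.Nonempty := by
    rw [Finsupp.support_nonempty_iff]
    intro h
    exact hne (MonoidAlgebra.coeff_injective h)
  obtain ⟨g₀, hg₀, hn⟩ := Finset.exists_mem_eq_sup _ hsupp fun g => (nf g).toList.length
  set n := x.coeff.support.sup fun g => (nf g).toList.length with hn_def
  have hterm : ∀ g ∈ x.coeff.support,
      coeff (W (nf g₀).toList) (PowerSeries.coeff (2 * n) (Φ (single g (x.coeff g))) (word [] 1)) =
        if (nf g).toList = (nf g₀).toList then f (single (nf g).head (x.coeff g)) else 0 := by
    intro g hg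
    obtain ⟨θ, hθ, hθ'⟩ := hΦ (nf g) (x.coeff g)
    rw [hnf] at hθ
    have hle : (nf g).toList.length ≤ n := Finset.le_sup (f := fun g => (nf g).toList.length) hg
    rcases hle.lt_or_eq with hlt | heq
    · rw [hθ.1 _ (by omega), if_neg]
      · exact map_zero _
      · intro h
        rw [h, ← hn] at hlt
        exact lt_irrefl _ hlt
    · rw [heq] at hθ
      rw [hθ.2, hθ']
      split_ifs with h
      · rw [h, coeff_word_self]
      · exact coeff_word_ne (fun h' => h (hW _ _ h').symm) _
  have hsum : x = ∑ g ∈ x.coeff.support, single g (x.coeff g) := x.sum_coeff_single.symm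
  let ev₀ : PowerSeries (AddMonoid.End (TensorRing δ)) →+ L := AddMonoidHom.mk'
    (fun p => coeff (W (nf g₀).toList)
      ((PowerSeries.coeff (2 * n) p : AddMonoid.End (TensorRing δ)) (word [] 1)))
    fun p q => by rw [map_add]; exact map_add (TwistedTensor.coeff _) _ _
  have h0 : ∑ g ∈ x.coeff.support,
      (if (nf g).toList = (nf g₀).toList then f (single (nf g).head (x.coeff g)) else 0) = 0 := by
    rw [← Finset.sum_congr rfl hterm]
    calc _ = ev₀ (Φ (∑ g ∈ x.coeff.support, single g (x.coeff g))) := by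
          rw [map_sum, map_sum]
          rfl
      _ = 0 := by rw [← hsum, hx, map_zero]
  rw [← Finset.sum_filter, ← map_sum, map_eq_zero_iff f hf] at h0
  have h1 := congrArg (fun p => p.coeff (nf g₀).head) h0
  simp only [MonoidAlgebra.coeff_sum, Finsupp.finsetSum_apply, MonoidAlgebra.coeff_zero,
    Finsupp.zero_apply] at h1
  have hmem : g₀ ∈ x.coeff.support.filter fun g => (nf g).toList = (nf g₀).toList :=
    Finset.mem_filter.2 ⟨hg₀, rfl⟩
  rw [Finset.sum_eq_single_of_mem g₀ hmem] at h1
  · rw [MonoidAlgebra.coeff_single, Finsupp.single_apply, if_pos rfl] at h1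
    exact Finsupp.mem_support_iff.1 hg₀ h1
  · intro g hg hgne
    rw [MonoidAlgebra.coeff_single, Finsupp.single_apply, if_neg]
    intro h
    exact hgne ((NormalWord.equiv ψ d).injective (NormalWord.ext h (Finset.mem_filter.1 hg).2))

end HNNExtension

namespace HNNExtension

open MonoidAlgebra NormalWord TwistedTensor

/-- Adjoining two letters centralizing two division subrings. -/
def signData {L : Type w} [DivisionRing L] (E : ℤˣ → Subfield L) (ι : ℤˣ → Type w)
    (b : ∀ u, Module.Basis (ι u) (E u) L) : Data L :=
  ⟨ℤˣ, E, fun u => (E u).subtype, ι, b⟩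

variable {A : Type*} {L : Type w} [DivisionRing L] {E : ℤˣ → Subfield L} {ι : ℤˣ → Type w}
  {b : ∀ u, Module.Basis (ι u) (E u) L}

variable (b) in
/-- The word of letters attached to the tail of a normal word. -/
def letters (idx : ∀ u, L → ι u) (f : A → L) (τ : Lˣ) :
    List (ℤˣ × A) → List (signData E ι b).Letter
  | [] => []
  | x :: l => ⟨-x.1, idx (-x.1) (τ ^ (x.1 : ℤ) : Lˣ)⟩ :: ⟨x.1, idx x.1 (f x.2)⟩ ::
      letters idx f τ l

variable {idx : ∀ u, L → ι u} {f : A → L} {τ : Lˣ} {S : ℤˣ → Set A}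

theorem letters_injOn (hf : Function.Injective f)
    (hidx : ∀ u, ∀ a ∈ S u, b u (idx u (f a)) = f a) :
    ∀ {l l' : List (ℤˣ × A)}, (∀ x ∈ l, x.2 ∈ S x.1) → (∀ x ∈ l', x.2 ∈ S x.1) →
      letters b idx f τ l = letters b idx f τ l' → l = l'
  | [], [], _, _, _ => rfl
  | [], _ :: _, _, _, h => by simp [letters] at h
  | _ :: _, [], _, _, h => by simp [letters] at h
  | ⟨u, a⟩ :: l, ⟨u', a'⟩ :: l', hl, hl', h => by
    rw [letters, letters, List.cons_eq_cons, List.cons_eq_cons] at h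
    obtain ⟨-, h, h'⟩ := h
    have ih := letters_injOn hf hidx (fun x hx => hl x (List.mem_cons_of_mem _ hx))
      (fun x hx => hl' x (List.mem_cons_of_mem _ hx)) h'
    have hu : u = u' := congrArg Sigma.fst h
    subst hu
    have hi : idx u (f a) = idx u (f a') := eq_of_heq (Sigma.mk.inj h).2
    have ha := hidx u a (hl _ List.mem_cons_self)
    rw [hi, hidx u a' (hl' _ List.mem_cons_self)] at ha
    rw [ih, hf ha]

theorem units_neg_ne (u : ℤˣ) : -u ≠ u := by
  rcases Int.units_eq_one_or u with rfl | rfl <;> decide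

variable [Group A] {C₁ C₂ : Subgroup A}

/-- The action of the tail of a normal word. -/
theorem list_prod_apply (hf : Function.Injective f) (hf1 : f 1 = 1)
    (hidx : ∀ u, ∀ a ∈ S u, b u (idx u (f a)) = f a)
    (hidxτ : ∀ u : ℤˣ, b (-u) (idx (-u) (τ ^ (u : ℤ) : Lˣ)) = (τ ^ (u : ℤ) : Lˣ))
    {y : ℤˣ → AddMonoid.End (TensorRing (signData E ι b))}
    {c : A → AddMonoid.End (TensorRing (signData E ι b))}
    (hc : ∀ a m, c a m = f a • m)
    (hy : ∀ u m, y u m = sqShift (signData E ι b) (-u)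
      (((τ ^ (u : ℤ) : Lˣ) : L) • sqShift (signData E ι b) u m)) :
    ∀ l : List (ℤˣ × A), l.IsChain (fun x x' => x.2 ∈ toSubgroup C₁ C₂ x.1 → x.1 = x'.1) →
      (∀ x ∈ l, x.2 ∈ S x.1) →
      (l.map fun x => y x.1 * c x.2).prod (word [] 1) = word (letters b idx f τ l) 1
  | [], _, _ => rfl
  | ⟨u, a⟩ :: l, hl, hS => by
    have ih := list_prod_apply hf hf1 hidx hidxτ hc hy l (List.isChain_cons.1 hl).2
      fun x hx => hS x (List.mem_cons_of_mem _ hx)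
    rw [List.map_cons, List.prod_cons]
    change y u (c a ((l.map fun x => y x.1 * c x.2).prod (word [] 1))) = _
    have h1 : ¬ Stalls ((⟨u, idx u (f a)⟩ : (signData E ι b).Letter) ::
        letters b idx f τ l) := by
      rintro ⟨j, i, i', l', h, hi⟩
      rw [List.cons_eq_cons] at h
      obtain ⟨h, h'⟩ := h
      have hj : u = j := congrArg Sigma.fst h
      subst hj
      have hi' : idx u (f a) = i := eq_of_heq (Sigma.mk.inj h).2
      subst hi'
      have ha : a = 1 := hf ((hidx u a (hS _ List.mem_cons_self)).symm.trans (hi.trans hf1.symm))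
      cases l with
      | nil => simp [letters] at h'
      | cons x l =>
        rw [letters, List.cons_eq_cons] at h'
        have hx : -x.1 = u := congrArg Sigma.fst h'.1
        have := (List.isChain_cons.1 hl).1 x rfl (by rw [ha]; exact one_mem _)
        exact units_neg_ne u ((congrArg Neg.neg this).trans hx)
    have h2 : ¬ Stalls ((⟨-u, idx (-u) (τ ^ (u : ℤ) : Lˣ)⟩ : (signData E ι b).Letter) ::
        ⟨u, idx u (f a)⟩ :: letters b idx f τ l) := by
      rintro ⟨j, i, i', l', h, hi⟩
      rw [List.cons_eq_cons, List.cons_eq_cons] at h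
      have hj : -u = j := congrArg Sigma.fst h.1
      have hj' : u = j := congrArg Sigma.fst h.2.1
      exact units_neg_ne u (hj.trans hj'.symm)
    rw [ih, hc, hy, smul_word, mul_one]
    nth_rw 1 [← hidx u a (hS _ List.mem_cons_self)]
    have e1 := sqShift_basis h1
    have e2 := sqShift_basis h2
    refine Eq.trans (congrArg (fun m => sqShift (signData E ι b) (-u)
      (((τ ^ (u : ℤ) : Lˣ) : L) • m)) e1) ?_
    rw [smul_word, mul_one]
    refine Eq.trans (congrArg (fun z => sqShift (signData E ι b) (-u)
      (word _ z)) (hidxτ u).symm) ?_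
    exact e2

end HNNExtension

namespace HNNExtension

open MonoidAlgebra NormalWord TwistedTensor

set_option maxHeartbeats 1000000 in
/-- A sufficient condition for embedding the group algebra of an HNN extension. -/
theorem exists_embedding_of_linearIndepOn {k A : Type*} [DivisionRing k] [Group A]
    {C₁ C₂ : Subgroup A} {ψ : C₁ ≃* C₂} {L : Type w} [DivisionRing L]
    {f : MonoidAlgebra k A →+* L} (hf : Function.Injective f) {τ : Lˣ}
    (hτ : ∀ (c : C₁) (r : k), (τ : L) * f (single (c : A) r) = f (single (ψ c : A) r) * τ)
    {E : ℤˣ → Subfield L}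
    (hE : ∀ u, ∀ c ∈ toSubgroup C₁ C₂ u, ∀ r, f (single c r) ∈ E u)
    (d : TransversalPair A C₁ C₂) (hone : ∀ u, (1 : A) ∈ d.set u)
    (hli : ∀ u : ℤˣ, LinearIndepOn (E u) id
      (insert ((τ ^ (-u : ℤ) : Lˣ) : L) ((fun a => f (single a 1)) '' d.set u))) :
    ∃ (Q : Type w) (_ : DivisionRing Q)
      (Φ : MonoidAlgebra k (HNNExtension A C₁ C₂ ψ) →+* Q), Function.Injective Φ := by
  classical
  let ι : ℤˣ → Type w := fun u => (hli u).extend (Set.subset_univ _)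
  let b : ∀ u, Module.Basis (ι u) (E u) L := fun u => Module.Basis.extend (hli u)
  have hb : ∀ u : ℤˣ, ∀ x ∈ insert ((τ ^ (-u : ℤ) : Lˣ) : L) ((fun a => f (single a 1)) '' d.set u),
      ∃ i, b u i = x := fun u x hx =>
    ⟨⟨x, (hli u).subset_extend _ hx⟩, Module.Basis.extend_apply_self _ _⟩
  have hf1 : f (single 1 1) = 1 := map_one f
  have hbo : ∀ u, ∃ i, b u i = 1 := fun u =>
    hb u 1 (Set.mem_insert_of_mem _ ⟨1, hone u, hf1⟩)
  choose o ho using hbo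
  let idx : ∀ u, L → ι u := fun u x => if h : ∃ i, b u i = x then h.choose else o u
  have hidx' : ∀ u x, (∃ i, b u i = x) → b u (idx u x) = x := fun u x h => by
    change b u (dite _ _ _) = x
    rw [dif_pos h]
    exact h.choose_spec
  have hidx : ∀ u, ∀ a ∈ d.set u, b u (idx u (f (single a 1))) = f (single a 1) :=
    fun u a ha => hidx' u _ (hb u _ (Set.mem_insert_of_mem _ ⟨a, ha, rfl⟩))
  have hidxτ : ∀ u : ℤˣ, b (-u) (idx (-u) (τ ^ (u : ℤ) : Lˣ)) = (τ ^ (u : ℤ) : Lˣ) := fun u =>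
    hidx' _ _ (hb _ _ (Or.inl (by rw [Units.val_neg, neg_neg])))
  let δ : Data L := signData E ι b
  have hinj : Function.Injective fun a : A => f (single a 1) := fun a a' h =>
    MonoidAlgebra.of_injective (R := k) (hf h)
  -- the embedding into power series
  let F : MonoidAlgebra k A →+* PowerSeries (TensorRing δ) :=
    (PowerSeries.C.comp (C δ)).comp f
  let ct : L →+* PowerSeries (TensorRing δ) := PowerSeries.C.comp (C δ)
  let z : ℤˣ → TensorRing δ := fun u => T δ u
  have hz : ∀ u (e : L), e ∈ E u → SemiconjBy (z u) (C δ e) (C δ e) := fun u e he =>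
    T_mul_C (d := δ) u ⟨e, he⟩
  let v₁ := (PowerSeries.isUnit_linear (-z 1)).unit
  let v₂ := (PowerSeries.isUnit_linear (z (-1))).unit
  have hv₁ : (v₁ : PowerSeries (TensorRing δ)) = 1 + PowerSeries.C (-z 1) * PowerSeries.X := rfl
  have hv₂ : (v₂ : PowerSeries (TensorRing δ)) = 1 + PowerSeries.C (z (-1)) * PowerSeries.X := rfl
  have hlin : ∀ {x : TensorRing δ} {e : L}, SemiconjBy x (C δ e) (C δ e) →
      SemiconjBy (1 + PowerSeries.C x * PowerSeries.X) (ct e) (ct e) := fun {x e} h =>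
    (SemiconjBy.one_left _).add_left
      ((h.map (PowerSeries.C (R := TensorRing δ))).mul_left (PowerSeries.commute_X _).symm)
  let s : (PowerSeries (TensorRing δ))ˣ := v₂ * Units.map ct.toMonoidHom τ * v₁⁻¹
  have hs : ∀ (c : C₁) (r : k),
      (s : PowerSeries (TensorRing δ)) * F (single (c : A) r) = F (single (ψ c : A) r) * s := by
    intro c r
    have h1 : SemiconjBy (v₁ : PowerSeries (TensorRing δ)) (ct (f (single (c : A) r)))
        (ct (f (single (c : A) r))) :=
      hlin (hz 1 _ (hE 1 _ c.2 _)).neg_left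
    have h2 : SemiconjBy (v₂ : PowerSeries (TensorRing δ)) (ct (f (single (ψ c : A) r)))
        (ct (f (single (ψ c : A) r))) :=
      hlin (hz (-1) _ (hE (-1) _ (ψ c).2 _))
    have h3 : SemiconjBy (ct τ) (ct (f (single (c : A) r))) (ct (f (single (ψ c : A) r))) :=
      SemiconjBy.map (hτ c r) ct
    exact (h2.mul_left h3).mul_left h1.units_inv_symm_left
  obtain ⟨Φ, hΦA, hΦt⟩ := exists_monoidAlgebra_lift F s hs
  obtain ⟨L', hL', χ, hχ⟩ := TwistedTensor.exists_divisionRing_embedding δ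
  obtain ⟨Q, hQ, φ, hφ⟩ := PowerSeriesEmbedding.exists_divisionRing_embedding L'
  have hχ' : Function.Injective (PowerSeries.map χ) := fun p q h => PowerSeries.ext fun n =>
    hχ (by simpa using congrArg (PowerSeries.coeff n) h)
  refine ⟨Q, hQ, φ.comp ((PowerSeries.map χ).comp Φ), hφ.comp (hχ'.comp ?_)⟩
  -- the action
  let σ : ℤˣ → AddMonoid.End (TensorRing δ) := fun u => sqShift δ u
  have hσ : ∀ u, σ u * σ u = 0 := fun u => by
    ext1 x
    exact sqShift_sqShift (d := δ) (fun _ _ => rfl) (ho u) x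
  let ρ : TensorRing δ →+* AddMonoid.End (TensorRing δ) := act isTwisted_sqShift
  have hρz : ∀ u, ρ (z u) = σ u := fun u => by
    ext1 x
    exact act_T _ _ _
  have hρC : ∀ e x, ρ (C δ e) x = e • x := fun e x => act_C isTwisted_sqShift _ _
  let P := PowerSeries.map ρ
  let y : ℤˣ → AddMonoid.End (TensorRing δ) := fun u => σ (-u) * (ρ (C δ (τ ^ (u : ℤ) : Lˣ)) * σ u)
  have hPv₁ : P v₁ = 1 + PowerSeries.C (-σ 1) * PowerSeries.X := by
    rw [hv₁, map_add, map_mul, PowerSeries.map_C, PowerSeries.map_X, map_one, map_neg, hρz]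
  have hPv₂ : P v₂ = 1 + PowerSeries.C (σ (-1)) * PowerSeries.X := by
    rw [hv₂, map_add, map_mul, PowerSeries.map_C, PowerSeries.map_X, map_one, hρz]
  have hPv₁' : P (v₁⁻¹ : (PowerSeries (TensorRing δ))ˣ) =
      1 + PowerSeries.C (σ 1) * PowerSeries.X := by
    refine (left_inv_eq_right_inv (a := P v₁) ?_ ?_).symm
    · rw [hPv₁, PowerSeries.linear_mul_linear (hσ 1)]
    · rw [← map_mul, Units.mul_inv, map_one]
  have hPv₂' : P (v₂⁻¹ : (PowerSeries (TensorRing δ))ˣ) =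
      1 + PowerSeries.C (-σ (-1)) * PowerSeries.X := by
    refine (left_inv_eq_right_inv (a := P v₂) ?_ ?_).symm
    · have := PowerSeries.linear_mul_linear (r := -σ (-1)) (by rw [neg_mul_neg, hσ])
      rw [neg_neg] at this
      rw [hPv₂, this]
    · rw [← map_mul, Units.mul_inv, map_one]
  have hPct : ∀ e, P (ct e) = PowerSeries.C (ρ (C δ e)) := fun e => PowerSeries.map_C _ _
  have hy : ∀ u : ℤˣ, PowerSeries.HasTop 2 ((P.comp Φ) (single (t ^ (u : ℤ)) 1)) (y u) := by
    intro u
    rw [RingHom.comp_apply, hΦt]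
    rcases Int.units_eq_one_or u with rfl | rfl
    · have h1 : ((s ^ ((1 : ℤˣ) : ℤ) : (PowerSeries (TensorRing δ))ˣ) : PowerSeries (TensorRing δ)) =
          v₂ * (ct τ * (v₁⁻¹ : (PowerSeries (TensorRing δ))ˣ)) := by
        rw [Units.val_one, zpow_one, ← mul_assoc]
        rfl
      rw [h1, map_mul, map_mul, hPv₂, hPv₁', hPct]
      have := (PowerSeries.hasTop_linear (σ (-1))).mul
        ((PowerSeries.hasTop_C (ρ (C δ τ))).mul (PowerSeries.hasTop_linear (σ 1)))
      simpa [y] using this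
    · have h1 : ((s ^ ((-1 : ℤˣ) : ℤ) : (PowerSeries (TensorRing δ))ˣ) : PowerSeries (TensorRing δ)) =
          v₁ * (ct (τ⁻¹ : Lˣ) * (v₂⁻¹ : (PowerSeries (TensorRing δ))ˣ)) := by
        rw [Units.val_neg, Units.val_one, zpow_neg_one, mul_inv_rev, mul_inv_rev, inv_inv,
          ← map_inv]
        rfl
      rw [h1, map_mul, map_mul, hPv₁, hPv₂', hPct]
      have := (PowerSeries.hasTop_linear (-σ 1)).mul
        ((PowerSeries.hasTop_C (ρ (C δ (τ⁻¹ : Lˣ)))).mul (PowerSeries.hasTop_linear (-σ (-1))))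
      simpa [y] using this
  have key : Function.Injective (P.comp Φ) := by
    refine injective_of_hasTop (δ := δ) (d := d) hf
      (W := letters b idx (fun a => f (single a 1)) τ) ?_ ?_
    · intro w w' h
      exact letters_injOn (S := d.set) hinj hidx (fun x hx => w.mem_set x.1 x.2 hx)
        (fun x hx => w'.mem_set x.1 x.2 hx) h
    · intro w r
      have hc : ∀ a, (P.comp Φ) (single (of a) 1) = PowerSeries.C (ρ (C δ (f (single a 1)))) :=
        fun a => by
          rw [RingHom.comp_apply, hΦA]
          exact hPct _
      refine ⟨ρ (C δ (f (single w.head r))) * (w.toList.map fun x => y x.1 *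
        ρ (C δ (f (single x.2 1)))).prod, ?_, ?_⟩
      · have h1 := hasTop_list (Φ := P.comp Φ) (c := fun a => ρ (C δ (f (single a 1)))) hc hy
          w.toList
        have h2 := (PowerSeries.hasTop_C (ρ (C δ (f (single w.head r))))).mul h1
        rw [zero_add] at h2
        have h3 : (P.comp Φ) (single (w.prod ψ) r) =
            PowerSeries.C (ρ (C δ (f (single w.head r)))) *
            (P.comp Φ) (single (w.toList.map fun x => t ^ (x.1 : ℤ) * of x.2).prod 1) := by
          rw [← hPct]
          change _ = P (F _) * _
          rw [← hΦA, ← RingHom.comp_apply P, ← map_mul, single_mul_single, mul_one]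
          rfl
        rw [h3]
        exact h2
      · change ρ (C δ (f (single w.head r))) ((w.toList.map fun x => y x.1 *
          ρ (C δ (f (single x.2 1)))).prod (word [] 1)) = _
        have := list_prod_apply (S := d.set) (τ := τ) (C₁ := C₁) (C₂ := C₂) hinj hf1 hidx hidxτ
          (y := y) (c := fun a => ρ (C δ (f (single a 1)))) (fun a m => hρC _ _)
          (fun u m => congrArg (sqShift δ (-u)) (hρC _ _)) w.toList w.chain
          (fun x hx => w.mem_set x.1 x.2 hx)
        refine (congrArg _ this).trans ?_
        refine (hρC _ _).trans ?_
        rw [smul_word, mul_one]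
  rw [RingHom.coe_comp] at key
  exact key.of_comp

end HNNExtension

namespace Hughes

open MonoidAlgebra

theorem _root_.LocallyIndicable.subgroup {A : Type*} [Group A] (hA : LocallyIndicable A)
    (C : Subgroup A) : LocallyIndicable C := by
  intro H hH hfg
  have e : H ≃* H.map C.subtype := H.equivMapOfInjective C.subtype C.subtype_injective
  have := (Group.fg_iff_subgroup_fg _).2 hfg
  obtain ⟨f, hf⟩ := hA (H.map C.subtype)
    (fun h => hH ((Subgroup.map_eq_bot_iff_of_injective H C.subtype_injective).1 h))
    ((Group.fg_iff_subgroup_fg _).1 (Group.fg_of_surjective (f := e.toMonoidHom) e.surjective))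
  exact ⟨f.comp e.toMonoidHom, hf.comp e.surjective⟩

/-- An isomorphism of subgroups extends to the division rings that they generate in a Hughes-free
division ring. -/
theorem exists_ringHom_closure {k A : Type*} [DivisionRing k] [Group A] {D : Type w}
    [DivisionRing D] {φ : MonoidAlgebra k A →+* D} (hA : LocallyIndicable A)
    (hφ : IsHughesFreeEmbedding φ) {C₁ C₂ : Subgroup A} (ψ : C₁ ≃* C₂) :
    ∃ (E : Subfield D) (α : E →+* D), ∀ (c : C₁) (r : k), ∃ h : φ (single (c : A) r) ∈ E,
      α ⟨_, h⟩ = φ (single (ψ c : A) r) := by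
  let g : Bool → C₁ →* A := fun i => if i then C₁.subtype else C₂.subtype.comp ψ.toMonoidHom
  have hg : ∀ i, Function.Injective (g i) := fun i => by
    cases i
    · exact C₂.subtype_injective.comp ψ.injective
    · exact C₁.subtype_injective
  let Φ : Bool → MonoidAlgebra k C₁ →+* D := fun i => φ.comp (mapDomainRingHom k (g i))
  have hΦ : ∀ i b c, Φ i (single b c) = φ (single (g i b) c) := fun i b c => by
    change φ (mapDomain _ _) = _
    rw [mapDomain_single]
  obtain ⟨α, hα⟩ := exists_ringHom_gen (φ := Φ) (hA.subgroup C₁)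
    (hughesFree_of_isHughesFreeEmbedding hφ g hg hΦ) ⊤ true false
  refine ⟨gen Φ ⊤ true, α, fun c r => ?_⟩
  have h1 : unit Φ r c true = φ (single (c : A) r) := hΦ true c r
  have h2 : unit Φ r c false = φ (single (ψ c : A) r) := hΦ false c r
  have h3 := hα c trivial r
  rw [h2] at h3
  exact ⟨h1 ▸ unit_mem_gen (φ := Φ) (Subgroup.mem_top c) r true, by
    rw [← h3]
    congr 2
    exact h1.symm⟩

end Hughes

namespace TwistedTensor

theorem T_ne_C {D : Type w} [DivisionRing D] (d : Data D) (j : d.J) (x : D) : T d j ≠ C d x := by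
  intro h
  obtain ⟨i⟩ := (d.basis j).index_nonempty
  have h1 : T d j * C d (d.basis j i) = C d (x * d.basis j i) := by rw [h, map_mul]
  rw [T_mul, C_def, C_def, shift_basis] at h1
  have h2 := congrArg (coeff [⟨j, i⟩]) h1
  rw [coeff_word_self, coeff_word_ne (by simp)] at h2
  exact one_ne_zero h2

end TwistedTensor

namespace HNNExtension

open MonoidAlgebra TwistedTensor NormalWord

/-- Coset representatives of a subgroup stay independent in a larger division ring, even together
with an element outside of the smaller division ring. -/
theorem linearIndepOn_insert_image {k A : Type*} [DivisionRing k] [Group A] {D : Type w}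
    [DivisionRing D] {φ : MonoidAlgebra k A →+* D} (hA : LocallyIndicable A)
    (hφ : IsHughesFreeEmbedding φ) {L : Type w} [DivisionRing L] (χ : D →+* L) (H : Subgroup A)
    {S : Set A} (hS : Subgroup.IsComplement (H : Set A) S) {x : L} (hx : ∀ e, χ e ≠ x) :
    LinearIndepOn ((Hughes.gen (fun _ : Unit => φ) H ()).map χ) id
      (insert x ((fun a => χ (φ (single a 1))) '' S)) := by
  have hfree : Hughes.HughesFree fun _ : Unit => φ :=
    Hughes.hughesFree_of_isHughesFreeEmbedding hφ (fun _ => MonoidHom.id A)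
      (fun _ => Function.injective_id) fun _ _ _ => rfl
  have h1 := Hughes.linearIndependent_coset hA hfree H () (fun s : S => (s : A)) fun s s' h => by
    obtain ⟨r, -, hr⟩ := Subgroup.isComplement_iff_existsUnique_mul_inv_mem.1 hS (s : A)
    exact (hr s (by simp [H.one_mem])).trans (hr s' h).symm
  have h2 : LinearIndependent ((Hughes.gen (fun _ : Unit => φ) H ()).map χ)
      fun s : S => χ (φ (single (s : A) 1)) := by
    rw [linearIndependent_iff'] at h1 ⊢
    intro t c hc s hs
    have hpre : ∀ s, ∃ e : Hughes.gen (fun _ : Unit => φ) H (), χ e = c s := fun s => by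
      obtain ⟨e, he, he'⟩ := Subfield.mem_map.1 (c s).2
      exact ⟨⟨e, he⟩, he'⟩
    choose e he using hpre
    have h3 : ∑ s ∈ t, e s • Hughes.unit (fun _ : Unit => φ) 1 (s : A) () = 0 := by
      apply χ.injective
      rw [map_sum, map_zero, ← hc]
      refine Finset.sum_congr rfl fun s _ => ?_
      change χ ((e s : D) * φ (single (s : A) 1)) = (c s : L) * χ (φ (single (s : A) 1))
      rw [map_mul, he]
    apply Subtype.ext
    rw [← he, h1 t e h3 s hs]
    exact map_zero χ
  have h4 := h2.linearIndepOn_id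
  have h5 : Set.range (fun s : S => χ (φ (single (s : A) 1))) =
      (fun a => χ (φ (single a 1))) '' S := by
    rw [Set.image_eq_range]
  rw [h5] at h4
  refine h4.id_insert fun hmem => ?_
  have h6 : ∀ z ∈ Submodule.span ((Hughes.gen (fun _ : Unit => φ) H ()).map χ)
      ((fun a => χ (φ (single a 1))) '' S), z ∈ χ.range := by
    intro z hz
    induction hz using Submodule.span_induction with
    | mem z hz =>
      obtain ⟨a, -, rfl⟩ := hz
      exact ⟨_, rfl⟩
    | zero => exact zero_mem _
    | add y z _ _ hy hz => exact add_mem hy hz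
    | smul c z _ hz =>
      obtain ⟨e, -, he⟩ := Subfield.mem_map.1 c.2
      exact mul_mem (⟨e, he⟩ : (c : L) ∈ χ.range) hz
  obtain ⟨e, he⟩ := h6 x hmem
  exact hx e he

end HNNExtension

/-- Let `A` be a locally indicable group, `C₁, C₂ ≤ A` subgroups, `ψ : C₁ ≃ C₂` an
isomorphism, and `G = A∗_ψ` the corresponding HNN extension.  If `kA` admits a Hughes-free
embedding into a division ring, then `kG` embeds into a division ring. -/
theorem monoidAlgebra_hnnExtension_embeds_divisionRing
    {k : Type u} [DivisionRing k] {A : Type v} [Group A]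
    (hA : LocallyIndicable A)
    (C₁ C₂ : Subgroup A) (ψ : C₁ ≃* C₂)
    (hDA : ∃ (DA : Type (max u v)) (_ : DivisionRing DA)
      (φA : MonoidAlgebra k A →+* DA), IsHughesFreeEmbedding φA) :
    ∃ (D : Type (max u v)) (_ : DivisionRing D)
      (φ : MonoidAlgebra k (HNNExtension A C₁ C₂ ψ) →+* D),
      Function.Injective φ := by
  obtain ⟨D, _, φ, hφ⟩ := hDA
  obtain ⟨E, α, hα⟩ := Hughes.exists_ringHom_closure hA hφ ψ
  let δ : TwistedTensor.Data D :=
    { J := Unit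
      E := fun _ => E
      α := fun _ => α
      ι := fun _ => Module.Basis.ofVectorSpaceIndex E D
      basis := fun _ => Module.Basis.ofVectorSpace E D }
  obtain ⟨L, _, χ, hχ⟩ := TwistedTensor.exists_divisionRing_embedding δ
  let θ : D →+* L := χ.comp (TwistedTensor.C δ)
  have hT : ∀ e, θ e ≠ χ (TwistedTensor.T δ ()) := fun e he =>
    TwistedTensor.T_ne_C δ () e (hχ he).symm
  let τ : Lˣ := Units.mk0 (χ (TwistedTensor.T δ ())) fun h => hT 0 (by rw [h, map_zero])
  have hτ : ∀ u : ℤˣ, ∀ e, θ e ≠ (τ ^ (-u : ℤ) : Lˣ) := by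
    intro u e he
    rcases Int.units_eq_one_or u with rfl | rfl
    · refine hT e⁻¹ ?_
      rw [map_inv₀, he, ← Units.val_inv_eq_inv_val]
      simp [τ]
    · refine hT e ?_
      rw [he]
      simp [τ]
  choose S hS hS1 using fun u : ℤˣ => (HNNExtension.toSubgroup C₁ C₂ u).exists_isComplement_right 1
  refine HNNExtension.exists_embedding_of_linearIndepOn (f := θ.comp φ) (τ := τ)
    (E := fun u => (Hughes.gen (fun _ : Unit => φ) (HNNExtension.toSubgroup C₁ C₂ u) ()).map θ)
    (θ.injective.comp hφ.1) (fun c r => ?_)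
    (fun u c hc r => Subfield.mem_map.2 ⟨_, Hughes.unit_mem_gen hc r (), rfl⟩)
    ⟨S, hS⟩ hS1 fun u => HNNExtension.linearIndepOn_insert_image hA hφ θ _ (hS u) (hτ u)
  obtain ⟨h, h'⟩ := hα c r
  change χ (TwistedTensor.T δ ()) * χ (TwistedTensor.C δ (φ _)) =
    χ (TwistedTensor.C δ (φ _)) * χ (TwistedTensor.T δ ())
  rw [← map_mul, ← map_mul, ← h']
  exact congrArg χ (TwistedTensor.T_mul_C (d := δ) () ⟨_, h⟩)
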